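/- Main parameter-uniform error estimate: there exists a constant C, independent of ε_1,…,ε_n, M and N (depending only on n, α, T and on the data A, f and the boundary/initial functions), such that ‖U − u‖ ≤ C(M^{−1} + N^{−2}(ln N)³), where u is the (sufficiently smooth) exact solution of Lu = f on Ω with u prescribed on Γ, U is the mesh function solving L^{M,N}U = f at the interior points of the Shishkin mesh with U = u at the boundary mesh points, and ‖·‖ is the maximum over all mesh points of the largest component absolute value. -/

import Mathlib

/-- Auxiliary downward recursion for the Shishkin transition parameters:
`shishkinSigmaAux α lnN ε n m = σ_{n-m}`. -/
noncomputable def shishkinSigmaAux (α lnN : ℝ) (ε : ℕ → ℝ) (n : ℕ) : ℕ → ℝ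
  | 0 => min (1 / 4) (2 * Real.sqrt (ε n / α) * lnN)
  | m + 1 => min (shishkinSigmaAux α lnN ε n m / 2)
      (2 * Real.sqrt (ε (n - (m + 1)) / α) * lnN)

/-- The Shishkin transition parameter `σ_r` (for `1 ≤ r ≤ n`), with the
convention `σ_0 = 0`. -/
noncomputable def shishkinSigma (α N : ℝ) (ε : ℕ → ℝ) (n r : ℕ) : ℝ :=
  if r = 0 then 0 else shishkinSigmaAux α (Real.log N) ε n (n - r)

/-- The mesh index of the transition point `σ_r`: on the Shishkin mesh with
`N = 2^{n+p+1}` intervals, `σ_r` is the mesh point with index `2^{r+p-1}`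
(and `σ_0 = 0` has index `0`). -/
def meshIdx (p r : ℕ) : ℕ := if r = 0 then 0 else 2 ^ (r + p - 1)

/-- `xm : ℕ → ℝ` is the piecewise-uniform Shishkin mesh on `[0,1]` with
`N = 2^{n+p+1}` mesh intervals: it is uniform with `N/2^{n+1}` intervals on
`[0,σ₁]`, `N/2^{n-r+2}` intervals on `(σ_r,σ_{r+1}]`, `N/2` intervals on
`(σ_n, 1−σ_n]`, and is symmetric about `1/2`. -/
def IsShishkinMesh (α : ℝ) (ε : ℕ → ℝ) (n p N : ℕ) (xm : ℕ → ℝ) : Prop :=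
  xm 0 = 0 ∧ xm N = 1 ∧
  (∀ r : ℕ, 1 ≤ r → r ≤ n → ∀ j : ℕ, meshIdx p (r - 1) ≤ j → j ≤ meshIdx p r →
    xm j = shishkinSigma α (N : ℝ) ε n (r - 1)
      + ((j - meshIdx p (r - 1) : ℕ) : ℝ)
          / ((meshIdx p r - meshIdx p (r - 1) : ℕ) : ℝ)
          * (shishkinSigma α (N : ℝ) ε n r - shishkinSigma α (N : ℝ) ε n (r - 1))) ∧
  (∀ j : ℕ, N / 4 ≤ j → j ≤ N - N / 4 →
    xm j = shishkinSigma α (N : ℝ) ε n n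
      + ((j - N / 4 : ℕ) : ℝ) / ((N / 2 : ℕ) : ℝ)
          * (1 - 2 * shishkinSigma α (N : ℝ) ε n n)) ∧
  (∀ j ≤ N, xm (N - j) = 1 - xm j)

/-- The discrete operator `L^{M,N}` applied to the vector mesh function `Ψ`
(component `i`, space index `j`, time index `k`), on the mesh
`x : ℕ → ℝ`, `t : ℕ → ℝ`:
`L^{M,N}Ψ = D_t⁻ Ψ − ε_i δ_x² Ψ + Σ_l a_il Ψ_l`. -/
noncomputable def discreteL (n : ℕ) (ε : ℕ → ℝ) (A : ℕ → ℕ → ℝ → ℝ → ℝ)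
    (x t : ℕ → ℝ) (Ψ : ℕ → ℕ → ℕ → ℝ) (i j k : ℕ) : ℝ :=
  (Ψ i j k - Ψ i j (k - 1)) / (t k - t (k - 1))
    - ε i * (((Ψ i (j + 1) k - Ψ i j k) / (x (j + 1) - x j)
          - (Ψ i j k - Ψ i (j - 1) k) / (x j - x (j - 1)))
        / ((x (j + 1) - x (j - 1)) / 2))
    + ∑ l ∈ Finset.Icc 1 n, A i l (x j) (t k) * Ψ l j k

section UniformConvergence

open scoped ContDiff

variable {n : ℕ}

/-- Joint smoothness of a function of two real variables. -/
def Smooth2 (F : ℝ → ℝ → ℝ) : Prop := ContDiff ℝ ∞ (fun p : ℝ × ℝ => F p.1 p.2)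

/-- Partial derivative in the first variable. -/
noncomputable def dX (F : ℝ → ℝ → ℝ) (x t : ℝ) : ℝ := deriv (fun y => F y t) x

/-- Partial derivative in the second variable. -/
noncomputable def dT (F : ℝ → ℝ → ℝ) (x t : ℝ) : ℝ := deriv (fun s => F x s) t

namespace Smooth2

variable {F G : ℝ → ℝ → ℝ}

theorem hasFDerivAt (hF : Smooth2 F) (x t : ℝ) :
    HasFDerivAt (fun p : ℝ × ℝ => F p.1 p.2) (fderiv ℝ (fun p : ℝ × ℝ => F p.1 p.2) (x, t)) (x, t) :=
  (hF.differentiable (by simp)).differentiableAt.hasFDerivAt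

theorem hasDerivAt_fst' (hF : Smooth2 F) (x t : ℝ) :
    HasDerivAt (fun y => F y t) (fderiv ℝ (fun p : ℝ × ℝ => F p.1 p.2) (x, t) (1, 0)) x :=
  HasFDerivAt.comp_hasDerivAt (f := fun y => (y, t)) x (hF.hasFDerivAt x t)
    ((hasDerivAt_id x).prodMk (hasDerivAt_const x t))

theorem hasDerivAt_snd' (hF : Smooth2 F) (x t : ℝ) :
    HasDerivAt (fun s => F x s) (fderiv ℝ (fun p : ℝ × ℝ => F p.1 p.2) (x, t) (0, 1)) t :=
  HasFDerivAt.comp_hasDerivAt (f := fun s => (x, s)) t (hF.hasFDerivAt x t)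
    ((hasDerivAt_const t x).prodMk (hasDerivAt_id t))

theorem dX_eq (hF : Smooth2 F) (x t : ℝ) :
    dX F x t = fderiv ℝ (fun p : ℝ × ℝ => F p.1 p.2) (x, t) (1, 0) :=
  (hF.hasDerivAt_fst' x t).deriv

theorem dT_eq (hF : Smooth2 F) (x t : ℝ) :
    dT F x t = fderiv ℝ (fun p : ℝ × ℝ => F p.1 p.2) (x, t) (0, 1) :=
  (hF.hasDerivAt_snd' x t).deriv

theorem hasDerivAt_fst (hF : Smooth2 F) (x t : ℝ) : HasDerivAt (fun y => F y t) (dX F x t) x :=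
  hF.dX_eq x t ▸ hF.hasDerivAt_fst' x t

theorem hasDerivAt_snd (hF : Smooth2 F) (x t : ℝ) : HasDerivAt (fun s => F x s) (dT F x t) t :=
  hF.dT_eq x t ▸ hF.hasDerivAt_snd' x t

theorem fderiv_apply (hF : Smooth2 F) (v : ℝ × ℝ) :
    ContDiff ℝ ∞ (fun p : ℝ × ℝ => fderiv ℝ (fun p : ℝ × ℝ => F p.1 p.2) p v) :=
  (ContDiff.fderiv_right (m := ∞) hF (by simp)).clm_apply contDiff_const

theorem dX (hF : Smooth2 F) : Smooth2 (dX F) := by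
  have : (fun p : ℝ × ℝ => _root_.dX F p.1 p.2) =
      fun p : ℝ × ℝ => fderiv ℝ (fun p : ℝ × ℝ => F p.1 p.2) p (1, 0) := by
    funext p; exact hF.dX_eq p.1 p.2
  rw [Smooth2, this]; exact hF.fderiv_apply _

theorem dT (hF : Smooth2 F) : Smooth2 (dT F) := by
  have : (fun p : ℝ × ℝ => _root_.dT F p.1 p.2) =
      fun p : ℝ × ℝ => fderiv ℝ (fun p : ℝ × ℝ => F p.1 p.2) p (0, 1) := by
    funext p; exact hF.dT_eq p.1 p.2
  rw [Smooth2, this]; exact hF.fderiv_apply _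

theorem dX_dT (hF : Smooth2 F) : _root_.dX (_root_.dT F) = _root_.dT (_root_.dX F) := by
  funext x t
  have hd : DifferentiableAt ℝ (fderiv ℝ (fun p : ℝ × ℝ => F p.1 p.2)) (x, t) :=
    ((ContDiff.fderiv_right (m := ∞) hF (by simp)).differentiable (by simp)).differentiableAt
  have h1 : ∀ v w : ℝ × ℝ,
      fderiv ℝ (fun p : ℝ × ℝ => fderiv ℝ (fun p : ℝ × ℝ => F p.1 p.2) p v) (x, t) w
        = fderiv ℝ (fderiv ℝ (fun p : ℝ × ℝ => F p.1 p.2)) (x, t) w v := by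
    intro v w
    rw [fderiv_clm_apply hd (differentiableAt_const v)]
    simp
  have hsym : IsSymmSndFDerivAt ℝ (fun p : ℝ × ℝ => F p.1 p.2) (x, t) :=
    (ContDiff.contDiffAt hF).isSymmSndFDerivAt
      (by simpa using WithTop.coe_le_coe.2 (le_top (a := (2 : ℕ∞))))
  have e1 : (fun p : ℝ × ℝ => _root_.dT F p.1 p.2) =
      fun p : ℝ × ℝ => fderiv ℝ (fun p : ℝ × ℝ => F p.1 p.2) p (0, 1) := by
    funext p; exact hF.dT_eq p.1 p.2
  have e2 : (fun p : ℝ × ℝ => _root_.dX F p.1 p.2) =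
      fun p : ℝ × ℝ => fderiv ℝ (fun p : ℝ × ℝ => F p.1 p.2) p (1, 0) := by
    funext p; exact hF.dX_eq p.1 p.2
  rw [hF.dT.dX_eq, hF.dX.dT_eq, e1, e2, h1, h1]
  exact hsym _ _

theorem continuous (hF : Smooth2 F) : Continuous (fun p : ℝ × ℝ => F p.1 p.2) :=
  ContDiff.continuous hF

theorem add (hF : Smooth2 F) (hG : Smooth2 G) : Smooth2 (fun x t => F x t + G x t) :=
  ContDiff.add hF hG

theorem sub (hF : Smooth2 F) (hG : Smooth2 G) : Smooth2 (fun x t => F x t - G x t) :=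
  ContDiff.sub hF hG

theorem mul (hF : Smooth2 F) (hG : Smooth2 G) : Smooth2 (fun x t => F x t * G x t) :=
  ContDiff.mul hF hG

theorem const_mul (hF : Smooth2 F) (c : ℝ) : Smooth2 (fun x t => c * F x t) :=
  ContDiff.mul contDiff_const hF

theorem sum {ι : Type*} {s : Finset ι} {F : ι → ℝ → ℝ → ℝ} (hF : ∀ i ∈ s, Smooth2 (F i)) :
    Smooth2 (fun x t => ∑ i ∈ s, F i x t) :=
  ContDiff.sum fun i hi => hF i hi

end Smooth2

section Rules

variable {F G : ℝ → ℝ → ℝ}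

theorem dX_add (hF : Smooth2 F) (hG : Smooth2 G) (x t : ℝ) :
    dX (fun x t => F x t + G x t) x t = dX F x t + dX G x t :=
  ((hF.hasDerivAt_fst x t).add (hG.hasDerivAt_fst x t)).deriv

theorem dX_sub (hF : Smooth2 F) (hG : Smooth2 G) (x t : ℝ) :
    dX (fun x t => F x t - G x t) x t = dX F x t - dX G x t :=
  ((hF.hasDerivAt_fst x t).sub (hG.hasDerivAt_fst x t)).deriv

theorem dX_mul (hF : Smooth2 F) (hG : Smooth2 G) (x t : ℝ) :
    dX (fun x t => F x t * G x t) x t = dX F x t * G x t + F x t * dX G x t :=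
  ((hF.hasDerivAt_fst x t).mul (hG.hasDerivAt_fst x t)).deriv

theorem dX_const_mul (hF : Smooth2 F) (c x t : ℝ) :
    dX (fun x t => c * F x t) x t = c * dX F x t :=
  ((hF.hasDerivAt_fst x t).const_mul c).deriv

theorem dX_sum {ι : Type*} {s : Finset ι} {F : ι → ℝ → ℝ → ℝ} (hF : ∀ i ∈ s, Smooth2 (F i))
    (x t : ℝ) : dX (fun x t => ∑ i ∈ s, F i x t) x t = ∑ i ∈ s, dX (F i) x t :=
  (HasDerivAt.fun_sum fun i hi => (hF i hi).hasDerivAt_fst x t).deriv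

theorem dT_add (hF : Smooth2 F) (hG : Smooth2 G) (x t : ℝ) :
    dT (fun x t => F x t + G x t) x t = dT F x t + dT G x t :=
  ((hF.hasDerivAt_snd x t).add (hG.hasDerivAt_snd x t)).deriv

theorem dT_sub (hF : Smooth2 F) (hG : Smooth2 G) (x t : ℝ) :
    dT (fun x t => F x t - G x t) x t = dT F x t - dT G x t :=
  ((hF.hasDerivAt_snd x t).sub (hG.hasDerivAt_snd x t)).deriv

theorem dT_mul (hF : Smooth2 F) (hG : Smooth2 G) (x t : ℝ) :
    dT (fun x t => F x t * G x t) x t = dT F x t * G x t + F x t * dT G x t :=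
  ((hF.hasDerivAt_snd x t).mul (hG.hasDerivAt_snd x t)).deriv

theorem dT_const_mul (hF : Smooth2 F) (c x t : ℝ) :
    dT (fun x t => c * F x t) x t = c * dT F x t :=
  ((hF.hasDerivAt_snd x t).const_mul c).deriv

theorem dT_sum {ι : Type*} {s : Finset ι} {F : ι → ℝ → ℝ → ℝ} (hF : ∀ i ∈ s, Smooth2 (F i))
    (x t : ℝ) : dT (fun x t => ∑ i ∈ s, F i x t) x t = ∑ i ∈ s, dT (F i) x t :=
  (HasDerivAt.fun_sum fun i hi => (hF i hi).hasDerivAt_snd x t).deriv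

end Rules

/-- The open rectangle `(0,1) × (0,T)`, on which equations may be differentiated. -/
def EqOnOpen (T : ℝ) (F G : ℝ → ℝ → ℝ) : Prop :=
  ∀ x ∈ Set.Ioo (0 : ℝ) 1, ∀ t ∈ Set.Ioo 0 T, F x t = G x t

namespace EqOnOpen

variable {T : ℝ} {F G : ℝ → ℝ → ℝ}

theorem dX (h : EqOnOpen T F G) : EqOnOpen T (dX F) (dX G) := fun x hx t ht =>
  Filter.EventuallyEq.deriv_eq <| by
    filter_upwards [isOpen_Ioo.mem_nhds hx] with y hy using h y hy t ht

theorem dT (h : EqOnOpen T F G) : EqOnOpen T (dT F) (dT G) := fun x hx t ht =>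
  Filter.EventuallyEq.deriv_eq <| by
    filter_upwards [isOpen_Ioo.mem_nhds ht] with s hs using h x hx s hs

theorem closed (h : EqOnOpen T F G) (hT : 0 < T) (hF : Smooth2 F) (hG : Smooth2 G) :
    ∀ x ∈ Set.Icc (0 : ℝ) 1, ∀ t ∈ Set.Icc 0 T, F x t = G x t := by
  intro x hx t ht
  have hcl : closure (Set.Ioo (0 : ℝ) 1 ×ˢ Set.Ioo 0 T) = Set.Icc (0 : ℝ) 1 ×ˢ Set.Icc 0 T := by
    rw [closure_prod_eq, closure_Ioo zero_ne_one, closure_Ioo hT.ne]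
  have heq : Set.EqOn (fun p : ℝ × ℝ => F p.1 p.2) (fun p => G p.1 p.2)
      (closure (Set.Ioo (0 : ℝ) 1 ×ˢ Set.Ioo 0 T)) :=
    Set.EqOn.closure (fun p hp => h p.1 hp.1 p.2 hp.2) hF.continuous hG.continuous
  rw [hcl] at heq
  exact heq (Set.mk_mem_prod hx ht)

end EqOnOpen

/-- Smooth functions of one variable that agree on a nondegenerate interval have equal derivatives
up to its end points. -/
theorem deriv_eq_of_eqOn_Icc {g h : ℝ → ℝ} {a b : ℝ} (hab : a < b) (hg : ContDiff ℝ ∞ g)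
    (hh : ContDiff ℝ ∞ h) (heq : Set.EqOn g h (Set.Icc a b)) :
    Set.EqOn (deriv g) (deriv h) (Set.Icc a b) := by
  have h1 : Set.EqOn (deriv g) (deriv h) (Set.Ioo a b) := fun x hx =>
    Filter.EventuallyEq.deriv_eq <| by
      filter_upwards [isOpen_Ioo.mem_nhds hx] with y hy using heq (Set.Ioo_subset_Icc_self hy)
  rw [← closure_Ioo hab.ne]
  exact h1.closure (hg.continuous_deriv (by simp)) (hh.continuous_deriv (by simp))

theorem Smooth2.slice_fst {F : ℝ → ℝ → ℝ} (hF : Smooth2 F) (t : ℝ) :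
    ContDiff ℝ ∞ (fun x => F x t) :=
  ContDiff.comp (g := fun p : ℝ × ℝ => F p.1 p.2) hF (contDiff_id.prodMk contDiff_const)

theorem Smooth2.slice_snd {F : ℝ → ℝ → ℝ} (hF : Smooth2 F) (x : ℝ) :
    ContDiff ℝ ∞ (fun t => F x t) :=
  ContDiff.comp (g := fun p : ℝ × ℝ => F p.1 p.2) hF (contDiff_const.prodMk contDiff_id)

theorem dX_eq_of_eq_on_line {F G : ℝ → ℝ → ℝ} (hF : Smooth2 F) (hG : Smooth2 G) {t : ℝ}
    (h : ∀ x ∈ Set.Icc (0 : ℝ) 1, F x t = G x t) :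
    ∀ x ∈ Set.Icc (0 : ℝ) 1, dX F x t = dX G x t :=
  fun _ hx => deriv_eq_of_eqOn_Icc zero_lt_one (hF.slice_fst t) (hG.slice_fst t) h hx

theorem dT_eq_of_eq_on_line {F G : ℝ → ℝ → ℝ} (hF : Smooth2 F) (hG : Smooth2 G) {T x : ℝ}
    (hT : 0 < T) (h : ∀ t ∈ Set.Icc (0 : ℝ) T, F x t = G x t) :
    ∀ t ∈ Set.Icc (0 : ℝ) T, dT F x t = dT G x t :=
  fun _ ht => deriv_eq_of_eqOn_Icc hT (hF.slice_snd x) (hG.slice_snd x) h ht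

/-- The data of a parabolic reaction–diffusion system with `n` components, labelled `1, …, n`. -/
structure ParabolicData (n : ℕ) where
  T : ℝ
  T_pos : 0 < T
  A : ℕ → ℕ → ℝ → ℝ → ℝ
  A_smooth : ∀ i ∈ Finset.Icc 1 n, ∀ j ∈ Finset.Icc 1 n, Smooth2 (A i j)
  A_diag : ∀ i ∈ Finset.Icc 1 n, ∀ x ∈ Set.Icc (0:ℝ) 1, ∀ t ∈ Set.Icc (0:ℝ) T,
      ∑ j ∈ (Finset.Icc 1 n).erase i, |A i j x t| < A i i x t
  A_off : ∀ i ∈ Finset.Icc 1 n, ∀ j ∈ Finset.Icc 1 n, i ≠ j →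
      ∀ x ∈ Set.Icc (0:ℝ) 1, ∀ t ∈ Set.Icc (0:ℝ) T, A i j x t ≤ 0
  α : ℝ
  α_pos : 0 < α
  α_lt : ∀ x ∈ Set.Icc (0:ℝ) 1, ∀ t ∈ Set.Icc (0:ℝ) T, ∀ i ∈ Finset.Icc 1 n,
      α < ∑ j ∈ Finset.Icc 1 n, A i j x t
  f : ℕ → ℝ → ℝ → ℝ
  φ : ℕ → ℝ → ℝ → ℝ
  f_smooth : ∀ i ∈ Finset.Icc 1 n, Smooth2 (f i)
  φ_smooth : ∀ i ∈ Finset.Icc 1 n, Smooth2 (φ i)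

/-- The differential operator `∂_t − E ∂_x² + A`. -/
noncomputable def ParabolicData.L (D : ParabolicData n) (ε : ℕ → ℝ) (z : ℕ → ℝ → ℝ → ℝ) (i : ℕ)
    (x t : ℝ) : ℝ :=
  dT (z i) x t - ε i * dX (dX (z i)) x t + ∑ j ∈ Finset.Icc 1 n, D.A i j x t * z j x t

theorem deriv_nonpos_of_left_min {g : ℝ → ℝ} {g' a b : ℝ} (hab : a < b)
    (hg : HasDerivAt g g' b) (hmin : ∀ s ∈ Set.Icc a b, g b ≤ g s) : g' ≤ 0 := by
  by_contra! hpos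
  have h2 := (hasDerivAt_iff_tendsto_slope.1 hg).eventually (lt_mem_nhds hpos)
  have h3 : ∀ᶠ y in nhdsWithin b (Set.Iio b), 0 < slope g b y :=
    h2.filter_mono (nhdsWithin_mono _ fun y hy => ne_of_lt hy)
  have h4 : ∀ᶠ y in nhdsWithin b (Set.Iio b), y ∈ Set.Ioo a b := Ioo_mem_nhdsLT hab
  obtain ⟨y, hy1, hy2⟩ := (h3.and h4).exists
  rw [slope_def_field] at hy1
  have h5 := hmin y ⟨hy2.1.le, hy2.2.le⟩
  have h6 : y - b < 0 := by linarith [hy2.2]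
  have h7 : (g y - g b) / (y - b) ≤ 0 := div_nonpos_of_nonneg_of_nonpos (by linarith) h6.le
  linarith

theorem second_deriv_nonneg_of_interior_min {g g' : ℝ → ℝ} {g'' x a b : ℝ} (hx : x ∈ Set.Ioo a b)
    (hg : ∀ y, HasDerivAt g (g' y) y) (hg' : HasDerivAt g' g'' x)
    (hmin : ∀ y ∈ Set.Icc a b, g x ≤ g y) : 0 ≤ g'' := by
  by_contra! hneg
  have hloc : IsLocalMin g x := by
    filter_upwards [isOpen_Ioo.mem_nhds hx] with y hy using hmin y (Set.Ioo_subset_Icc_self hy)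
  have h0 : g' x = 0 := hloc.hasDerivAt_eq_zero (hg x)
  have h2 := (hasDerivAt_iff_tendsto_slope.1 hg').eventually (gt_mem_nhds hneg)
  have h3 : ∀ᶠ y in nhdsWithin x (Set.Ioi x), slope g' x y < 0 :=
    h2.filter_mono (nhdsWithin_mono _ fun y hy => ne_of_gt hy)
  obtain ⟨c, hc, hcs⟩ := (mem_nhdsGT_iff_exists_Ioo_subset' hx.2).1 h3
  set d := min c b with hd
  have hxd : x < d := lt_min hc hx.2
  obtain ⟨y, hy, hyeq⟩ := exists_hasDerivAt_eq_slope g g' hxd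
    (fun y _ => (hg y).continuousAt.continuousWithinAt) (fun y _ => hg y)
  have hys : slope g' x y < 0 := hcs ⟨hy.1, hy.2.trans_le (min_le_left _ _)⟩
  rw [slope_def_field, h0, sub_zero] at hys
  have hypos : 0 < y - x := by linarith [hy.1]
  have hneg' : g' y < 0 := by
    by_contra! h
    exact absurd (div_nonneg h hypos.le) (not_le.2 hys)
  have h5 := hmin d ⟨by linarith [hx.1], min_le_right _ _⟩
  have h6 : 0 ≤ (g d - g x) / (d - x) := div_nonneg (by linarith) (by linarith)
  linarith

theorem ParabolicData.max_principle (D : ParabolicData n) {ε : ℕ → ℝ}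
    (hε : ∀ i ∈ Finset.Icc 1 n, 0 < ε i) {w : ℕ → ℝ → ℝ → ℝ}
    (hw : ∀ i ∈ Finset.Icc 1 n, Smooth2 (w i))
    (hL : ∀ i ∈ Finset.Icc 1 n, ∀ x ∈ Set.Icc (0:ℝ) 1, ∀ t ∈ Set.Icc 0 D.T, 0 ≤ D.L ε w i x t)
    (hΓ : ∀ i ∈ Finset.Icc 1 n, ∀ x ∈ Set.Icc (0:ℝ) 1, ∀ t ∈ Set.Icc 0 D.T,
      (x = 0 ∨ x = 1 ∨ t = 0) → 0 ≤ w i x t) :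
    ∀ i ∈ Finset.Icc 1 n, ∀ x ∈ Set.Icc (0:ℝ) 1, ∀ t ∈ Set.Icc 0 D.T, 0 ≤ w i x t := by
  intro i₀ hi₀ x₀ hx₀ t₀ ht₀
  by_contra! hneg
  have hcomp : IsCompact (Set.Icc (0:ℝ) 1 ×ˢ Set.Icc 0 D.T) := isCompact_Icc.prod isCompact_Icc
  have hex : ∀ i ∈ Finset.Icc 1 n, ∃ p ∈ Set.Icc (0:ℝ) 1 ×ˢ Set.Icc 0 D.T,
      ∀ q ∈ Set.Icc (0:ℝ) 1 ×ˢ Set.Icc 0 D.T, w i p.1 p.2 ≤ w i q.1 q.2 := fun i hi =>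
    hcomp.exists_isMinOn ⟨(x₀, t₀), hx₀, ht₀⟩ (hw i hi).continuous.continuousOn
  choose! P hP hPmin using hex
  obtain ⟨i, hi, himin⟩ := Finset.exists_min_image (Finset.Icc 1 n)
    (fun i => w i (P i).1 (P i).2) ⟨i₀, hi₀⟩
  set x := (P i).1 with hxdef
  set t := (P i).2 with htdef
  have hx : x ∈ Set.Icc (0:ℝ) 1 := (hP i hi).1
  have ht : t ∈ Set.Icc 0 D.T := (hP i hi).2
  have hmin : ∀ j ∈ Finset.Icc 1 n, ∀ y ∈ Set.Icc (0:ℝ) 1, ∀ s ∈ Set.Icc 0 D.T,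
      w i x t ≤ w j y s := fun j hj y hy s hs =>
    (himin j hj).trans (hPmin j hj (y, s) ⟨hy, hs⟩)
  have hlt : w i x t < 0 := (hmin i₀ hi₀ x₀ hx₀ t₀ ht₀).trans_lt hneg
  have hnΓ : ¬ (x = 0 ∨ x = 1 ∨ t = 0) := fun h => absurd (hΓ i hi x hx t ht h) (not_le.2 hlt)
  push Not at hnΓ
  have hx' : x ∈ Set.Ioo (0:ℝ) 1 :=
    ⟨lt_of_le_of_ne hx.1 hnΓ.1.symm, lt_of_le_of_ne hx.2 hnΓ.2.1⟩
  have ht' : 0 < t := lt_of_le_of_ne ht.1 hnΓ.2.2.symm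
  have h1 : dT (w i) x t ≤ 0 := deriv_nonpos_of_left_min ht' ((hw i hi).hasDerivAt_snd x t)
    fun s hs => hmin i hi x hx s ⟨hs.1, hs.2.trans ht.2⟩
  have h2 : 0 ≤ dX (dX (w i)) x t := second_deriv_nonneg_of_interior_min hx'
    (fun y => (hw i hi).hasDerivAt_fst y t) ((hw i hi).dX.hasDerivAt_fst x t)
    fun y hy => hmin i hi y hy t ht
  have h3 : ∑ j ∈ Finset.Icc 1 n, D.A i j x t * w j x t
      ≤ ∑ j ∈ Finset.Icc 1 n, D.A i j x t * w i x t := by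
    refine Finset.sum_le_sum fun j hj => ?_
    by_cases hij : i = j
    · rw [hij]
    · exact mul_le_mul_of_nonpos_left (hmin j hj x hx t ht) (D.A_off i hi j hj hij x hx t ht)
  rw [← Finset.sum_mul] at h3
  have h4 := D.α_lt x hx t ht i hi
  have h5 := hL i hi x hx t ht
  rw [ParabolicData.L] at h5
  have h6 := mul_nonneg (hε i hi).le h2
  have h7 := mul_neg_of_pos_of_neg (D.α_pos.trans h4) hlt
  linarith

theorem ParabolicData.L_add (D : ParabolicData n) {ε : ℕ → ℝ} {z w : ℕ → ℝ → ℝ → ℝ} {i : ℕ}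
    (hz : Smooth2 (z i)) (hw : Smooth2 (w i)) (x t : ℝ) :
    D.L ε (fun i x t => z i x t + w i x t) i x t = D.L ε z i x t + D.L ε w i x t := by
  have h : dX (fun x t => z i x t + w i x t) = fun x t => dX (z i) x t + dX (w i) x t := by
    funext x t; exact dX_add hz hw x t
  simp only [ParabolicData.L, h, dT_add hz hw, dX_add hz.dX hw.dX, mul_add, Finset.sum_add_distrib]
  ring

theorem ParabolicData.L_const_mul (D : ParabolicData n) {ε : ℕ → ℝ} {z : ℕ → ℝ → ℝ → ℝ} {i : ℕ}
    (hz : Smooth2 (z i)) (c x t : ℝ) :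
    D.L ε (fun i x t => c * z i x t) i x t = c * D.L ε z i x t := by
  have h : dX (fun x t => c * z i x t) = fun x t => c * dX (z i) x t := by
    funext x t; exact dX_const_mul hz c x t
  simp only [ParabolicData.L, h, dT_const_mul hz, dX_const_mul hz.dX, mul_add, mul_sub,
    Finset.mul_sum]
  congr 1
  · ring
  · exact Finset.sum_congr rfl fun j _ => by ring

/-- Comparison principle for the differential operator. -/
theorem ParabolicData.comparison (D : ParabolicData n) {ε : ℕ → ℝ}
    (hε : ∀ i ∈ Finset.Icc 1 n, 0 < ε i) {z β : ℕ → ℝ → ℝ → ℝ}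
    (hz : ∀ i ∈ Finset.Icc 1 n, Smooth2 (z i)) (hβ : ∀ i ∈ Finset.Icc 1 n, Smooth2 (β i))
    (hL : ∀ i ∈ Finset.Icc 1 n, ∀ x ∈ Set.Icc (0:ℝ) 1, ∀ t ∈ Set.Icc 0 D.T,
      |D.L ε z i x t| ≤ D.L ε β i x t)
    (hΓ : ∀ i ∈ Finset.Icc 1 n, ∀ x ∈ Set.Icc (0:ℝ) 1, ∀ t ∈ Set.Icc 0 D.T,
      (x = 0 ∨ x = 1 ∨ t = 0) → |z i x t| ≤ β i x t) :
    ∀ i ∈ Finset.Icc 1 n, ∀ x ∈ Set.Icc (0:ℝ) 1, ∀ t ∈ Set.Icc 0 D.T, |z i x t| ≤ β i x t := by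
  have key : ∀ c : ℝ, |c| = 1 → ∀ i ∈ Finset.Icc 1 n, ∀ x ∈ Set.Icc (0:ℝ) 1,
      ∀ t ∈ Set.Icc 0 D.T, 0 ≤ β i x t + c * z i x t := by
    intro c hc
    have hbd : ∀ a b : ℝ, |a| ≤ b → 0 ≤ b + c * a := fun a b hab => by
      have h1 := neg_abs_le (c * a)
      rw [abs_mul, hc, one_mul] at h1
      linarith
    refine D.max_principle hε (w := fun i x t => β i x t + c * z i x t)
      (fun i hi => (hβ i hi).add ((hz i hi).const_mul c)) (fun i hi x hx t ht => ?_)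
      (fun i hi x hx t ht h => hbd _ _ (hΓ i hi x hx t ht h))
    have h1 : D.L ε (fun i x t => β i x t + c * z i x t) i x t
        = D.L ε β i x t + c * D.L ε z i x t := by
      rw [D.L_add (z := β) (w := fun i x t => c * z i x t) (hβ i hi) ((hz i hi).const_mul c),
        D.L_const_mul (hz i hi)]
    rw [h1]
    exact hbd _ _ (hL i hi x hx t ht)
  intro i hi x hx t ht
  have h1 := key 1 (by simp) i hi x hx t ht
  have h2 := key (-1) (by simp) i hi x hx t ht
  exact abs_le.2 ⟨by linarith, by linarith⟩

/-- The boundary-layer function attached to the diffusion parameter `e`. -/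
noncomputable def layer (α e x : ℝ) : ℝ :=
  Real.exp (-(√(α / e) * x)) + Real.exp (-(√(α / e) * (1 - x)))

theorem layer_pos (α e x : ℝ) : 0 < layer α e x := by unfold layer; positivity

theorem layer_smooth (α e : ℝ) : Smooth2 (fun x _ => layer α e x) := by
  unfold Smooth2 layer; fun_prop

theorem dX_dX_layer {α e : ℝ} (h : 0 ≤ α / e) (x t : ℝ) :
    dX (dX fun x _ => layer α e x) x t = α / e * layer α e x := by
  set l := √(α / e) with hl
  have h1 : dX (fun x _ => layer α e x) =
      fun x _ => -l * Real.exp (-(l * x)) + l * Real.exp (-(l * (1 - x))) := by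
    funext y s
    have a1 : HasDerivAt (fun y => Real.exp (-(l * y))) (Real.exp (-(l * y)) * (-(l * 1))) y :=
      (((hasDerivAt_id y).const_mul l).neg).exp
    have a2 : HasDerivAt (fun y => Real.exp (-(l * (1 - y))))
        (Real.exp (-(l * (1 - y))) * (-(l * (-1)))) y :=
      (((((hasDerivAt_id y).const_sub 1)).const_mul l).neg).exp
    refine ((a1.add a2).deriv.trans ?_)
    ring
  rw [h1]
  have a1 : HasDerivAt (fun y => -l * Real.exp (-(l * y)))
      (-l * (Real.exp (-(l * x)) * (-(l * 1)))) x :=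
    ((((hasDerivAt_id x).const_mul l).neg).exp).const_mul _
  have a2 : HasDerivAt (fun y => l * Real.exp (-(l * (1 - y))))
      (l * (Real.exp (-(l * (1 - x))) * (-(l * (-1))))) x :=
    ((((((hasDerivAt_id x).const_sub 1)).const_mul l).neg).exp).const_mul _
  refine ((a1.add a2).deriv.trans ?_)
  have h2 : l ^ 2 = α / e := Real.sq_sqrt h
  rw [← h2, layer, ← hl]
  ring

theorem layer_le_layer {α e e' x : ℝ} (hα : 0 ≤ α) (he : 0 < e) (hee' : e ≤ e')
    (hx : x ∈ Set.Icc (0:ℝ) 1) : layer α e x ≤ layer α e' x := by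
  have h : √(α / e') ≤ √(α / e) :=
    Real.sqrt_le_sqrt (div_le_div_of_nonneg_left hα he hee')
  refine add_le_add (Real.exp_le_exp.2 (neg_le_neg ?_)) (Real.exp_le_exp.2 (neg_le_neg ?_))
  · exact mul_le_mul_of_nonneg_right h hx.1
  · exact mul_le_mul_of_nonneg_right h (by linarith [hx.2])

theorem one_le_layer {α e x : ℝ} (h : x = 0 ∨ x = 1) : 1 ≤ layer α e x := by
  have h1 := Real.exp_pos (-(√(α / e) * x))
  have h2 := Real.exp_pos (-(√(α / e) * (1 - x)))
  unfold layer
  rcases h with rfl | rfl <;> simp at * <;> linarith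

theorem Smooth2.exists_bound {F : ℝ → ℝ → ℝ} (hF : Smooth2 F) (T : ℝ) :
    ∃ C : ℝ, ∀ x ∈ Set.Icc (0:ℝ) 1, ∀ t ∈ Set.Icc 0 T, |F x t| ≤ C := by
  obtain ⟨C, hC⟩ := (isCompact_Icc.prod isCompact_Icc :
    IsCompact (Set.Icc (0:ℝ) 1 ×ˢ Set.Icc 0 T)).exists_bound_of_continuousOn
      hF.continuous.continuousOn
  exact ⟨C, fun x hx t ht => hC (x, t) ⟨hx, ht⟩⟩

theorem ParabolicData.exists_gap (D : ParabolicData n) :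
    ∃ δ : ℝ, 0 < δ ∧ δ ≤ 1 ∧ ∀ i ∈ Finset.Icc 1 n, ∀ x ∈ Set.Icc (0:ℝ) 1, ∀ t ∈ Set.Icc 0 D.T,
      D.α + δ ≤ ∑ j ∈ Finset.Icc 1 n, D.A i j x t := by
  have hex : ∀ i ∈ Finset.Icc 1 n, ∃ d : ℝ, 0 < d ∧ ∀ x ∈ Set.Icc (0:ℝ) 1, ∀ t ∈ Set.Icc 0 D.T,
      D.α + d ≤ ∑ j ∈ Finset.Icc 1 n, D.A i j x t := by
    intro i hi
    have hs : Smooth2 (fun x t => ∑ j ∈ Finset.Icc 1 n, D.A i j x t) :=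
      Smooth2.sum fun j hj => D.A_smooth i hi j hj
    obtain ⟨p, hp, hmin⟩ := (isCompact_Icc.prod isCompact_Icc :
      IsCompact (Set.Icc (0:ℝ) 1 ×ˢ Set.Icc 0 D.T)).exists_isMinOn
        ⟨(0, 0), ⟨⟨le_rfl, zero_le_one⟩, ⟨le_rfl, D.T_pos.le⟩⟩⟩ hs.continuous.continuousOn
    refine ⟨∑ j ∈ Finset.Icc 1 n, D.A i j p.1 p.2 - D.α,
      by linarith [D.α_lt p.1 hp.1 p.2 hp.2 i hi], fun x hx t ht => ?_⟩
    have := hmin (a := (x, t)) ⟨hx, ht⟩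
    simp only [Set.mem_ofPred_eq] at this
    linarith
  choose! d hd hdb using hex
  rcases (Finset.Icc 1 n).eq_empty_or_nonempty with h | h
  · exact ⟨1, one_pos, le_rfl, fun i hi => by simp [h] at hi⟩
  · obtain ⟨i₀, hi₀, hmin⟩ := Finset.exists_min_image (Finset.Icc 1 n) d h
    refine ⟨min 1 (d i₀), lt_min one_pos (hd i₀ hi₀), min_le_left _ _, fun i hi x hx t ht => ?_⟩
    have := hdb i hi x hx t ht
    have := hmin i hi
    have := min_le_right 1 (d i₀)
    linarith

theorem ParabolicData.exists_diag_bound (D : ParabolicData n) :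
    ∃ K : ℝ, 1 ≤ K ∧ ∀ i ∈ Finset.Icc 1 n, ∀ x ∈ Set.Icc (0:ℝ) 1, ∀ t ∈ Set.Icc 0 D.T,
      D.A i i x t ≤ K := by
  have hex : ∀ i ∈ Finset.Icc 1 n, ∃ C : ℝ, ∀ x ∈ Set.Icc (0:ℝ) 1, ∀ t ∈ Set.Icc 0 D.T,
      |D.A i i x t| ≤ C := fun i hi => (D.A_smooth i hi i hi).exists_bound D.T
  choose! C hC using hex
  refine ⟨1 + ∑ i ∈ Finset.Icc 1 n, |C i|, by
    linarith [Finset.sum_nonneg fun i (_ : i ∈ Finset.Icc 1 n) => abs_nonneg (C i)],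
    fun i hi x hx t ht => ?_⟩
  have h1 := hC i hi x hx t ht
  have h2 := Finset.single_le_sum (fun i _ => abs_nonneg (C i)) hi
  linarith [le_abs_self (D.A i i x t), le_abs_self (C i)]

/-- Weighted row sums against a family bounded above by `m`. -/
theorem ParabolicData.row_sum_ge (D : ParabolicData n) {i : ℕ} (hi : i ∈ Finset.Icc 1 n) {x t : ℝ}
    (hx : x ∈ Set.Icc (0:ℝ) 1) (ht : t ∈ Set.Icc 0 D.T) {b : ℕ → ℝ} {m : ℝ}
    (hb : ∀ j ∈ Finset.Icc 1 n, b j ≤ m) :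
    (∑ j ∈ Finset.Icc 1 n, D.A i j x t) * m - D.A i i x t * (m - b i)
      ≤ ∑ j ∈ Finset.Icc 1 n, D.A i j x t * b j := by
  rw [← Finset.add_sum_erase _ _ hi, ← Finset.add_sum_erase _ (fun j => D.A i j x t * b j) hi,
    add_mul, Finset.sum_mul]
  have : ∑ j ∈ (Finset.Icc 1 n).erase i, D.A i j x t * m
      ≤ ∑ j ∈ (Finset.Icc 1 n).erase i, D.A i j x t * b j := by
    refine Finset.sum_le_sum fun j hj => ?_
    rw [Finset.mem_erase] at hj
    exact mul_le_mul_of_nonpos_left (hb j hj.2) (D.A_off i hi j hj.2 hj.1.symm x hx t ht)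
  linarith

theorem sum_pow_Ico_le {R c : ℝ} (hR : 1 ≤ R) (hc : 0 ≤ c) (hcR : 2 * c ≤ R - 1) (i : ℕ) :
    c * ∑ q ∈ Finset.Ico 1 i, R ^ q ≤ R ^ i / 2 := by
  have hR0 : 0 ≤ R := by linarith
  have h1 : ∑ q ∈ Finset.Ico 1 i, R ^ q ≤ ∑ q ∈ Finset.range i, R ^ q := by
    refine Finset.sum_le_sum_of_subset_of_nonneg (fun q hq => ?_) fun q _ _ => by positivity
    simp at hq ⊢; omega
  have h2 := geom_sum_mul R i
  have h3 : 0 ≤ ∑ q ∈ Finset.range i, R ^ q := Finset.sum_nonneg fun q _ => by positivity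
  have h4 := mul_le_mul_of_nonneg_left h1 hc
  have h5 := mul_le_mul_of_nonneg_left hcR h3
  nlinarith

theorem Finset.sum_Icc_split {M : Type*} [AddCommMonoid M] {i : ℕ} (hi : i ∈ Finset.Icc 1 n)
    (g : ℕ → M) :
    ∑ q ∈ Finset.Icc 1 n, g q = ∑ q ∈ Finset.Ico 1 i, g q + ∑ q ∈ Finset.Icc i n, g q := by
  rw [Finset.mem_Icc] at hi
  have h1 : Finset.Icc 1 n = Finset.Ico 1 (n + 1) := by ext; simp
  have h2 : Finset.Icc i n = Finset.Ico i (n + 1) := by ext; simp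
  rw [h1, h2, Finset.sum_Ico_consecutive _ hi.1 (by omega)]

theorem ParabolicData.L_layer_sum (D : ParabolicData n) {ε : ℕ → ℝ}
    (hε : ∀ i ∈ Finset.Icc 1 n, 0 < ε i) (c : ℕ → ℕ → ℝ) (i : ℕ) (x t : ℝ) :
    D.L ε (fun i x _ => 1 + ∑ q ∈ Finset.Icc 1 n, c q i * layer D.α (ε q) x) i x t
      = ∑ j ∈ Finset.Icc 1 n, D.A i j x t
        + ∑ q ∈ Finset.Icc 1 n, layer D.α (ε q) x *
          (-(ε i * (D.α / ε q) * c q i) + ∑ j ∈ Finset.Icc 1 n, D.A i j x t * c q j) := by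
  have hs : ∀ i, ∀ q ∈ Finset.Icc 1 n, Smooth2 (fun x _ => c q i * layer D.α (ε q) x) :=
    fun i q _ => (layer_smooth D.α (ε q)).const_mul (c q i)
  have hone : Smooth2 (fun _ _ => (1:ℝ)) := contDiff_const
  have h1 : dX (fun x _ => 1 + ∑ q ∈ Finset.Icc 1 n, c q i * layer D.α (ε q) x)
      = fun x t => ∑ q ∈ Finset.Icc 1 n, c q i * dX (fun x _ => layer D.α (ε q) x) x t := by
    funext x t
    rw [dX_add hone (Smooth2.sum (hs i)), dX_sum (hs i)]
    have : dX (fun _ _ => (1:ℝ)) x t = 0 := by simp [dX]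
    rw [this, zero_add]
    exact Finset.sum_congr rfl fun q _ => dX_const_mul (layer_smooth _ _) _ _ _
  have h2 : dX (dX (fun x _ => 1 + ∑ q ∈ Finset.Icc 1 n, c q i * layer D.α (ε q) x)) x t
      = ∑ q ∈ Finset.Icc 1 n, c q i * (D.α / ε q * layer D.α (ε q) x) := by
    rw [h1, dX_sum fun q _ => (layer_smooth D.α (ε q)).dX.const_mul (c q i)]
    refine Finset.sum_congr rfl fun q hq => ?_
    rw [dX_const_mul (layer_smooth _ _).dX, dX_dX_layer (div_nonneg D.α_pos.le (hε q hq).le)]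
  have h3 : dT (fun x (_ : ℝ) => 1 + ∑ q ∈ Finset.Icc 1 n, c q i * layer D.α (ε q) x) x t = 0 := by
    simp [dT]
  simp only [ParabolicData.L, h2, h3]
  have h4 : ∑ j ∈ Finset.Icc 1 n, D.A i j x t *
      (1 + ∑ q ∈ Finset.Icc 1 n, c q j * layer D.α (ε q) x)
      = ∑ j ∈ Finset.Icc 1 n, D.A i j x t + ∑ q ∈ Finset.Icc 1 n, layer D.α (ε q) x *
          ∑ j ∈ Finset.Icc 1 n, D.A i j x t * c q j := by
    simp only [mul_add, mul_one, Finset.sum_add_distrib, Finset.mul_sum]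
    rw [Finset.sum_comm]
    congr 1
    exact Finset.sum_congr rfl fun q _ => Finset.sum_congr rfl fun j _ => by ring
  rw [h4]
  simp only [mul_add, Finset.sum_add_distrib, Finset.mul_sum]
  have h5 : ∑ q ∈ Finset.Icc 1 n, layer D.α (ε q) x * -(ε i * (D.α / ε q) * c q i)
      = -∑ q ∈ Finset.Icc 1 n, ε i * (c q i * (D.α / ε q * layer D.α (ε q) x)) := by
    rw [← Finset.sum_neg_distrib]
    exact Finset.sum_congr rfl fun q _ => by ring
  rw [h5]
  ring

/-- A supersolution of the system whose `i`-th component only carries the layers `q ≥ i`. -/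
theorem ParabolicData.exists_barrier (D : ParabolicData n) :
    ∃ C : ℝ, 0 < C ∧ ∀ ε μ : ℕ → ℝ, (∀ i ∈ Finset.Icc 1 n, 0 < ε i) →
      (∀ i ∈ Finset.Icc 1 n, ∀ j ∈ Finset.Icc 1 n, i ≤ j → ε i ≤ ε j) →
      (∀ i ∈ Finset.Icc 1 n, 0 < μ i) →
      (∀ q ∈ Finset.Icc 1 n, ∀ i ∈ Finset.Icc 1 n, q ≤ i → ε q * μ q ≤ ε i * μ i) →
      ∃ β : ℕ → ℝ → ℝ → ℝ, (∀ i, Smooth2 (β i)) ∧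
        ∀ i ∈ Finset.Icc 1 n, ∀ x ∈ Set.Icc (0:ℝ) 1, ∀ t ∈ Set.Icc 0 D.T,
          (1 + ∑ q ∈ Finset.Icc 1 n, μ q * layer D.α (ε q) x ≤ C * D.L ε β i x t) ∧
          (1 + μ i * layer D.α (ε i) x ≤ C * β i x t) ∧
          β i x t ≤ C * (1 + ∑ q ∈ Finset.Icc i n, μ q * layer D.α (ε q) x) := by
  obtain ⟨δ, hδ, hδ1, hgap⟩ := D.exists_gap
  obtain ⟨K, hK1, hK⟩ := D.exists_diag_bound
  have hα := D.α_pos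
  set κ := (K + 1) / D.α with hκ
  have hκ0 : 0 < κ := by positivity
  set R := 1 + 2 * (K * κ / δ) with hR
  have hKκ : 0 < K * κ / δ := by positivity
  have hR1 : 1 ≤ R := by linarith
  have hκR : 2 * κ ≤ R - 1 := by
    have : κ ≤ K * κ / δ := by
      rw [le_div_iff₀ hδ]; nlinarith
    linarith
  have hRpos : 0 < R := by linarith
  refine ⟨1 / D.α + 2 / δ + 2 + R ^ n, by positivity, fun ε μ hε hmono hμ hεμ => ?_⟩
  set b : ℕ → ℕ → ℝ := fun q i => if i ≤ q then μ q else -(κ * (ε q * μ q / ε i)) with hb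
  set β : ℕ → ℝ → ℝ → ℝ :=
    fun i x _ => 1 + ∑ q ∈ Finset.Icc 1 n, (R ^ q * b q i) * layer D.α (ε q) x with hβ
  refine ⟨β, fun i => Smooth2.add contDiff_const
    (Smooth2.sum fun q _ => (layer_smooth _ _).const_mul _), fun i hi x hx t ht => ?_⟩
  have hi' := Finset.mem_Icc.1 hi
  have hB : ∀ q, 0 < layer D.α (ε q) x := fun q => layer_pos _ _ _
  have hratio : ∀ q ∈ Finset.Ico 1 i, ε q * μ q / ε i * layer D.α (ε q) x
      ≤ μ i * layer D.α (ε i) x := by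
    intro q hq
    have hq' := Finset.mem_Ico.1 hq
    have hqn : q ∈ Finset.Icc 1 n := Finset.mem_Icc.2 ⟨hq'.1, by omega⟩
    have h1 : ε q * μ q / ε i ≤ μ i := by
      rw [div_le_iff₀ (hε i hi), mul_comm (μ i)]
      exact hεμ q hqn i hi hq'.2.le
    exact mul_le_mul h1 (layer_le_layer hα.le (hε q hqn) (hmono q hqn i hi hq'.2.le) hx)
      (hB q).le (hμ i hi).le
  have hmem : ∀ q ∈ Finset.Icc i n, q ∈ Finset.Icc 1 n := fun q hq => by
    rw [Finset.mem_Icc] at hq ⊢; omega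
  have hmem' : ∀ q ∈ Finset.Ico 1 i, q ∈ Finset.Icc 1 n := fun q hq => by
    rw [Finset.mem_Ico] at hq; rw [Finset.mem_Icc]; omega
  have hble : ∀ q ∈ Finset.Icc 1 n, ∀ j ∈ Finset.Icc 1 n, b q j ≤ μ q := by
    intro q hq j hj
    simp only [hb]
    split_ifs with h
    · exact le_rfl
    · have := hμ q hq; have := hε q hq; have := hε j hj
      have : 0 ≤ κ * (ε q * μ q / ε j) := by positivity
      linarith
  have hsplit : ∀ g : ℕ → ℝ, ∑ q ∈ Finset.Icc 1 n, g q = _ := Finset.sum_Icc_split hi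
  have hwpos : ∀ q ∈ Finset.Icc 1 n, 0 < μ q * layer D.α (ε q) x := fun q hq =>
    mul_pos (hμ q hq) (hB q)
  -- the contribution of each layer to the operator
  have hhigh : ∀ q ∈ Finset.Icc i n, δ * (μ q * layer D.α (ε q) x) * R ^ q ≤
      layer D.α (ε q) x * (-(ε i * (D.α / ε q) * (R ^ q * b q i))
        + ∑ j ∈ Finset.Icc 1 n, D.A i j x t * (R ^ q * b q j)) := by
    intro q hq
    have hq1 := hmem q hq
    have hbi : b q i = μ q := if_pos (Finset.mem_Icc.1 hq).1
    have h1 := D.row_sum_ge hi hx ht (hble q hq1)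
    rw [hbi, sub_self, mul_zero, sub_zero] at h1
    have h2 := mul_le_mul_of_nonneg_right (hgap i hi x hx t ht) (hμ q hq1).le
    have h3 : ε i * (D.α / ε q) ≤ D.α := by
      rw [mul_div_assoc', div_le_iff₀ (hε q hq1)]
      nlinarith [hmono i hi q hq1 (Finset.mem_Icc.1 hq).1]
    have h4 := mul_le_mul_of_nonneg_right h3 (hμ q hq1).le
    have h5 : ∑ j ∈ Finset.Icc 1 n, D.A i j x t * (R ^ q * b q j)
        = R ^ q * ∑ j ∈ Finset.Icc 1 n, D.A i j x t * b q j := by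
      rw [Finset.mul_sum]; exact Finset.sum_congr rfl fun j _ => by ring
    rw [h5, hbi]
    have h6 : δ * μ q ≤ -(ε i * (D.α / ε q) * μ q) + ∑ j ∈ Finset.Icc 1 n, D.A i j x t * b q j := by
      linarith
    have h7 := mul_le_mul_of_nonneg_left h6 (mul_pos (pow_pos hRpos q) (hB q)).le
    linarith
  have hlow : ∀ q ∈ Finset.Ico 1 i, δ * (μ q * layer D.α (ε q) x) * R ^ q
        - K * κ * (μ i * layer D.α (ε i) x) * R ^ q ≤
      layer D.α (ε q) x * (-(ε i * (D.α / ε q) * (R ^ q * b q i))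
        + ∑ j ∈ Finset.Icc 1 n, D.A i j x t * (R ^ q * b q j)) := by
    intro q hq
    have hq1 := hmem' q hq
    have hbi : b q i = -(κ * (ε q * μ q / ε i)) := if_neg (by have := Finset.mem_Ico.1 hq; omega)
    have h1 := D.row_sum_ge hi hx ht (hble q hq1)
    have hAii := hK i hi x hx t ht
    have hsum : 0 ≤ ∑ j ∈ Finset.Icc 1 n, D.A i j x t := by
      linarith [hgap i hi x hx t ht]
    have h2 := mul_nonneg hsum (hμ q hq1).le
    have hpos : 0 ≤ μ q - b q i := by linarith [hble q hq1 i hi]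
    have h3 := mul_le_mul_of_nonneg_right hAii hpos
    have h4 : ε i * (D.α / ε q) * b q i = -((K + 1) * μ q) := by
      rw [hbi, hκ]; field_simp [(hε i hi).ne', (hε q hq1).ne']
    have h5 : ∑ j ∈ Finset.Icc 1 n, D.A i j x t * (R ^ q * b q j)
        = R ^ q * ∑ j ∈ Finset.Icc 1 n, D.A i j x t * b q j := by
      rw [Finset.mul_sum]; exact Finset.sum_congr rfl fun j _ => by ring
    rw [h5]
    have h6 : μ q - K * κ * (ε q * μ q / ε i) ≤ -(ε i * (D.α / ε q) * b q i)
        + ∑ j ∈ Finset.Icc 1 n, D.A i j x t * b q j := by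
      rw [h4]
      have : K * b q i = -(K * κ * (ε q * μ q / ε i)) := by rw [hbi]; ring
      linarith
    have h7 := mul_le_mul_of_nonneg_left h6 (mul_pos (pow_pos hRpos q) (hB q)).le
    have h8 := mul_le_mul_of_nonneg_left (hratio q hq)
      (mul_pos (mul_pos (zero_lt_one.trans_le hK1) hκ0) (pow_pos hRpos q)).le
    have h9 : δ * (μ q * layer D.α (ε q) x) * R ^ q ≤ (μ q * layer D.α (ε q) x) * R ^ q :=
      mul_le_mul_of_nonneg_right (by nlinarith [hwpos q hq1]) (pow_pos hRpos q).le
    linarith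
  have hwi := hwpos i hi
  have hgeo1 := sum_pow_Ico_le hR1 (c := K * κ / δ) hKκ.le (by linarith) i
  have hgeo2 := sum_pow_Ico_le hR1 (c := κ) hκ0.le hκR i
  have hLβ : D.α + δ / 2 * ∑ q ∈ Finset.Icc 1 n, μ q * layer D.α (ε q) x ≤ D.L ε β i x t := by
    have e := D.L_layer_sum hε (fun q i => R ^ q * b q i) i x t
    have h1 := add_le_add (Finset.sum_le_sum hlow) (Finset.sum_le_sum hhigh)
    rw [← hsplit, Finset.sum_sub_distrib, ← Finset.mul_sum] at h1
    have h2 : K * κ * (μ i * layer D.α (ε i) x) * ∑ q ∈ Finset.Ico 1 i, R ^ q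
        ≤ δ / 2 * (μ i * layer D.α (ε i) x * R ^ i) := by
      have h := mul_le_mul_of_nonneg_left hgeo1 (mul_pos hδ hwi).le
      have e1 : δ * (μ i * layer D.α (ε i) x) * (K * κ / δ * ∑ q ∈ Finset.Ico 1 i, R ^ q)
          = K * κ * (μ i * layer D.α (ε i) x) * ∑ q ∈ Finset.Ico 1 i, R ^ q := by
        field_simp
      rw [e1] at h; linarith
    have h3 : ∑ q ∈ Finset.Ico 1 i, δ * (μ q * layer D.α (ε q) x) * R ^ q
        + ∑ q ∈ Finset.Icc i n, δ * (μ q * layer D.α (ε q) x) * R ^ q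
        = δ * ∑ q ∈ Finset.Icc 1 n, μ q * layer D.α (ε q) x * R ^ q := by
      rw [← hsplit, Finset.mul_sum]; exact Finset.sum_congr rfl fun q _ => by ring
    have h4 : μ i * layer D.α (ε i) x * R ^ i
        ≤ ∑ q ∈ Finset.Icc 1 n, μ q * layer D.α (ε q) x * R ^ q :=
      Finset.single_le_sum (f := fun q => μ q * layer D.α (ε q) x * R ^ q)
        (fun q hq => (mul_pos (hwpos q hq) (pow_pos hRpos q)).le) hi
    have h5 : ∑ q ∈ Finset.Icc 1 n, μ q * layer D.α (ε q) x
        ≤ ∑ q ∈ Finset.Icc 1 n, μ q * layer D.α (ε q) x * R ^ q :=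
      Finset.sum_le_sum fun q hq => le_mul_of_one_le_right (hwpos q hq).le (one_le_pow₀ hR1)
    have h6 := hgap i hi x hx t ht
    have h7 := mul_le_mul_of_nonneg_left h4 (half_pos hδ).le
    have h8 := mul_le_mul_of_nonneg_left h5 (half_pos hδ).le
    rw [hβ, e]
    linarith
  have hS : 0 ≤ ∑ q ∈ Finset.Icc 1 n, μ q * layer D.α (ε q) x :=
    Finset.sum_nonneg fun q hq => (hwpos q hq).le
  have hRn : 0 < R ^ n := pow_pos hRpos n
  refine ⟨?_, ?_, ?_⟩
  · have hL0 : 0 ≤ D.L ε β i x t := by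
      refine le_trans ?_ hLβ; positivity
    have h1 : 1 ≤ 1 / D.α * D.L ε β i x t := by
      rw [div_mul_eq_mul_div, one_mul, le_div_iff₀ hα]
      have := mul_nonneg (half_pos hδ).le hS
      linarith
    have h2 : ∑ q ∈ Finset.Icc 1 n, μ q * layer D.α (ε q) x ≤ 2 / δ * D.L ε β i x t := by
      rw [div_mul_eq_mul_div, le_div_iff₀ hδ]
      linarith
    nlinarith
  · have h1 : 1 + μ i * layer D.α (ε i) x / 2 ≤ β i x t := by
      simp only [hβ]
      rw [hsplit]
      have h2 : -(κ * ∑ q ∈ Finset.Ico 1 i, R ^ q) * (μ i * layer D.α (ε i) x)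
          ≤ ∑ q ∈ Finset.Ico 1 i, R ^ q * b q i * layer D.α (ε q) x := by
        rw [Finset.mul_sum, ← Finset.sum_neg_distrib, Finset.sum_mul]
        refine Finset.sum_le_sum fun q hq => ?_
        have hbi : b q i = -(κ * (ε q * μ q / ε i)) :=
          if_neg (by have := Finset.mem_Ico.1 hq; omega)
        rw [hbi]
        have h3 := mul_le_mul_of_nonneg_left (hratio q hq) (mul_pos hκ0 (pow_pos hRpos q)).le
        linarith
      have h4 : R ^ i * (μ i * layer D.α (ε i) x)
          ≤ ∑ q ∈ Finset.Icc i n, R ^ q * b q i * layer D.α (ε q) x := by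
        have h5 : ∀ q ∈ Finset.Icc i n, R ^ q * b q i * layer D.α (ε q) x
            = R ^ q * (μ q * layer D.α (ε q) x) := fun q hq => by
          have hbi : b q i = μ q := if_pos (Finset.mem_Icc.1 hq).1
          rw [hbi]; ring
        rw [Finset.sum_congr rfl h5]
        exact Finset.single_le_sum (f := fun q => R ^ q * (μ q * layer D.α (ε q) x))
          (fun q hq => (mul_pos (pow_pos hRpos q) (hwpos q (hmem q hq))).le)
          (Finset.mem_Icc.2 ⟨le_rfl, hi'.2⟩)
      have h6 := mul_le_mul_of_nonneg_right hgeo2 hwi.le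
      have h7 := mul_le_mul_of_nonneg_right (one_le_pow₀ hR1 : 1 ≤ R ^ i) hwi.le
      linarith
    have h2 : 0 < 1 / D.α + 2 / δ + R ^ n := by positivity
    nlinarith
  · have h1 : β i x t ≤ 1 + R ^ n * ∑ q ∈ Finset.Icc i n, μ q * layer D.α (ε q) x := by
      simp only [hβ]
      rw [hsplit, Finset.mul_sum]
      have h2 : ∑ q ∈ Finset.Ico 1 i, R ^ q * b q i * layer D.α (ε q) x ≤ 0 := by
        refine Finset.sum_nonpos fun q hq => ?_
        have hbi : b q i = -(κ * (ε q * μ q / ε i)) :=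
          if_neg (by have := Finset.mem_Ico.1 hq; omega)
        have := hμ q (hmem' q hq); have := hε q (hmem' q hq); have := hε i hi; have := hB q
        rw [hbi]
        have : 0 ≤ R ^ q * (κ * (ε q * μ q / ε i)) * layer D.α (ε q) x := by positivity
        linarith
      have h3 : ∑ q ∈ Finset.Icc i n, R ^ q * b q i * layer D.α (ε q) x
          ≤ ∑ q ∈ Finset.Icc i n, R ^ n * (μ q * layer D.α (ε q) x) := by
        refine Finset.sum_le_sum fun q hq => ?_
        have hbi : b q i = μ q := if_pos (Finset.mem_Icc.1 hq).1
        rw [hbi, mul_assoc]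
        exact mul_le_mul_of_nonneg_right (pow_le_pow_right₀ hR1 (Finset.mem_Icc.1 hq).2)
          (hwpos q (hmem q hq)).le
      linarith
    have h2 : 0 ≤ ∑ q ∈ Finset.Icc i n, μ q * layer D.α (ε q) x :=
      Finset.sum_nonneg fun q hq => (hwpos q (hmem q hq)).le
    have h3 : 0 < 1 / D.α + 2 / δ := by positivity
    have h4 := mul_nonneg h3.le h2
    linarith

/-- Layer-adapted a priori bound for the system. -/
theorem ParabolicData.exists_layer_bound (D : ParabolicData n) :
    ∃ C : ℝ, 0 < C ∧ ∀ ε μ : ℕ → ℝ, (∀ i ∈ Finset.Icc 1 n, 0 < ε i) →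
      (∀ i ∈ Finset.Icc 1 n, ∀ j ∈ Finset.Icc 1 n, i ≤ j → ε i ≤ ε j) →
      (∀ i ∈ Finset.Icc 1 n, 0 < μ i) →
      (∀ q ∈ Finset.Icc 1 n, ∀ i ∈ Finset.Icc 1 n, q ≤ i → ε q * μ q ≤ ε i * μ i) →
      ∀ (z : ℕ → ℝ → ℝ → ℝ) (K : ℝ), 0 ≤ K → (∀ i ∈ Finset.Icc 1 n, Smooth2 (z i)) →
      (∀ i ∈ Finset.Icc 1 n, ∀ x ∈ Set.Icc (0:ℝ) 1, ∀ t ∈ Set.Icc 0 D.T,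
        |D.L ε z i x t| ≤ K * (1 + ∑ q ∈ Finset.Icc 1 n, μ q * layer D.α (ε q) x)) →
      (∀ i ∈ Finset.Icc 1 n, ∀ x ∈ Set.Icc (0:ℝ) 1, |z i x 0| ≤ K) →
      (∀ i ∈ Finset.Icc 1 n, ∀ t ∈ Set.Icc 0 D.T, ∀ x, (x = 0 ∨ x = 1) → |z i x t| ≤ K * μ i) →
      ∀ i ∈ Finset.Icc 1 n, ∀ x ∈ Set.Icc (0:ℝ) 1, ∀ t ∈ Set.Icc 0 D.T,
        |z i x t| ≤ C * K * (1 + ∑ q ∈ Finset.Icc i n, μ q * layer D.α (ε q) x) := by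
  obtain ⟨C, hC, H⟩ := D.exists_barrier
  refine ⟨C * C, by positivity, fun ε μ hε hmono hμ hεμ z K hK hz hL h0 h1 i hi x hx t ht => ?_⟩
  obtain ⟨β, hβ, hb⟩ := H ε μ hε hmono hμ hεμ
  have key := D.comparison hε hz (β := fun i x t => (K * C) * β i x t)
    (fun i _ => (hβ i).const_mul _)
    (fun i hi x hx t ht => by
      rw [D.L_const_mul (hβ i), mul_assoc]
      exact (hL i hi x hx t ht).trans (mul_le_mul_of_nonneg_left (hb i hi x hx t ht).1 hK))
    (fun i hi x hx t ht hΓ => by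
      have h2 := mul_le_mul_of_nonneg_left (hb i hi x hx t ht).2.1 hK
      have h3 := mul_pos (hμ i hi) (layer_pos D.α (ε i) x)
      rw [mul_assoc]
      refine le_trans ?_ h2
      by_cases hx01 : x = 0 ∨ x = 1
      · refine (h1 i hi t ht x hx01).trans (mul_le_mul_of_nonneg_left ?_ hK)
        have := mul_le_mul_of_nonneg_left (one_le_layer (α := D.α) (e := ε i) hx01) (hμ i hi).le
        linarith
      · have ht0 : t = 0 := by tauto
        rw [ht0]
        refine (h0 i hi x hx).trans (le_mul_of_one_le_right hK (by linarith)))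
    i hi x hx t ht
  have h4 := mul_le_mul_of_nonneg_left (hb i hi x hx t ht).2.2 (mul_nonneg hK hC.le)
  linarith

/-- A smooth solution of the initial-boundary value problem for some admissible diffusion
parameters. -/
structure ParabolicData.Sol (D : ParabolicData n) where
  ε : ℕ → ℝ
  ε_pos : ∀ i ∈ Finset.Icc 1 n, 0 < ε i
  ε_le_one : ∀ i ∈ Finset.Icc 1 n, ε i ≤ 1
  ε_mono : ∀ i ∈ Finset.Icc 1 n, ∀ j ∈ Finset.Icc 1 n, i ≤ j → ε i ≤ ε j
  u : ℕ → ℝ → ℝ → ℝ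
  u_smooth : ∀ i ∈ Finset.Icc 1 n, Smooth2 (u i)
  eqn : ∀ i ∈ Finset.Icc 1 n, EqOnOpen D.T (D.L ε u i) (D.f i)
  boundary : ∀ i ∈ Finset.Icc 1 n, ∀ x ∈ Set.Icc (0:ℝ) 1, ∀ t ∈ Set.Icc (0:ℝ) D.T,
    (x = 0 ∨ x = 1 ∨ t = 0) → u i x t = D.φ i x t

/-- `h − ∑ j, a j * z j`. -/
noncomputable def subSum (n : ℕ) (h : ℝ → ℝ → ℝ) (a z : ℕ → ℝ → ℝ → ℝ) (x t : ℝ) : ℝ :=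
  h x t - ∑ j ∈ Finset.Icc 1 n, a j x t * z j x t

theorem subSum_smooth {h : ℝ → ℝ → ℝ} {a z : ℕ → ℝ → ℝ → ℝ} (hh : Smooth2 h)
    (ha : ∀ j ∈ Finset.Icc 1 n, Smooth2 (a j)) (hz : ∀ j ∈ Finset.Icc 1 n, Smooth2 (z j)) :
    Smooth2 (subSum n h a z) :=
  hh.sub (Smooth2.sum fun j hj => (ha j hj).mul (hz j hj))

theorem dX_subSum {h : ℝ → ℝ → ℝ} {a z : ℕ → ℝ → ℝ → ℝ} (hh : Smooth2 h)
    (ha : ∀ j ∈ Finset.Icc 1 n, Smooth2 (a j)) (hz : ∀ j ∈ Finset.Icc 1 n, Smooth2 (z j)) :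
    dX (subSum n h a z) =
      subSum n (subSum n (dX h) (fun j => dX (a j)) z) a (fun j => dX (z j)) := by
  funext x t
  have hs : ∀ j ∈ Finset.Icc 1 n, Smooth2 (fun x t => a j x t * z j x t) :=
    fun j hj => (ha j hj).mul (hz j hj)
  unfold subSum
  rw [dX_sub hh (Smooth2.sum hs), dX_sum hs, sub_sub, ← Finset.sum_add_distrib]
  congr 1
  exact Finset.sum_congr rfl fun j hj => dX_mul (ha j hj) (hz j hj) x t

theorem dT_subSum {h : ℝ → ℝ → ℝ} {a z : ℕ → ℝ → ℝ → ℝ} (hh : Smooth2 h)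
    (ha : ∀ j ∈ Finset.Icc 1 n, Smooth2 (a j)) (hz : ∀ j ∈ Finset.Icc 1 n, Smooth2 (z j)) :
    dT (subSum n h a z) =
      subSum n (subSum n (dT h) (fun j => dT (a j)) z) a (fun j => dT (z j)) := by
  funext x t
  have hs : ∀ j ∈ Finset.Icc 1 n, Smooth2 (fun x t => a j x t * z j x t) :=
    fun j hj => (ha j hj).mul (hz j hj)
  unfold subSum
  rw [dT_sub hh (Smooth2.sum hs), dT_sum hs, sub_sub, ← Finset.sum_add_distrib]
  congr 1
  exact Finset.sum_congr rfl fun j hj => dT_mul (ha j hj) (hz j hj) x t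

namespace ParabolicData

variable (D : ParabolicData n) {ε : ℕ → ℝ} {z : ℕ → ℝ → ℝ → ℝ} {i : ℕ} {g : ℝ → ℝ → ℝ}

theorem L_smooth (hi : i ∈ Finset.Icc 1 n) (hz : ∀ j ∈ Finset.Icc 1 n, Smooth2 (z j)) :
    Smooth2 (D.L ε z i) :=
  (((hz i hi).dT.sub ((hz i hi).dX.dX.const_mul (ε i))).add
    (Smooth2.sum fun j hj => (D.A_smooth i hi j hj).mul (hz j hj)))

theorem L_dX (hi : i ∈ Finset.Icc 1 n) (hz : ∀ j ∈ Finset.Icc 1 n, Smooth2 (z j)) (x t : ℝ) :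
    D.L ε (fun j => dX (z j)) i x t
      = subSum n (dX (D.L ε z i)) (fun j => dX (D.A i j)) z x t := by
  have hs : ∀ j ∈ Finset.Icc 1 n, Smooth2 (fun x t => D.A i j x t * z j x t) :=
    fun j hj => (D.A_smooth i hi j hj).mul (hz j hj)
  have h1 := (hz i hi).dT
  have h2 := (hz i hi).dX.dX.const_mul (ε i)
  have e : dX (D.L ε z i) x t = dT (dX (z i)) x t - ε i * dX (dX (dX (z i))) x t
      + ∑ j ∈ Finset.Icc 1 n, (dX (D.A i j) x t * z j x t + D.A i j x t * dX (z j) x t) := by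
    unfold ParabolicData.L
    rw [dX_add (h1.sub h2) (Smooth2.sum hs), dX_sub h1 h2, dX_const_mul (hz i hi).dX.dX,
      dX_sum hs, (hz i hi).dX_dT]
    congr 1
    exact Finset.sum_congr rfl fun j hj => dX_mul (D.A_smooth i hi j hj) (hz j hj) x t
  rw [subSum, e, Finset.sum_add_distrib, ParabolicData.L]
  ring

theorem L_dT (hi : i ∈ Finset.Icc 1 n) (hz : ∀ j ∈ Finset.Icc 1 n, Smooth2 (z j)) (x t : ℝ) :
    D.L ε (fun j => dT (z j)) i x t
      = subSum n (dT (D.L ε z i)) (fun j => dT (D.A i j)) z x t := by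
  have hs : ∀ j ∈ Finset.Icc 1 n, Smooth2 (fun x t => D.A i j x t * z j x t) :=
    fun j hj => (D.A_smooth i hi j hj).mul (hz j hj)
  have h1 := (hz i hi).dT
  have h2 := (hz i hi).dX.dX.const_mul (ε i)
  have e : dT (D.L ε z i) x t = dT (dT (z i)) x t - ε i * dX (dX (dT (z i))) x t
      + ∑ j ∈ Finset.Icc 1 n, (dT (D.A i j) x t * z j x t + D.A i j x t * dT (z j) x t) := by
    unfold ParabolicData.L
    rw [dT_add (h1.sub h2) (Smooth2.sum hs), dT_sub h1 h2, dT_const_mul (hz i hi).dX.dX,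
      dT_sum hs, (hz i hi).dX_dT, (hz i hi).dX.dX_dT]
    congr 1
    exact Finset.sum_congr rfl fun j hj => dT_mul (D.A_smooth i hi j hj) (hz j hj) x t
  rw [subSum, e, Finset.sum_add_distrib, ParabolicData.L]
  ring

theorem L_dX_eqOn (hi : i ∈ Finset.Icc 1 n) (hz : ∀ j ∈ Finset.Icc 1 n, Smooth2 (z j))
    (h : EqOnOpen D.T (D.L ε z i) g) :
    EqOnOpen D.T (D.L ε (fun j => dX (z j)) i) (subSum n (dX g) (fun j => dX (D.A i j)) z) :=
  fun x hx t ht => by rw [D.L_dX hi hz, subSum, subSum, h.dX x hx t ht]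

theorem L_dT_eqOn (hi : i ∈ Finset.Icc 1 n) (hz : ∀ j ∈ Finset.Icc 1 n, Smooth2 (z j))
    (h : EqOnOpen D.T (D.L ε z i) g) :
    EqOnOpen D.T (D.L ε (fun j => dT (z j)) i) (subSum n (dT g) (fun j => dT (D.A i j)) z) :=
  fun x hx t ht => by rw [D.L_dT hi hz, subSum, subSum, h.dT x hx t ht]

/-- The closed space-time rectangle. -/
def rect : Set (ℝ × ℝ) := {p | p.1 ∈ Set.Icc (0:ℝ) 1 ∧ p.2 ∈ Set.Icc 0 D.T}

/-- The bottom side `t = 0`. -/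
def bottom (_D : ParabolicData n) : Set (ℝ × ℝ) := {p | p.1 ∈ Set.Icc (0:ℝ) 1 ∧ p.2 = 0}

/-- The lateral sides `x = 0` and `x = 1`. -/
def side : Set (ℝ × ℝ) := {p | (p.1 = 0 ∨ p.1 = 1) ∧ p.2 ∈ Set.Icc 0 D.T}

theorem bottom_subset : D.bottom ⊆ D.rect := fun p hp =>
  ⟨hp.1, by rw [hp.2]; exact ⟨le_rfl, D.T_pos.le⟩⟩

theorem side_subset : D.side ⊆ D.rect := fun p hp =>
  ⟨by rcases hp.1 with h | h <;> simp [h], hp.2⟩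

/-- `Z` is bounded by a multiple of `W` on `S`, uniformly over all solutions for the data `D`. -/
def Dom (S : Set (ℝ × ℝ)) (Z W : D.Sol → ℝ → ℝ → ℝ) : Prop :=
  ∃ C : ℝ, 0 ≤ C ∧ ∀ s : D.Sol, ∀ x t : ℝ, (x, t) ∈ S → |Z s x t| ≤ C * W s x t

/-- The layer weight with amplitudes `μ (ε q)`, containing the layers `q ≥ i`. -/
noncomputable def weight (μ : ℝ → ℝ) (i : ℕ) (s : D.Sol) (x _t : ℝ) : ℝ :=
  1 + ∑ q ∈ Finset.Icc i n, μ (s.ε q) * layer D.α (s.ε q) x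

namespace Dom

variable {D} {S S' : Set (ℝ × ℝ)} {Z Z' W W' : D.Sol → ℝ → ℝ → ℝ}

theorem subset (h : D.Dom S Z W) (hS : S' ⊆ S) : D.Dom S' Z W := by
  obtain ⟨C, hC, H⟩ := h
  exact ⟨C, hC, fun s x t hxt => H s x t (hS hxt)⟩

theorem congr (h : D.Dom S Z W) (hZ : ∀ s x t, (x, t) ∈ S → Z' s x t = Z s x t) :
    D.Dom S Z' W := by
  obtain ⟨C, hC, H⟩ := h
  exact ⟨C, hC, fun s x t hxt => hZ s x t hxt ▸ H s x t hxt⟩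

theorem mono (h : D.Dom S Z W) (hW : ∀ s x t, (x, t) ∈ S → W s x t ≤ W' s x t) :
    D.Dom S Z W' := by
  obtain ⟨C, hC, H⟩ := h
  exact ⟨C, hC, fun s x t hxt =>
    (H s x t hxt).trans (mul_le_mul_of_nonneg_left (hW s x t hxt) hC)⟩

theorem add (h : D.Dom S Z W) (h' : D.Dom S Z' W) :
    D.Dom S (fun s x t => Z s x t + Z' s x t) W := by
  obtain ⟨C, hC, H⟩ := h
  obtain ⟨C', hC', H'⟩ := h'
  refine ⟨C + C', by positivity, fun s x t hxt => (abs_add_le _ _).trans ?_⟩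
  rw [add_mul]
  exact add_le_add (H s x t hxt) (H' s x t hxt)

theorem neg (h : D.Dom S Z W) : D.Dom S (fun s x t => -Z s x t) W := by
  obtain ⟨C, hC, H⟩ := h
  exact ⟨C, hC, fun s x t hxt => by rw [abs_neg]; exact H s x t hxt⟩

theorem sub (h : D.Dom S Z W) (h' : D.Dom S Z' W) :
    D.Dom S (fun s x t => Z s x t - Z' s x t) W := by
  simpa only [sub_eq_add_neg] using h.add h'.neg

theorem sum {ι : Type*} {J : Finset ι} {Z : ι → D.Sol → ℝ → ℝ → ℝ}
    (h : ∀ j ∈ J, D.Dom S (Z j) W) :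
    D.Dom S (fun s x t => ∑ j ∈ J, Z j s x t) W := by
  choose! C hC H using h
  refine ⟨∑ j ∈ J, C j, Finset.sum_nonneg hC, fun s x t hxt => ?_⟩
  rw [Finset.sum_mul]
  exact (Finset.abs_sum_le_sum_abs _ _).trans (Finset.sum_le_sum fun j hj => H j hj s x t hxt)

theorem data_mul (hS : S ⊆ D.rect) {a : ℝ → ℝ → ℝ} (ha : Smooth2 a) (h : D.Dom S Z W) :
    D.Dom S (fun s x t => a x t * Z s x t) W := by
  obtain ⟨C, hC, H⟩ := h
  obtain ⟨K, hK⟩ := ha.exists_bound D.T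
  refine ⟨|K| * C, by positivity, fun s x t hxt => ?_⟩
  rw [abs_mul, mul_assoc]
  exact mul_le_mul ((hK x (hS hxt).1 t (hS hxt).2).trans (le_abs_self K)) (H s x t hxt)
    (abs_nonneg _) (abs_nonneg _)

theorem data (hS : S ⊆ D.rect) {a : ℝ → ℝ → ℝ} (ha : Smooth2 a)
    (hW : ∀ s x t, 1 ≤ W s x t) : D.Dom S (fun _ x t => a x t) W := by
  obtain ⟨K, hK⟩ := ha.exists_bound D.T
  refine ⟨|K|, abs_nonneg _, fun s x t hxt => ?_⟩
  exact ((hK x (hS hxt).1 t (hS hxt).2).trans (le_abs_self K)).trans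
    (le_mul_of_one_le_right (abs_nonneg _) (hW s x t))

theorem eps_mul {i : ℕ} (hi : i ∈ Finset.Icc 1 n) (h : D.Dom S Z W) :
    D.Dom S (fun s x t => s.ε i * Z s x t) W := by
  obtain ⟨C, hC, H⟩ := h
  refine ⟨C, hC, fun s x t hxt => ?_⟩
  rw [abs_mul, abs_of_pos (s.ε_pos i hi)]
  exact (mul_le_of_le_one_left (abs_nonneg _) (s.ε_le_one i hi)).trans (H s x t hxt)

theorem subSum (hS : S ⊆ D.rect) {a : ℕ → ℝ → ℝ → ℝ} {z : D.Sol → ℕ → ℝ → ℝ → ℝ}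
    (ha : ∀ j ∈ Finset.Icc 1 n, Smooth2 (a j)) (h : D.Dom S Z W)
    (hz : ∀ j ∈ Finset.Icc 1 n, D.Dom S (fun s => z s j) W) :
    D.Dom S (fun s => subSum n (Z s) a (z s)) W :=
  h.sub (sum fun j hj => data_mul hS (ha j hj) (hz j hj))

end Dom

variable {D}

theorem weight_term_nonneg {μ : ℝ → ℝ} (hμ : ∀ e, 0 < e → 0 < μ e) (s : D.Sol) (x : ℝ) :
    ∀ q ∈ Finset.Icc 1 n, 0 ≤ μ (s.ε q) * layer D.α (s.ε q) x :=
  fun q hq => (mul_pos (hμ _ (s.ε_pos q hq)) (layer_pos _ _ _)).le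

theorem one_le_weight {μ : ℝ → ℝ} (hμ : ∀ e, 0 < e → 0 < μ e) (s : D.Sol) (x t : ℝ) :
    1 ≤ D.weight μ 1 s x t :=
  le_add_of_nonneg_right (Finset.sum_nonneg (weight_term_nonneg hμ s x))

theorem weight_le_weight_one {μ : ℝ → ℝ} (hμ : ∀ e, 0 < e → 0 < μ e) {i : ℕ}
    (hi : i ∈ Finset.Icc 1 n) (s : D.Sol) (x t : ℝ) :
    D.weight μ i s x t ≤ D.weight μ 1 s x t := by
  refine add_le_add_right (Finset.sum_le_sum_of_subset_of_nonneg (fun q hq => ?_)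
    fun q hq _ => weight_term_nonneg hμ s x q hq) 1
  simp only [Finset.mem_Icc] at hi hq ⊢
  omega

theorem Dom.of_L {μ : ℝ → ℝ} (hμ : ∀ e, 0 < e → 0 < μ e)
    (hμm : ∀ e e', 0 < e → e ≤ e' → e * μ e ≤ e' * μ e') {z : D.Sol → ℕ → ℝ → ℝ → ℝ}
    (hz : ∀ s, ∀ i ∈ Finset.Icc 1 n, Smooth2 (z s i))
    (hL : ∀ i ∈ Finset.Icc 1 n, D.Dom D.rect (fun s => D.L s.ε (z s) i) (D.weight μ 1))
    (h0 : ∀ i ∈ Finset.Icc 1 n, D.Dom D.bottom (fun s => z s i) fun _ _ _ => 1)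
    (h1 : ∀ i ∈ Finset.Icc 1 n, D.Dom D.side (fun s => z s i) fun s _ _ => μ (s.ε i)) :
    ∀ i ∈ Finset.Icc 1 n, D.Dom D.rect (fun s => z s i) (D.weight μ i) := by
  obtain ⟨C, hC, H⟩ := D.exists_layer_bound
  choose! a ha0 ha using hL
  choose! b hb0 hb using h0
  choose! c hc0 hc using h1
  set K := ∑ i ∈ Finset.Icc 1 n, (a i + b i + c i) with hK
  have hterm : ∀ i ∈ Finset.Icc 1 n, 0 ≤ a i + b i + c i := fun i hi => by
    have := ha0 i hi; have := hb0 i hi; have := hc0 i hi; positivity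
  have hKi : ∀ i ∈ Finset.Icc 1 n, a i + b i + c i ≤ K := fun i hi =>
    Finset.single_le_sum (f := fun i => a i + b i + c i) hterm hi
  have hK0 : 0 ≤ K := Finset.sum_nonneg hterm
  intro i hi
  refine ⟨C * K, by positivity, fun s x t hxt => ?_⟩
  refine H s.ε (fun q => μ (s.ε q)) s.ε_pos s.ε_mono (fun q hq => hμ _ (s.ε_pos q hq))
    (fun q hq j hj hqj => hμm _ _ (s.ε_pos q hq) (s.ε_mono q hq j hj hqj)) (z s) K hK0 (hz s)
    (fun j hj y hy r hr => ?_) (fun j hj y hy => ?_) (fun j hj r hr y hy => ?_)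
    i hi x hxt.1 t hxt.2
  · refine (ha j hj s y r ⟨hy, hr⟩).trans (mul_le_mul_of_nonneg_right ?_ ?_)
    · linarith [hKi j hj, ha0 j hj, hb0 j hj, hc0 j hj]
    · exact zero_le_one.trans (one_le_weight hμ s y r)
  · refine (hb j hj s y 0 ⟨hy, rfl⟩).trans ?_
    linarith [hKi j hj, ha0 j hj, hb0 j hj, hc0 j hj]
  · refine (hc j hj s y r ⟨hy, hr⟩).trans (mul_le_mul_of_nonneg_right ?_ ?_)
    · linarith [hKi j hj, ha0 j hj, hb0 j hj, hc0 j hj]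
    · exact (hμ _ (s.ε_pos j hj)).le

theorem layer_le_two {α e x : ℝ} (hx : x ∈ Set.Icc (0:ℝ) 1) : layer α e x ≤ 2 := by
  have h1 : Real.exp (-(√(α / e) * x)) ≤ 1 := Real.exp_le_one_iff.2 (by
    have := mul_nonneg (Real.sqrt_nonneg (α / e)) hx.1; linarith)
  have h2 : Real.exp (-(√(α / e) * (1 - x))) ≤ 1 := Real.exp_le_one_iff.2 (by
    have := mul_nonneg (Real.sqrt_nonneg (α / e)) (sub_nonneg.2 hx.2); linarith)
  unfold layer; linarith

theorem Dom.bounded_of_L {z : D.Sol → ℕ → ℝ → ℝ → ℝ}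
    (hz : ∀ s, ∀ i ∈ Finset.Icc 1 n, Smooth2 (z s i))
    (hL : ∀ i ∈ Finset.Icc 1 n, D.Dom D.rect (fun s => D.L s.ε (z s) i) fun _ _ _ => 1)
    (h0 : ∀ i ∈ Finset.Icc 1 n, D.Dom D.bottom (fun s => z s i) fun _ _ _ => 1)
    (h1 : ∀ i ∈ Finset.Icc 1 n, D.Dom D.side (fun s => z s i) fun _ _ _ => 1) :
    ∀ i ∈ Finset.Icc 1 n, D.Dom D.rect (fun s => z s i) fun _ _ _ => 1 := by
  intro i hi
  obtain ⟨C, hC, H⟩ := Dom.of_L (D := D) (μ := fun _ => 1) (fun _ _ => one_pos)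
    (fun e e' _ h => by simpa using h) hz
    (fun i hi => (hL i hi).mono fun s x t _ => one_le_weight (fun _ _ => one_pos) s x t) h0 h1 i hi
  refine ⟨C * (1 + n * 2), by positivity, fun s x t hxt => (H s x t hxt).trans ?_⟩
  rw [mul_one]
  refine mul_le_mul_of_nonneg_left
    ((weight_le_weight_one (fun _ _ => one_pos) hi s x t).trans ?_) hC
  refine add_le_add_right ?_ 1
  refine (Finset.sum_le_card_nsmul _ _ 2 fun q _ => ?_).trans ?_
  · rw [one_mul]; exact layer_le_two hxt.1
  · simp

end ParabolicData

theorem abs_deriv_le_of_bounds {g g' g'' : ℝ → ℝ} {a b P Q : ℝ} (hab : a < b)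
    (hg : ∀ y, HasDerivAt g (g' y) y) (hg' : ∀ y, HasDerivAt g' (g'' y) y)
    (hP : ∀ y ∈ Set.Icc a b, |g y| ≤ P) (hQ : ∀ y ∈ Set.Icc a b, |g'' y| ≤ Q) :
    ∀ x ∈ Set.Icc a b, |g' x| ≤ 2 * P / (b - a) + Q * (b - a) := by
  intro x hx
  have hba : 0 < b - a := sub_pos.2 hab
  have hQ0 : 0 ≤ Q := (abs_nonneg _).trans (hQ x hx)
  obtain ⟨ξ, hξ, hξe⟩ := exists_hasDerivAt_eq_slope g g' hab
    (fun y _ => (hg y).continuousAt.continuousWithinAt) (fun y _ => hg y)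
  have h1 : |g' ξ| ≤ 2 * P / (b - a) := by
    rw [hξe, abs_div, abs_of_pos hba]
    refine div_le_div_of_nonneg_right ?_ hba.le
    have h2 := hP a ⟨le_rfl, hab.le⟩
    have h3 := hP b ⟨hab.le, le_rfl⟩
    rw [abs_le] at *
    constructor <;> linarith
  have h2 : |g' x - g' ξ| ≤ Q * (b - a) := by
    have h3 := (convex_Icc a b).norm_image_sub_le_of_norm_hasDerivWithin_le
      (fun y _ => (hg' y).hasDerivWithinAt) hQ (Set.Ioo_subset_Icc_self hξ) hx
    refine h3.trans (mul_le_mul_of_nonneg_left ?_ hQ0)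
    rw [Real.norm_eq_abs, abs_le]
    constructor <;> linarith [hx.1, hx.2, hξ.1, hξ.2]
  calc |g' x| = |g' ξ + (g' x - g' ξ)| := by ring_nf
    _ ≤ |g' ξ| + |g' x - g' ξ| := abs_add_le _ _
    _ ≤ _ := add_le_add h1 h2

namespace ParabolicData

variable {D : ParabolicData n} {S : Set (ℝ × ℝ)} {W : D.Sol → ℝ → ℝ → ℝ} {i : ℕ}

theorem Dom.of_eqOn {Z Z' : D.Sol → ℝ → ℝ → ℝ} (H : D.Dom D.rect Z' W)
    (hZ : ∀ s, Smooth2 (Z s)) (hZ' : ∀ s, Smooth2 (Z' s))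
    (h : ∀ s, EqOnOpen D.T (Z s) (Z' s)) : D.Dom D.rect Z W :=
  H.congr fun s x t hxt => (h s).closed D.T_pos (hZ s) (hZ' s) x hxt.1 t hxt.2

theorem Dom.dX_subSum (hS : S ⊆ D.rect) {h : D.Sol → ℝ → ℝ → ℝ} {a : ℕ → ℝ → ℝ → ℝ}
    {z : D.Sol → ℕ → ℝ → ℝ → ℝ} (hh : ∀ s, Smooth2 (h s))
    (ha : ∀ j ∈ Finset.Icc 1 n, Smooth2 (a j))
    (hz : ∀ s, ∀ j ∈ Finset.Icc 1 n, Smooth2 (z s j))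
    (h1 : D.Dom S (fun s => dX (h s)) W)
    (h2 : ∀ j ∈ Finset.Icc 1 n, D.Dom S (fun s => z s j) W)
    (h3 : ∀ j ∈ Finset.Icc 1 n, D.Dom S (fun s => dX (z s j)) W) :
    D.Dom S (fun s => dX (_root_.subSum n (h s) a (z s))) W :=
  (Dom.subSum hS ha (Dom.subSum hS (fun j hj => (ha j hj).dX) h1 h2) h3).congr
    fun s x t _ => by rw [_root_.dX_subSum (hh s) ha (hz s)]

theorem Dom.dX_of_bounds (hi : i ∈ Finset.Icc 1 n) {Z : D.Sol → ℝ → ℝ → ℝ}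
    (hZ : ∀ s, Smooth2 (Z s)) (h0 : D.Dom D.rect Z fun _ _ _ => 1)
    (h2 : D.Dom D.rect (fun s x t => s.ε i * dX (dX (Z s)) x t) fun _ _ _ => 1) :
    D.Dom D.rect (fun s => dX (Z s)) fun s _ _ => (√(s.ε i))⁻¹ := by
  obtain ⟨P, hP0, hP⟩ := h0
  obtain ⟨Q, hQ0, hQ⟩ := h2
  refine ⟨4 * P + Q, by positivity, fun s x t hxt => ?_⟩
  have he := s.ε_pos i hi
  set r := √(s.ε i) with hr
  have hr0 : 0 < r := Real.sqrt_pos.2 he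
  have hr1 : r ≤ 1 := Real.sqrt_le_one.2 (s.ε_le_one i hi)
  have hrr : r * r = s.ε i := Real.mul_self_sqrt he.le
  obtain ⟨a, ha0, ha1, hxa⟩ : ∃ a, 0 ≤ a ∧ a + r / 2 ≤ 1 ∧ x ∈ Set.Icc a (a + r / 2) := by
    have h1 := hxt.1.1
    have h2 := hxt.1.2
    simp only at h1 h2
    rcases le_total x (1 / 2) with h | h
    · exact ⟨x, h1, by linarith, le_rfl, by linarith⟩
    · exact ⟨x - r / 2, by linarith, by linarith, by linarith, by linarith⟩
  have hsub : ∀ y ∈ Set.Icc a (a + r / 2), (y, t) ∈ D.rect := fun y hy =>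
    ⟨⟨ha0.trans hy.1, hy.2.trans ha1⟩, hxt.2⟩
  have := abs_deriv_le_of_bounds (b := a + r / 2) (P := P) (Q := Q / s.ε i)
    (by linarith) (fun y => (hZ s).hasDerivAt_fst y t) (fun y => (hZ s).dX.hasDerivAt_fst y t)
    (fun y hy => by simpa using hP s y t (hsub y hy))
    (fun y hy => by
      have h := hQ s y t (hsub y hy)
      rw [abs_mul, abs_of_pos he, mul_one] at h
      rw [le_div_iff₀ he]; linarith) x hxa
  refine this.trans (le_of_eq_of_le ?_ (mul_le_mul_of_nonneg_right
    (show 4 * P + Q / 2 ≤ 4 * P + Q by linarith) (by positivity)))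
  beta_reduce
  rw [← hr, ← hrr, add_sub_cancel_left]
  field_simp
  ring

namespace Sol

variable (s : D.Sol)

theorem L_dT_u (hi : i ∈ Finset.Icc 1 n) :
    EqOnOpen D.T (D.L s.ε (fun j => dT (s.u j)) i)
      (subSum n (dT (D.f i)) (fun j => dT (D.A i j)) s.u) :=
  D.L_dT_eqOn hi s.u_smooth (s.eqn i hi)

theorem L_dX_u (hi : i ∈ Finset.Icc 1 n) :
    EqOnOpen D.T (D.L s.ε (fun j => dX (s.u j)) i)
      (subSum n (dX (D.f i)) (fun j => dX (D.A i j)) s.u) :=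
  D.L_dX_eqOn hi s.u_smooth (s.eqn i hi)

/-- The right-hand side of the equation for `∂ₜ u`. -/
noncomputable def forceT (i : ℕ) : ℝ → ℝ → ℝ :=
  subSum n (dT (D.f i)) (fun j => dT (D.A i j)) s.u

/-- The right-hand side of the equation for `∂ₓ u`. -/
noncomputable def forceX (i : ℕ) : ℝ → ℝ → ℝ :=
  subSum n (dX (D.f i)) (fun j => dX (D.A i j)) s.u

theorem forceT_smooth (hi : i ∈ Finset.Icc 1 n) : Smooth2 (s.forceT i) :=
  subSum_smooth (D.f_smooth i hi).dT (fun j hj => (D.A_smooth i hi j hj).dT) s.u_smooth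

theorem forceX_smooth (hi : i ∈ Finset.Icc 1 n) : Smooth2 (s.forceX i) :=
  subSum_smooth (D.f_smooth i hi).dX (fun j hj => (D.A_smooth i hi j hj).dX) s.u_smooth

/-- The value of `∂ₜ u` at `t = 0`. -/
noncomputable def initT (i : ℕ) (x t : ℝ) : ℝ :=
  subSum n (D.f i) (D.A i) D.φ x t + s.ε i * dX (dX (D.φ i)) x t

theorem initT_smooth (hi : i ∈ Finset.Icc 1 n) : Smooth2 (s.initT i) :=
  (subSum_smooth (D.f_smooth i hi) (D.A_smooth i hi) D.φ_smooth).add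
    ((D.φ_smooth i hi).dX.dX.const_mul _)

theorem eps_dX_dX (hi : i ∈ Finset.Icc 1 n) :
    EqOnOpen D.T (fun x t => s.ε i * dX (dX (s.u i)) x t)
      (fun x t => dT (s.u i) x t - subSum n (D.f i) (D.A i) s.u x t) := fun x hx t ht => by
  have h := s.eqn i hi x hx t ht
  unfold ParabolicData.L at h
  unfold subSum
  linarith

theorem eps_dX_dX_dT (hi : i ∈ Finset.Icc 1 n) :
    EqOnOpen D.T (fun x t => s.ε i * dX (dX (dT (s.u i))) x t)
      (fun x t => dT (dT (s.u i)) x t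
        - subSum n (s.forceT i) (D.A i) (fun j => dT (s.u j)) x t) := fun x hx t ht => by
  have h := s.L_dT_u hi x hx t ht
  unfold ParabolicData.L at h
  simp only [subSum] at h ⊢
  simp only [forceT, subSum]
  linarith

theorem boundary_bottom (hi : i ∈ Finset.Icc 1 n) :
    ∀ x ∈ Set.Icc (0:ℝ) 1, s.u i x 0 = D.φ i x 0 := fun x hx =>
  s.boundary i hi x hx 0 ⟨le_rfl, D.T_pos.le⟩ (Or.inr (Or.inr rfl))

theorem dT_bottom (hi : i ∈ Finset.Icc 1 n) :
    ∀ x ∈ Set.Icc (0:ℝ) 1, dT (s.u i) x 0 = s.initT i x 0 := fun x hx => by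
  have hu := s.u_smooth i hi
  have hφ := D.φ_smooth i hi
  have h := (s.eps_dX_dX hi).closed D.T_pos (hu.dX.dX.const_mul _)
    (hu.dT.sub (subSum_smooth (D.f_smooth i hi) (D.A_smooth i hi) s.u_smooth)) x hx 0
    ⟨le_rfl, D.T_pos.le⟩
  have h2 := dX_eq_of_eq_on_line hu.dX hφ.dX
    (dX_eq_of_eq_on_line hu hφ (s.boundary_bottom hi)) x hx
  have h3 : subSum n (D.f i) (D.A i) s.u x 0 = subSum n (D.f i) (D.A i) D.φ x 0 := by
    unfold subSum
    congr 1
    exact Finset.sum_congr rfl fun j hj => by rw [s.boundary_bottom hj x hx]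
  rw [initT, ← h2, ← h3]
  linarith

theorem boundary_side (hi : i ∈ Finset.Icc 1 n) {x : ℝ} (hx : x = 0 ∨ x = 1) :
    ∀ t ∈ Set.Icc 0 D.T, s.u i x t = D.φ i x t := fun t ht =>
  s.boundary i hi x (by rcases hx with h | h <;> simp [h]) t ht (by tauto)

end Sol

theorem one_le_one_fun : ∀ (_ : D.Sol) (_ _ : ℝ), (1:ℝ) ≤ 1 := fun _ _ _ => le_rfl

theorem u_bounded (hi : i ∈ Finset.Icc 1 n) : D.Dom D.rect (fun s => s.u i) fun _ _ _ => 1 := by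
  refine Dom.bounded_of_L (fun s => s.u_smooth) (fun i hi => ?_) (fun i hi => ?_)
    (fun i hi => ?_) i hi
  · exact (Dom.data subset_rfl (D.f_smooth i hi) one_le_one_fun).of_eqOn
      (fun s => D.L_smooth hi s.u_smooth) (fun _ => D.f_smooth i hi) fun s => s.eqn i hi
  · exact (Dom.data D.bottom_subset (D.φ_smooth i hi) one_le_one_fun).congr fun s x t hxt => by
      have h2 : t = 0 := hxt.2
      rw [h2]; exact s.boundary_bottom hi x hxt.1
  · exact (Dom.data D.side_subset (D.φ_smooth i hi) one_le_one_fun).congr fun s x t hxt =>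
      s.boundary_side hi hxt.1 t hxt.2

theorem forceT_bounded (hi : i ∈ Finset.Icc 1 n) :
    D.Dom D.rect (fun s => s.forceT i) fun _ _ _ => 1 :=
  Dom.subSum subset_rfl (fun j hj => (D.A_smooth i hi j hj).dT)
    (Dom.data subset_rfl (D.f_smooth i hi).dT one_le_one_fun) fun _ hj => u_bounded hj

theorem forceX_bounded (hi : i ∈ Finset.Icc 1 n) :
    D.Dom D.rect (fun s => s.forceX i) fun _ _ _ => 1 :=
  Dom.subSum subset_rfl (fun j hj => (D.A_smooth i hi j hj).dX)
    (Dom.data subset_rfl (D.f_smooth i hi).dX one_le_one_fun) fun _ hj => u_bounded hj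

theorem add_eps_mul_bounded (hi : i ∈ Finset.Icc 1 n) (hS : S ⊆ D.rect) {F G : ℝ → ℝ → ℝ}
    (hF : Smooth2 F) (hG : Smooth2 G) :
    D.Dom S (fun s x t => F x t + s.ε i * G x t) fun _ _ _ => 1 :=
  (Dom.data hS hF one_le_one_fun).add (Dom.eps_mul hi (Dom.data hS hG one_le_one_fun))

theorem dX_add_eps_mul {F G : ℝ → ℝ → ℝ} (hF : Smooth2 F) (hG : Smooth2 G) (e : ℝ) :
    dX (fun x t => F x t + e * G x t) = fun x t => dX F x t + e * dX G x t := by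
  funext x t
  rw [dX_add hF (hG.const_mul e), dX_const_mul hG]

theorem initT_bounded (hi : i ∈ Finset.Icc 1 n) (hS : S ⊆ D.rect) :
    D.Dom S (fun s => s.initT i) fun _ _ _ => 1 :=
  add_eps_mul_bounded hi hS (subSum_smooth (D.f_smooth i hi) (D.A_smooth i hi) D.φ_smooth)
    (D.φ_smooth i hi).dX.dX

theorem dX_initT (s : D.Sol) (hi : i ∈ Finset.Icc 1 n) : dX (s.initT i) = fun x t =>
    dX (subSum n (D.f i) (D.A i) D.φ) x t + s.ε i * dX (dX (dX (D.φ i))) x t :=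
  dX_add_eps_mul (subSum_smooth (D.f_smooth i hi) (D.A_smooth i hi) D.φ_smooth)
    (D.φ_smooth i hi).dX.dX _

theorem dX_initT_bounded (hi : i ∈ Finset.Icc 1 n) (hS : S ⊆ D.rect) :
    D.Dom S (fun s => dX (s.initT i)) fun _ _ _ => 1 :=
  (add_eps_mul_bounded hi hS
    (subSum_smooth (D.f_smooth i hi) (D.A_smooth i hi) D.φ_smooth).dX
    (D.φ_smooth i hi).dX.dX.dX).congr fun s x t _ => by rw [dX_initT s hi]

theorem dX_dX_initT_bounded (hi : i ∈ Finset.Icc 1 n) (hS : S ⊆ D.rect) :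
    D.Dom S (fun s => dX (dX (s.initT i))) fun _ _ _ => 1 :=
  (add_eps_mul_bounded hi hS
    (subSum_smooth (D.f_smooth i hi) (D.A_smooth i hi) D.φ_smooth).dX.dX
    (D.φ_smooth i hi).dX.dX.dX.dX).congr fun s x t _ => by
      rw [dX_initT s hi, dX_add_eps_mul
        (subSum_smooth (D.f_smooth i hi) (D.A_smooth i hi) D.φ_smooth).dX
        (D.φ_smooth i hi).dX.dX.dX]

theorem dX_dT_u_bottom (hi : i ∈ Finset.Icc 1 n) :
    D.Dom D.bottom (fun s => dX (dT (s.u i))) fun _ _ _ => 1 :=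
  (dX_initT_bounded hi D.bottom_subset).congr fun s x t hxt => by
    have h2 : t = 0 := hxt.2
    rw [h2]
    exact dX_eq_of_eq_on_line (s.u_smooth i hi).dT (s.initT_smooth hi) (s.dT_bottom hi) x hxt.1

theorem dX_dX_dT_u_bottom (hi : i ∈ Finset.Icc 1 n) :
    D.Dom D.bottom (fun s => dX (dX (dT (s.u i)))) fun _ _ _ => 1 :=
  (dX_dX_initT_bounded hi D.bottom_subset).congr fun s x t hxt => by
    have h2 : t = 0 := hxt.2
    rw [h2]
    exact dX_eq_of_eq_on_line (s.u_smooth i hi).dT.dX (s.initT_smooth hi).dX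
      (dX_eq_of_eq_on_line (s.u_smooth i hi).dT (s.initT_smooth hi) (s.dT_bottom hi)) x hxt.1

theorem dT_u_bounded (hi : i ∈ Finset.Icc 1 n) :
    D.Dom D.rect (fun s => dT (s.u i)) fun _ _ _ => 1 := by
  refine Dom.bounded_of_L (z := fun s j => dT (s.u j)) (fun s i hi => (s.u_smooth i hi).dT)
    (fun i hi => ?_) (fun i hi => ?_) (fun i hi => ?_) i hi
  · exact (forceT_bounded hi).of_eqOn
      (fun s => D.L_smooth hi fun j hj => (s.u_smooth j hj).dT) (fun s => s.forceT_smooth hi)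
      fun s => s.L_dT_u hi
  · exact (initT_bounded hi D.bottom_subset).congr fun s x t hxt => by
      have h2 : t = 0 := hxt.2
      rw [h2]; exact s.dT_bottom hi x hxt.1
  · exact (Dom.data D.side_subset (D.φ_smooth i hi).dT one_le_one_fun).congr fun s x t hxt =>
      dT_eq_of_eq_on_line (s.u_smooth i hi) (D.φ_smooth i hi) D.T_pos
        (s.boundary_side hi hxt.1) t hxt.2

theorem dT_forceT_bounded (hi : i ∈ Finset.Icc 1 n) :
    D.Dom D.rect (fun s => dT (s.forceT i)) fun _ _ _ => 1 :=
  (Dom.subSum subset_rfl (fun j hj => (D.A_smooth i hi j hj).dT)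
    (Dom.subSum subset_rfl (fun j hj => (D.A_smooth i hi j hj).dT.dT)
      (Dom.data subset_rfl (D.f_smooth i hi).dT.dT one_le_one_fun) fun _ hj => u_bounded hj)
    fun _ hj => dT_u_bounded hj).congr fun s x t _ => by
      rw [Sol.forceT, dT_subSum (D.f_smooth i hi).dT
        (fun j hj => (D.A_smooth i hi j hj).dT) s.u_smooth]

theorem dT_dT_u_bounded (hi : i ∈ Finset.Icc 1 n) :
    D.Dom D.rect (fun s => dT (dT (s.u i))) fun _ _ _ => 1 := by
  refine Dom.bounded_of_L (z := fun s j => dT (dT (s.u j)))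
    (fun s i hi => (s.u_smooth i hi).dT.dT)
    (fun i hi => ?_) (fun i hi => ?_) (fun i hi => ?_) i hi
  · refine Dom.of_eqOn (Dom.subSum subset_rfl (fun j hj => (D.A_smooth i hi j hj).dT)
      (dT_forceT_bounded hi) fun j hj => dT_u_bounded hj)
      (fun s => D.L_smooth hi fun j hj => (s.u_smooth j hj).dT.dT)
      (fun s => subSum_smooth (s.forceT_smooth hi).dT (fun j hj => (D.A_smooth i hi j hj).dT)
        fun j hj => (s.u_smooth j hj).dT)
      fun s => D.L_dT_eqOn hi (fun j hj => (s.u_smooth j hj).dT) (s.L_dT_u hi)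
  · refine (((dX_dX_dT_u_bottom hi).eps_mul hi).add (Dom.subSum D.bottom_subset
      (D.A_smooth i hi) ((forceT_bounded hi).subset D.bottom_subset)
      fun j hj => (dT_u_bounded hj).subset D.bottom_subset)).congr fun s x t hxt => ?_
    have h := (s.eps_dX_dX_dT hi).closed D.T_pos ((s.u_smooth i hi).dT.dX.dX.const_mul _)
      ((s.u_smooth i hi).dT.dT.sub (subSum_smooth (s.forceT_smooth hi) (D.A_smooth i hi)
        fun j hj => (s.u_smooth j hj).dT)) x (D.bottom_subset hxt).1 t (D.bottom_subset hxt).2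
    linarith
  · exact (Dom.data D.side_subset (D.φ_smooth i hi).dT.dT one_le_one_fun).congr fun s x t hxt =>
      dT_eq_of_eq_on_line (s.u_smooth i hi).dT (D.φ_smooth i hi).dT D.T_pos
        (dT_eq_of_eq_on_line (s.u_smooth i hi) (D.φ_smooth i hi) D.T_pos
        (s.boundary_side hi hxt.1)) t hxt.2

theorem eps_dX_dX_u_bounded (hi : i ∈ Finset.Icc 1 n) :
    D.Dom D.rect (fun s x t => s.ε i * dX (dX (s.u i)) x t) fun _ _ _ => 1 :=
  ((dT_u_bounded hi).sub (Dom.subSum subset_rfl (D.A_smooth i hi)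
    (Dom.data subset_rfl (D.f_smooth i hi) one_le_one_fun) fun _ hj => u_bounded hj)).of_eqOn
    (fun s => (s.u_smooth i hi).dX.dX.const_mul _)
    (fun s => (s.u_smooth i hi).dT.sub
      (subSum_smooth (D.f_smooth i hi) (D.A_smooth i hi) s.u_smooth))
    fun s => s.eps_dX_dX hi

theorem eps_dX_dX_dT_u_bounded (hi : i ∈ Finset.Icc 1 n) :
    D.Dom D.rect (fun s x t => s.ε i * dX (dX (dT (s.u i))) x t) fun _ _ _ => 1 :=
  ((dT_dT_u_bounded hi).sub (Dom.subSum subset_rfl (D.A_smooth i hi)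
    (forceT_bounded hi) fun _ hj => dT_u_bounded hj)).of_eqOn
    (fun s => (s.u_smooth i hi).dT.dX.dX.const_mul _)
    (fun s => (s.u_smooth i hi).dT.dT.sub
      (subSum_smooth (s.forceT_smooth hi) (D.A_smooth i hi) fun j hj => (s.u_smooth j hj).dT))
    fun s => s.eps_dX_dX_dT hi

/-- Layer amplitude of first derivatives. -/
noncomputable def ampX (e : ℝ) : ℝ := (√e)⁻¹

/-- Layer amplitude of second derivatives. -/
noncomputable def ampXX (e : ℝ) : ℝ := e⁻¹

theorem ampX_pos (e : ℝ) (he : 0 < e) : 0 < ampX e := inv_pos.2 (Real.sqrt_pos.2 he)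

theorem ampXX_pos (e : ℝ) (he : 0 < e) : 0 < ampXX e := inv_pos.2 he

theorem ampX_mono (e e' : ℝ) (he : 0 < e) (h : e ≤ e') : e * ampX e ≤ e' * ampX e' := by
  have key : ∀ e : ℝ, 0 < e → e * ampX e = √e := fun e he => by
    have h0 := Real.sqrt_pos.2 he
    rw [ampX, mul_inv_eq_iff_eq_mul₀ h0.ne', Real.mul_self_sqrt he.le]
  rw [key e he, key e' (he.trans_le h)]
  exact Real.sqrt_le_sqrt h

theorem ampXX_mono (e e' : ℝ) (he : 0 < e) (h : e ≤ e') : e * ampXX e ≤ e' * ampXX e' := by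
  rw [ampXX, ampXX, mul_inv_cancel₀ he.ne', mul_inv_cancel₀ (he.trans_le h).ne']

theorem ampX_le_ampXX {e : ℝ} (he : 0 < e) (h1 : e ≤ 1) : ampX e ≤ ampXX e :=
  inv_anti₀ he (Real.le_sqrt_of_sq_le (by nlinarith))

theorem weight_ampX_le (s : D.Sol) (x t : ℝ) :
    D.weight ampX 1 s x t ≤ D.weight ampXX 1 s x t :=
  add_le_add_right (Finset.sum_le_sum fun q hq => mul_le_mul_of_nonneg_right
    (ampX_le_ampXX (s.ε_pos q hq) (s.ε_le_one q hq)) (layer_pos _ _ _).le) 1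

theorem Dom.to_ampX {Z : D.Sol → ℝ → ℝ → ℝ} (h : D.Dom S Z fun _ _ _ => 1) :
    D.Dom S Z (D.weight ampX 1) :=
  h.mono fun s x t _ => one_le_weight ampX_pos s x t

theorem Dom.to_ampXX {Z : D.Sol → ℝ → ℝ → ℝ} (h : D.Dom S Z (D.weight ampX 1)) :
    D.Dom S Z (D.weight ampXX 1) :=
  h.mono fun s x t _ => weight_ampX_le s x t

theorem dX_u_bound (hi : i ∈ Finset.Icc 1 n) :
    D.Dom D.rect (fun s => dX (s.u i)) (D.weight ampX i) := by
  refine Dom.of_L ampX_pos ampX_mono (z := fun s j => dX (s.u j))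
    (fun s i hi => (s.u_smooth i hi).dX)
    (fun i hi => ?_) (fun i hi => ?_) (fun i hi => ?_) i hi
  · exact (forceX_bounded hi).to_ampX.of_eqOn
      (fun s => D.L_smooth hi fun j hj => (s.u_smooth j hj).dX) (fun s => s.forceX_smooth hi)
      fun s => s.L_dX_u hi
  · exact (Dom.data D.bottom_subset (D.φ_smooth i hi).dX one_le_one_fun).congr
      fun s x t hxt => by
        have h2 : t = 0 := hxt.2
        rw [h2]
        exact dX_eq_of_eq_on_line (s.u_smooth i hi) (D.φ_smooth i hi)
          (s.boundary_bottom hi) x hxt.1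
  · exact (Dom.dX_of_bounds hi (fun s => s.u_smooth i hi) (u_bounded hi)
      (eps_dX_dX_u_bounded hi)).subset D.side_subset

theorem dX_u_bound_one (hi : i ∈ Finset.Icc 1 n) :
    D.Dom D.rect (fun s => dX (s.u i)) (D.weight ampX 1) :=
  (dX_u_bound hi).mono fun s x t _ => weight_le_weight_one ampX_pos hi s x t

theorem dX_forceT_bound (hi : i ∈ Finset.Icc 1 n) :
    D.Dom D.rect (fun s => dX (s.forceT i)) (D.weight ampX 1) :=
  Dom.dX_subSum subset_rfl (fun _ => (D.f_smooth i hi).dT)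
    (fun j hj => (D.A_smooth i hi j hj).dT) (fun s => s.u_smooth)
    (Dom.data subset_rfl (D.f_smooth i hi).dT.dX one_le_one_fun).to_ampX
    (fun _ hj => (u_bounded hj).to_ampX) fun _ hj => dX_u_bound_one hj

theorem dX_forceX_bound (hi : i ∈ Finset.Icc 1 n) :
    D.Dom D.rect (fun s => dX (s.forceX i)) (D.weight ampX 1) :=
  Dom.dX_subSum subset_rfl (fun _ => (D.f_smooth i hi).dX)
    (fun j hj => (D.A_smooth i hi j hj).dX) (fun s => s.u_smooth)
    (Dom.data subset_rfl (D.f_smooth i hi).dX.dX one_le_one_fun).to_ampX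
    (fun _ hj => (u_bounded hj).to_ampX) fun _ hj => dX_u_bound_one hj

theorem dX_dT_u_bound (hi : i ∈ Finset.Icc 1 n) :
    D.Dom D.rect (fun s => dX (dT (s.u i))) (D.weight ampX 1) := by
  refine (Dom.of_L ampX_pos ampX_mono (z := fun s j => dX (dT (s.u j)))
    (fun s i hi => (s.u_smooth i hi).dT.dX)
    (fun i hi => ?_) (fun i hi => ?_) (fun i hi => ?_) i hi).mono
    fun s x t _ => weight_le_weight_one ampX_pos hi s x t
  · exact (Dom.subSum subset_rfl (fun j hj => (D.A_smooth i hi j hj).dX)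
      (dX_forceT_bound hi) fun j hj => (dT_u_bounded hj).to_ampX).of_eqOn
      (fun s => D.L_smooth hi fun j hj => (s.u_smooth j hj).dT.dX)
      (fun s => subSum_smooth (s.forceT_smooth hi).dX (fun j hj => (D.A_smooth i hi j hj).dX)
        fun j hj => (s.u_smooth j hj).dT)
      fun s => D.L_dX_eqOn hi (fun j hj => (s.u_smooth j hj).dT) (s.L_dT_u hi)
  · exact dX_dT_u_bottom hi
  · exact (Dom.dX_of_bounds hi (fun s => (s.u_smooth i hi).dT) (dT_u_bounded hi)
      (eps_dX_dX_dT_u_bounded hi)).subset D.side_subset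

theorem Dom.of_eps_mul (hi : i ∈ Finset.Icc 1 n) {Z : D.Sol → ℝ → ℝ → ℝ}
    (h : D.Dom S (fun s x t => s.ε i * Z s x t) fun _ _ _ => 1) :
    D.Dom S Z fun s _ _ => ampXX (s.ε i) := by
  obtain ⟨C, hC, H⟩ := h
  refine ⟨C, hC, fun s x t hxt => ?_⟩
  have he := s.ε_pos i hi
  have h := H s x t hxt
  rw [abs_mul, abs_of_pos he, mul_one] at h
  change _ ≤ C * (s.ε i)⁻¹
  rw [← div_eq_mul_inv, le_div_iff₀ he]
  linarith

theorem dX_dX_u_bound (hi : i ∈ Finset.Icc 1 n) :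
    D.Dom D.rect (fun s => dX (dX (s.u i))) (D.weight ampXX i) := by
  refine Dom.of_L ampXX_pos ampXX_mono (z := fun s j => dX (dX (s.u j)))
    (fun s i hi => (s.u_smooth i hi).dX.dX)
    (fun i hi => ?_) (fun i hi => ?_) (fun i hi => ?_) i hi
  · exact (Dom.subSum subset_rfl (fun j hj => (D.A_smooth i hi j hj).dX)
      (dX_forceX_bound hi) fun j hj => dX_u_bound_one hj).to_ampXX.of_eqOn
      (fun s => D.L_smooth hi fun j hj => (s.u_smooth j hj).dX.dX)
      (fun s => subSum_smooth (s.forceX_smooth hi).dX (fun j hj => (D.A_smooth i hi j hj).dX)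
        fun j hj => (s.u_smooth j hj).dX)
      fun s => D.L_dX_eqOn hi (fun j hj => (s.u_smooth j hj).dX) (s.L_dX_u hi)
  · exact (Dom.data D.bottom_subset (D.φ_smooth i hi).dX.dX one_le_one_fun).congr
      fun s x t hxt => by
        have h2 : t = 0 := hxt.2
        rw [h2]
        exact dX_eq_of_eq_on_line (s.u_smooth i hi).dX (D.φ_smooth i hi).dX
          (dX_eq_of_eq_on_line (s.u_smooth i hi) (D.φ_smooth i hi)
          (s.boundary_bottom hi)) x hxt.1
  · exact ((eps_dX_dX_u_bounded hi).of_eps_mul hi).subset D.side_subset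

theorem dX_dX_u_bound_one (hi : i ∈ Finset.Icc 1 n) :
    D.Dom D.rect (fun s => dX (dX (s.u i))) (D.weight ampXX 1) :=
  (dX_dX_u_bound hi).mono fun s x t _ => weight_le_weight_one ampXX_pos hi s x t

theorem dX_dX_subSum_u_bound {h : ℝ → ℝ → ℝ} {a : ℕ → ℝ → ℝ → ℝ} (hh : Smooth2 h)
    (ha : ∀ j ∈ Finset.Icc 1 n, Smooth2 (a j)) :
    D.Dom D.rect (fun s => dX (dX (subSum n h a s.u))) (D.weight ampXX 1) := by
  have h1 : D.Dom D.rect (fun s => dX (subSum n (dX h) (fun j => dX (a j)) s.u))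
      (D.weight ampXX 1) :=
    (Dom.dX_subSum subset_rfl (fun _ => hh.dX) (fun j hj => (ha j hj).dX) (fun s => s.u_smooth)
      (Dom.data subset_rfl hh.dX.dX one_le_one_fun).to_ampX
      (fun _ hj => (u_bounded hj).to_ampX) fun _ hj => dX_u_bound_one hj).to_ampXX
  refine (Dom.dX_subSum subset_rfl
    (fun s => subSum_smooth hh.dX (fun j hj => (ha j hj).dX) s.u_smooth) ha
    (fun s j hj => (s.u_smooth j hj).dX) h1 (fun j hj => (dX_u_bound_one hj).to_ampXX)
    fun j hj => dX_dX_u_bound_one hj).congr fun s x t _ => ?_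
  rw [dX_subSum hh ha s.u_smooth]

theorem dX_dX_dT_u_bound (hi : i ∈ Finset.Icc 1 n) :
    D.Dom D.rect (fun s => dX (dX (dT (s.u i)))) (D.weight ampXX 1) := by
  refine (Dom.of_L ampXX_pos ampXX_mono (z := fun s j => dX (dX (dT (s.u j))))
    (fun s i hi => (s.u_smooth i hi).dT.dX.dX)
    (fun i hi => ?_) (fun i hi => ?_) (fun i hi => ?_) i hi).mono
    fun s x t _ => weight_le_weight_one ampXX_pos hi s x t
  · have hA := fun j hj => (D.A_smooth i hi j hj).dX
    have hu : ∀ s : D.Sol, ∀ j ∈ Finset.Icc 1 n, Smooth2 (dT (s.u j)) :=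
      fun s j hj => (s.u_smooth j hj).dT
    have h1 := Dom.dX_subSum (D := D) subset_rfl (fun s => (s.forceT_smooth hi).dX) hA hu
      (dX_dX_subSum_u_bound (D.f_smooth i hi).dT fun j hj => (D.A_smooth i hi j hj).dT)
      (fun j hj => (dT_u_bounded hj).to_ampX.to_ampXX) (fun j hj => (dX_dT_u_bound hj).to_ampXX)
    exact (Dom.subSum subset_rfl hA h1 fun j hj => (dX_dT_u_bound hj).to_ampXX).of_eqOn
      (fun s => D.L_smooth hi fun j hj => (hu s j hj).dX.dX)
      (fun s => subSum_smooth (subSum_smooth (s.forceT_smooth hi).dX hA (hu s)).dX hA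
        fun j hj => (hu s j hj).dX)
      fun s => D.L_dX_eqOn hi (fun j hj => (hu s j hj).dX) (D.L_dX_eqOn hi (hu s) (s.L_dT_u hi))
  · exact dX_dX_dT_u_bottom hi
  · exact ((eps_dX_dX_dT_u_bounded hi).of_eps_mul hi).subset D.side_subset

theorem eps_dX_four_u_bound (hi : i ∈ Finset.Icc 1 n) :
    D.Dom D.rect (fun s x t => s.ε i * dX (dX (dX (dX (s.u i)))) x t) (D.weight ampXX 1) := by
  have hs : ∀ s : D.Sol, Smooth2 (subSum n (D.f i) (D.A i) s.u) := fun s =>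
    subSum_smooth (D.f_smooth i hi) (D.A_smooth i hi) s.u_smooth
  have hu := fun s : D.Sol => s.u_smooth i hi
  have e1 : ∀ s : D.Sol, dX (dX fun x t => s.ε i * dX (dX (s.u i)) x t) =
      fun x t => s.ε i * dX (dX (dX (dX (s.u i)))) x t := fun s => by
    have : dX (fun x t => s.ε i * dX (dX (s.u i)) x t) =
        fun x t => s.ε i * dX (dX (dX (s.u i))) x t :=
      funext₂ fun x t => dX_const_mul (hu s).dX.dX _ x t
    rw [this]
    exact funext₂ fun x t => dX_const_mul (hu s).dX.dX.dX _ x t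
  have e2 : ∀ s : D.Sol, dX (dX fun x t => dT (s.u i) x t - subSum n (D.f i) (D.A i) s.u x t) =
      fun x t => dX (dX (dT (s.u i))) x t - dX (dX (subSum n (D.f i) (D.A i) s.u)) x t :=
    fun s => by
      have : dX (fun x t => dT (s.u i) x t - subSum n (D.f i) (D.A i) s.u x t) =
          fun x t => dX (dT (s.u i)) x t - dX (subSum n (D.f i) (D.A i) s.u) x t :=
        funext₂ fun x t => dX_sub (hu s).dT (hs s) x t
      rw [this]
      exact funext₂ fun x t => dX_sub (hu s).dT.dX (hs s).dX x t
  refine ((dX_dX_dT_u_bound hi).sub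
    (dX_dX_subSum_u_bound (D.f_smooth i hi) (D.A_smooth i hi))).of_eqOn
    (fun s => (hu s).dX.dX.dX.dX.const_mul _)
    (fun s => (hu s).dT.dX.dX.sub (hs s).dX.dX) fun s => ?_
  have := (s.eps_dX_dX hi).dX.dX
  rwa [e1, e2] at this

/-- Derivative bounds for all solutions, with a constant depending only on the data. -/
theorem exists_derivative_bounds (D : ParabolicData n) :
    ∃ C : ℝ, 0 < C ∧ ∀ s : D.Sol, ∀ i ∈ Finset.Icc 1 n, ∀ x ∈ Set.Icc (0:ℝ) 1,
      ∀ t ∈ Set.Icc 0 D.T,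
      |dT (dT (s.u i)) x t| ≤ C ∧
      |dX (dX (s.u i)) x t| ≤
        C * (1 + ∑ q ∈ Finset.Icc i n, (s.ε q)⁻¹ * layer D.α (s.ε q) x) ∧
      |s.ε i * dX (dX (dX (dX (s.u i)))) x t| ≤
        C * (1 + ∑ q ∈ Finset.Icc 1 n, (s.ε q)⁻¹ * layer D.α (s.ε q) x) := by
  have h1 := fun i (hi : i ∈ Finset.Icc 1 n) => dT_dT_u_bounded (D := D) hi
  have h2 := fun i (hi : i ∈ Finset.Icc 1 n) => dX_dX_u_bound (D := D) hi
  have h3 := fun i (hi : i ∈ Finset.Icc 1 n) => eps_dX_four_u_bound (D := D) hi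
  choose! a ha0 ha using h1
  choose! b hb0 hb using h2
  choose! c hc0 hc using h3
  have hterm : ∀ i ∈ Finset.Icc 1 n, 0 ≤ a i + b i + c i := fun i hi => by
    have := ha0 i hi; have := hb0 i hi; have := hc0 i hi; positivity
  have hK0 := Finset.sum_nonneg hterm
  refine ⟨1 + ∑ i ∈ Finset.Icc 1 n, (a i + b i + c i), by linarith,
    fun s i hi x hx t ht => ⟨?_, ?_, ?_⟩⟩ <;>
  have hKi := Finset.single_le_sum (f := fun i => a i + b i + c i) hterm hi <;>
  have e1 := ha0 i hi <;> have e2 := hb0 i hi <;> have e3 := hc0 i hi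
  · refine (ha i hi s x t ⟨hx, ht⟩).trans ?_
    linarith
  · refine (hb i hi s x t ⟨hx, ht⟩).trans (mul_le_mul_of_nonneg_right (by linarith) ?_)
    refine add_nonneg zero_le_one (Finset.sum_nonneg fun q hq => ?_)
    simp only [Finset.mem_Icc] at hi hq
    exact weight_term_nonneg ampXX_pos s x q (by simp only [Finset.mem_Icc]; omega)
  · exact (hc i hi s x t ⟨hx, ht⟩).trans (mul_le_mul_of_nonneg_right (by linarith)
      (zero_le_one.trans (one_le_weight ampXX_pos s x t)))

end ParabolicData

/-- The three-point second difference quotient of `w` at `b` on the points `a < b < c`. -/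
noncomputable def secDiff (w : ℝ → ℝ) (a b c : ℝ) : ℝ :=
  ((w c - w b) / (c - b) - (w b - w a) / (b - a)) / ((c - a) / 2)

theorem secDiff_reflect (w : ℝ → ℝ) (a b c : ℝ) :
    secDiff (fun y => w (1 - y)) (1 - c) (1 - b) (1 - a) = secDiff w a b c := by
  have e1 : 1 - b - (1 - c) = c - b := by ring
  have e2 : 1 - a - (1 - b) = b - a := by ring
  have e3 : 1 - a - (1 - c) = c - a := by ring
  simp only [secDiff, sub_sub_cancel, e1, e2, e3]
  congr 1
  ring

theorem secDiff_le {w w1 w2 : ℝ → ℝ} {a b c m : ℝ} (hab : a < b) (hbc : b < c)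
    (h1 : ∀ y, HasDerivAt w (w1 y) y) (h2 : ∀ y, HasDerivAt w1 (w2 y) y)
    (hm : ∀ y ∈ Set.Icc a c, w2 y ≤ m) : secDiff w a b c ≤ m := by
  have hconv : ConvexOn ℝ (Set.Icc a c) (fun y => m * y ^ 2 / 2 - w y) := by
    refine convexOn_of_hasDerivWithinAt2_nonneg (f' := fun y => m * y - w1 y)
      (f'' := fun y => m - w2 y) (convex_Icc a c) ?_ ?_ ?_ ?_
    · have : Continuous w := continuous_iff_continuousAt.2 fun y => (h1 y).continuousAt
      fun_prop
    · intro y _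
      have := ((((hasDerivAt_id y).pow 2).const_mul m).div_const 2).sub (h1 y)
      refine (this.congr_deriv ?_).hasDerivWithinAt
      simp; ring
    · intro y _
      have := ((hasDerivAt_id y).const_mul m).sub (h2 y)
      refine (this.congr_deriv ?_).hasDerivWithinAt
      simp
    · intro y hy
      exact sub_nonneg.2 (hm y (interior_subset hy))
  have h := hconv.slope_mono_adjacent (x := a) (y := b) (z := c) ⟨le_rfl, (hab.trans hbc).le⟩
    ⟨(hab.trans hbc).le, le_rfl⟩ hab hbc
  have hba : 0 < b - a := sub_pos.2 hab
  have hcb : 0 < c - b := sub_pos.2 hbc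
  have e1 : (m * b ^ 2 / 2 - w b - (m * a ^ 2 / 2 - w a)) / (b - a)
      = m * (b + a) / 2 - (w b - w a) / (b - a) := by field_simp; ring
  have e2 : (m * c ^ 2 / 2 - w c - (m * b ^ 2 / 2 - w b)) / (c - b)
      = m * (c + b) / 2 - (w c - w b) / (c - b) := by field_simp; ring
  rw [e1, e2] at h
  rw [secDiff, div_le_iff₀ (by linarith)]
  linarith

theorem abs_secDiff_sub_le {w w1 w2 : ℝ → ℝ} {a b c k m : ℝ} (hab : a < b) (hbc : b < c)
    (h1 : ∀ y, HasDerivAt w (w1 y) y) (h2 : ∀ y, HasDerivAt w1 (w2 y) y)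
    (hm : ∀ y ∈ Set.Icc a c, |w2 y - k| ≤ m) : |secDiff w a b c - k| ≤ m := by
  have hu := secDiff_le (m := k + m) hab hbc h1 h2 fun y hy => by
    linarith [(abs_le.1 (hm y hy)).2]
  have hl := secDiff_le (m := m - k) hab hbc (fun y => (h1 y).neg) (fun y => (h2 y).neg)
    fun y hy => by linarith [(abs_le.1 (hm y hy)).1]
  have e : secDiff (-w) a b c = -secDiff w a b c := by
    simp only [secDiff, Pi.neg_apply]; ring
  rw [e] at hl
  rw [abs_le]
  constructor <;> linarith

theorem nonneg_of_hasDerivAt_nonneg {f f' : ℝ → ℝ} {h : ℝ} (hf : ∀ s, HasDerivAt f (f' s) s)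
    (h0 : f 0 = 0) (hn : ∀ s ∈ Set.Icc 0 h, 0 ≤ f' s) : ∀ s ∈ Set.Icc 0 h, 0 ≤ f s := by
  intro s hs
  have hm : MonotoneOn f (Set.Icc 0 h) :=
    monotoneOn_of_hasDerivWithinAt_nonneg (f' := f') (convex_Icc 0 h)
      (fun y _ => (hf y).continuousAt.continuousWithinAt) (fun y _ => (hf y).hasDerivWithinAt)
      fun y hy => hn y (interior_subset hy)
  have := hm ⟨le_rfl, hs.1.trans hs.2⟩ hs hs.1
  rwa [h0] at this

theorem second_deriv_le_symm_diff {F F1 F2 F3 F4 : ℝ → ℝ} {x h : ℝ} (hh : 0 ≤ h)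
    (h1 : ∀ y, HasDerivAt F (F1 y) y) (h2 : ∀ y, HasDerivAt F1 (F2 y) y)
    (h3 : ∀ y, HasDerivAt F2 (F3 y) y) (h4 : ∀ y, HasDerivAt F3 (F4 y) y)
    (hn : ∀ y ∈ Set.Icc (x - h) (x + h), 0 ≤ F4 y) :
    0 ≤ F (x + h) + F (x - h) - 2 * F x - h ^ 2 * F2 x := by
  have plus : ∀ {g g' : ℝ → ℝ}, (∀ y, HasDerivAt g (g' y) y) →
      ∀ s, HasDerivAt (fun s => g (x + s)) (g' (x + s)) s := fun hg s => by
    have := (hg (x + s)).comp s ((hasDerivAt_id s).const_add x)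
    exact this.congr_deriv (by simp)
  have minus : ∀ {g g' : ℝ → ℝ}, (∀ y, HasDerivAt g (g' y) y) →
      ∀ s, HasDerivAt (fun s => g (x - s)) (-g' (x - s)) s := fun hg s => by
    have := (hg (x - s)).comp s ((hasDerivAt_id s).const_sub x)
    exact this.congr_deriv (by simp)
  have n3 : ∀ s ∈ Set.Icc 0 h, 0 ≤ F3 (x + s) - F3 (x - s) :=
    nonneg_of_hasDerivAt_nonneg (f' := fun s => F4 (x + s) + F4 (x - s))
      (fun s => ((plus h4 s).sub (minus h4 s)).congr_deriv (by ring)) (by simp)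
      fun s hs => add_nonneg (hn _ ⟨by linarith [hs.1], by linarith [hs.2]⟩)
        (hn _ ⟨by linarith [hs.2], by linarith [hs.1]⟩)
  have n2 := nonneg_of_hasDerivAt_nonneg (f := fun s => F2 (x + s) + F2 (x - s) - 2 * F2 x)
    (fun s => (((plus h3 s).add (minus h3 s)).sub_const _).congr_deriv
      (show _ = F3 (x + s) - F3 (x - s) by ring)) (by simp; ring) n3
  have n1 := nonneg_of_hasDerivAt_nonneg (f := fun s => F1 (x + s) - F1 (x - s) - s * (2 * F2 x))
    (fun s => (((plus h2 s).sub (minus h2 s)).sub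
      ((hasDerivAt_id s).mul_const (2 * F2 x))).congr_deriv
      (show _ = F2 (x + s) + F2 (x - s) - 2 * F2 x by ring)) (by simp) n2
  have n0 := nonneg_of_hasDerivAt_nonneg
    (f := fun s => F (x + s) + F (x - s) - 2 * F x - s ^ 2 * F2 x)
    (fun s => ((((plus h1 s).add (minus h1 s)).sub_const _).sub
      (((hasDerivAt_id s).pow 2).mul_const (F2 x))).congr_deriv
      (show _ = F1 (x + s) - F1 (x - s) - s * (2 * F2 x) by simp; ring)) (by simp; ring) n1
  exact n0 h ⟨hh, le_rfl⟩

/-- Comparison of second-difference remainders for dominated fourth derivatives. -/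
theorem abs_secDiff_remainder_le {w w1 w2 w3 w4 g g1 g2 g3 g4 : ℝ → ℝ} {x h : ℝ} (hh : 0 < h)
    (hw1 : ∀ y, HasDerivAt w (w1 y) y) (hw2 : ∀ y, HasDerivAt w1 (w2 y) y)
    (hw3 : ∀ y, HasDerivAt w2 (w3 y) y) (hw4 : ∀ y, HasDerivAt w3 (w4 y) y)
    (hg1 : ∀ y, HasDerivAt g (g1 y) y) (hg2 : ∀ y, HasDerivAt g1 (g2 y) y)
    (hg3 : ∀ y, HasDerivAt g2 (g3 y) y) (hg4 : ∀ y, HasDerivAt g3 (g4 y) y)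
    (hd : ∀ y ∈ Set.Icc (x - h) (x + h), |w4 y| ≤ g4 y) :
    |secDiff w (x - h) x (x + h) - w2 x| ≤ secDiff g (x - h) x (x + h) - g2 x := by
  have e : ∀ f : ℝ → ℝ, secDiff f (x - h) x (x + h) = (f (x + h) + f (x - h) - 2 * f x) / h ^ 2 := by
    intro f
    simp only [secDiff, add_sub_cancel_left, sub_sub_cancel]
    rw [show (x + h - (x - h)) / 2 = h by ring]
    field_simp; ring
  have hp := second_deriv_le_symm_diff (F4 := g4 + w4) hh.le (fun y => (hg1 y).add (hw1 y))
    (fun y => (hg2 y).add (hw2 y)) (fun y => (hg3 y).add (hw3 y)) (fun y => (hg4 y).add (hw4 y))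
    fun y hy => by
      have := (abs_le.1 (hd y hy)).1
      simp only [Pi.add_apply]; linarith
  have hm := second_deriv_le_symm_diff (F4 := g4 - w4) hh.le (fun y => (hg1 y).sub (hw1 y))
    (fun y => (hg2 y).sub (hw2 y)) (fun y => (hg3 y).sub (hw3 y)) (fun y => (hg4 y).sub (hw4 y))
    fun y hy => by
      have := (abs_le.1 (hd y hy)).2
      simp only [Pi.sub_apply]; linarith
  simp only [Pi.add_apply, Pi.sub_apply] at hp hm
  have h2 : 0 < h ^ 2 := by positivity
  have key : ∀ f f2 : ℝ → ℝ, secDiff f (x - h) x (x + h) - f2 x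
      = (f (x + h) + f (x - h) - 2 * f x - h ^ 2 * f2 x) / h ^ 2 := fun f f2 => by
    rw [e]; field_simp
  rw [key w w2, key g g2, abs_le, ← neg_div, div_le_div_iff_of_pos_right h2,
    div_le_div_iff_of_pos_right h2]
  constructor <;> linarith

theorem abs_sub_le_of_abs_deriv_le {G G' k k' : ℝ → ℝ} {a b : ℝ} (hab : a ≤ b)
    (hG : ∀ y, HasDerivAt G (G' y) y) (hk : ∀ y, HasDerivAt k (k' y) y)
    (hd : ∀ y ∈ Set.Icc a b, |G' y| ≤ k' y) : |G b - G a| ≤ k b - k a := by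
  have mono : ∀ {f f' : ℝ → ℝ}, (∀ y, HasDerivAt f (f' y) y) →
      (∀ y ∈ Set.Icc a b, 0 ≤ f' y) → f a ≤ f b := fun {f f'} hf hn =>
    monotoneOn_of_hasDerivWithinAt_nonneg (f' := f') (convex_Icc a b)
      (fun y _ => (hf y).continuousAt.continuousWithinAt) (fun y _ => (hf y).hasDerivWithinAt)
      (fun y hy => hn y (interior_subset hy)) ⟨le_rfl, hab⟩ ⟨hab, le_rfl⟩ hab
  have hp := mono (fun y => (hk y).add (hG y)) fun y hy => by
    linarith [(abs_le.1 (hd y hy)).1]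
  have hm := mono (fun y => (hk y).sub (hG y)) fun y hy => by
    linarith [(abs_le.1 (hd y hy)).2]
  simp only [Pi.add_apply, Pi.sub_apply] at hp hm
  rw [abs_le]
  constructor <;> linarith

theorem abs_sub_le_of_abs_deriv_le_exp_sum {ι : Type*} {Q : Finset ι} {c l : ι → ℝ}
    (hl : ∀ q ∈ Q, 0 < l q) {G G' : ℝ → ℝ} {a b c0 : ℝ} (hab : a ≤ b)
    (hG : ∀ y, HasDerivAt G (G' y) y)
    (hd : ∀ y ∈ Set.Icc a b, |G' y| ≤ c0 + ∑ q ∈ Q, c q * Real.exp (-(l q * y))) :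
    |G b - G a| ≤ c0 * (b - a)
      + ∑ q ∈ Q, c q / l q * (Real.exp (-(l q * a)) - Real.exp (-(l q * b))) := by
  have hk : ∀ y, HasDerivAt (fun y => c0 * y + ∑ q ∈ Q, -(c q / l q) * Real.exp (-(l q * y)))
      (c0 + ∑ q ∈ Q, c q * Real.exp (-(l q * y))) y := fun y => by
    have h1 : HasDerivAt (fun y => c0 * y) c0 y := by
      simpa using (hasDerivAt_id y).const_mul c0
    refine h1.add (HasDerivAt.fun_sum fun q hq => ?_)
    have h2 : HasDerivAt (fun y => Real.exp (-(l q * y)))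
        (Real.exp (-(l q * y)) * (-(l q * 1))) y :=
      (((hasDerivAt_id y).const_mul (l q)).neg).exp
    refine (h2.const_mul (-(c q / l q))).congr_deriv ?_
    have := (hl q hq).ne'
    field_simp
  refine (abs_sub_le_of_abs_deriv_le hab hG hk hd).trans (le_of_eq ?_)
  rw [add_sub_add_comm, ← mul_sub, ← Finset.sum_sub_distrib]
  congr 1
  exact Finset.sum_congr rfl fun q _ => by ring

theorem exp_sub_exp_le {l a b : ℝ} :
    Real.exp (-(l * a)) - Real.exp (-(l * b)) ≤ l * (b - a) * Real.exp (-(l * a)) := by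
  have h := Real.add_one_le_exp (-(l * (b - a)))
  have e : Real.exp (-(l * b)) = Real.exp (-(l * (b - a))) * Real.exp (-(l * a)) := by
    rw [← Real.exp_add]; ring_nf
  rw [e]
  nlinarith [Real.exp_pos (-(l * a))]

theorem secDiff_add (v w : ℝ → ℝ) (a b c : ℝ) :
    secDiff (v + w) a b c = secDiff v a b c + secDiff w a b c := by
  simp only [secDiff, Pi.add_apply]; ring

theorem secDiff_const_mul (k : ℝ) (v : ℝ → ℝ) (a b c : ℝ) :
    secDiff (fun y => k * v y) a b c = k * secDiff v a b c := by
  simp only [secDiff]; ring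

/-- The derivative of `layer`. -/
noncomputable def layerDeriv (α e x : ℝ) : ℝ :=
  √(α / e) * (Real.exp (-(√(α / e) * (1 - x))) - Real.exp (-(√(α / e) * x)))

theorem hasDerivAt_layer (α e x : ℝ) : HasDerivAt (layer α e) (layerDeriv α e x) x := by
  have a1 : HasDerivAt (fun y => Real.exp (-(√(α / e) * y)))
      (Real.exp (-(√(α / e) * x)) * (-(√(α / e) * 1))) x :=
    (((hasDerivAt_id x).const_mul _).neg).exp
  have a2 : HasDerivAt (fun y => Real.exp (-(√(α / e) * (1 - y))))
      (Real.exp (-(√(α / e) * (1 - x))) * (-(√(α / e) * (-1)))) x :=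
    ((((hasDerivAt_id x).const_sub 1).const_mul _).neg).exp
  exact (a1.add a2).congr_deriv (by unfold layerDeriv; ring)

theorem hasDerivAt_layerDeriv {α e : ℝ} (h : 0 ≤ α / e) (x : ℝ) :
    HasDerivAt (layerDeriv α e) (α / e * layer α e x) x := by
  have a1 : HasDerivAt (fun y => Real.exp (-(√(α / e) * y)))
      (Real.exp (-(√(α / e) * x)) * (-(√(α / e) * 1))) x :=
    (((hasDerivAt_id x).const_mul _).neg).exp
  have a2 : HasDerivAt (fun y => Real.exp (-(√(α / e) * (1 - y))))
      (Real.exp (-(√(α / e) * (1 - x))) * (-(√(α / e) * (-1)))) x :=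
    ((((hasDerivAt_id x).const_sub 1).const_mul _).neg).exp
  refine ((a2.sub a1).const_mul (√(α / e))).congr_deriv ?_
  rw [layer]
  linear_combination (Real.exp (-(√(α / e) * x)) + Real.exp (-(√(α / e) * (1 - x))))
    * Real.mul_self_sqrt h

theorem layer_reflect (α e x : ℝ) : layer α e (1 - x) = layer α e x := by
  unfold layer; rw [sub_sub_cancel, add_comm]

theorem layer_le_two_exp {α e x σ : ℝ} (h1 : σ ≤ x) (h2 : x ≤ 1 - σ) :
    layer α e x ≤ 2 * Real.exp (-(√(α / e) * σ)) := by
  have h := Real.sqrt_nonneg (α / e)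
  have a1 : Real.exp (-(√(α / e) * x)) ≤ Real.exp (-(√(α / e) * σ)) :=
    Real.exp_le_exp.2 (neg_le_neg (mul_le_mul_of_nonneg_left h1 h))
  have a2 : Real.exp (-(√(α / e) * (1 - x))) ≤ Real.exp (-(√(α / e) * σ)) :=
    Real.exp_le_exp.2 (neg_le_neg (mul_le_mul_of_nonneg_left (by linarith) h))
  unfold layer; linarith

theorem inv_mul_layer_le {α e x : ℝ} (hα : 0 < α) (he : 0 < e) (hx : x ≤ 3 / 4) :
    e⁻¹ * layer α e x ≤ e⁻¹ * Real.exp (-(√(α / e) * x)) + 32 / α := by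
  set l := √(α / e) with hl
  have hl0 : 0 < l := Real.sqrt_pos.2 (div_pos hα he)
  have hll : l * l = α / e := Real.mul_self_sqrt (div_pos hα he).le
  have h1 : Real.exp (-(l * (1 - x))) ≤ Real.exp (-(l / 4)) :=
    Real.exp_le_exp.2 (neg_le_neg (by nlinarith))
  have h2 := Real.quadratic_le_exp_of_nonneg (x := l / 4) (by positivity)
  have h3 : Real.exp (-(l / 4)) ≤ 32 * e / α := by
    rw [Real.exp_neg, inv_le_comm₀ (Real.exp_pos _) (by positivity), inv_div]
    refine le_trans ?_ h2
    have : α / (32 * e) = l * l / 32 := by rw [hll]; field_simp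
    rw [this]; nlinarith
  have h4 : e⁻¹ * (32 * e / α) = 32 / α := by field_simp
  rw [layer, mul_add, ← h4]
  exact add_le_add le_rfl (mul_le_mul_of_nonneg_left (h1.trans h3) (inv_pos.2 he).le)

/-- A function whose second and fourth derivatives obey the layer bounds of component `i`. -/
structure LayerFn {D : ParabolicData n} (s : D.Sol) (i : ℕ) (C : ℝ) where
  v : ℝ → ℝ
  v1 : ℝ → ℝ
  v2 : ℝ → ℝ
  v3 : ℝ → ℝ
  v4 : ℝ → ℝ
  d1 : ∀ y, HasDerivAt v (v1 y) y
  d2 : ∀ y, HasDerivAt v1 (v2 y) y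
  d3 : ∀ y, HasDerivAt v2 (v3 y) y
  d4 : ∀ y, HasDerivAt v3 (v4 y) y
  second : ∀ x ∈ Set.Icc (0:ℝ) 1,
    |v2 x| ≤ C * (1 + ∑ q ∈ Finset.Icc i n, (s.ε q)⁻¹ * layer D.α (s.ε q) x)
  fourth : ∀ x ∈ Set.Icc (0:ℝ) 1,
    |s.ε i * v4 x| ≤ C * (1 + ∑ q ∈ Finset.Icc 1 n, (s.ε q)⁻¹ * layer D.α (s.ε q) x)

namespace LayerFn

variable {D : ParabolicData n} {s : D.Sol} {i : ℕ} {C : ℝ}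

/-- The reflection `x ↦ 1 - x`. -/
def reflect (w : LayerFn s i C) : LayerFn s i C where
  v y := w.v (1 - y)
  v1 y := -w.v1 (1 - y)
  v2 y := w.v2 (1 - y)
  v3 y := -w.v3 (1 - y)
  v4 y := w.v4 (1 - y)
  d1 y := by
    have := (w.d1 (1 - y)).comp y ((hasDerivAt_id y).const_sub 1)
    exact this.congr_deriv (by simp)
  d2 y := by
    have := ((w.d2 (1 - y)).comp y ((hasDerivAt_id y).const_sub 1)).neg
    exact this.congr_deriv (by simp)
  d3 y := by
    have := (w.d3 (1 - y)).comp y ((hasDerivAt_id y).const_sub 1)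
    exact this.congr_deriv (by simp)
  d4 y := by
    have := ((w.d4 (1 - y)).comp y ((hasDerivAt_id y).const_sub 1)).neg
    exact this.congr_deriv (by simp)
  second x hx := by
    have := w.second (1 - x) ⟨by linarith [hx.2], by linarith [hx.1]⟩
    simpa only [layer_reflect] using this
  fourth x hx := by
    have := w.fourth (1 - x) ⟨by linarith [hx.2], by linarith [hx.1]⟩
    simpa only [layer_reflect] using this

theorem truncation_uniform (w : LayerFn s i C) (hC : 0 ≤ C) {F : Finset ℕ}
    (hF : F ⊆ Finset.Icc 1 n) {x h σ : ℝ} (hh : 0 < h) (hσ0 : 0 ≤ σ) (hσ : σ ≤ x - h)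
    (hσ' : x + h ≤ 1 - σ) :
    |s.ε i * (secDiff w.v (x - h) x (x + h) - w.v2 x)| ≤
      C * (1 + 2 / D.α) * (h ^ 2 * (1 + ∑ q ∈ Finset.Icc 1 n \ F, (s.ε q)⁻¹)
        + ∑ q ∈ F, Real.exp (-(√(D.α / s.ε q) * σ))) := by
  have hα := D.α_pos
  have hpos : ∀ q ∈ F, 0 < s.ε q := fun q hq => s.ε_pos q (hF hq)
  have hposc : ∀ q ∈ Finset.Icc 1 n \ F, 0 < s.ε q := fun q hq =>
    s.ε_pos q (Finset.sdiff_subset hq)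
  have hr : ∀ q ∈ F, 0 < D.α / s.ε q := fun q hq => div_pos hα (hpos q hq)
  set K := C * (1 + ∑ q ∈ Finset.Icc 1 n \ F, (s.ε q)⁻¹ * 2) with hK
  have hnear0 : 0 ≤ ∑ q ∈ Finset.Icc 1 n \ F, (s.ε q)⁻¹ :=
    Finset.sum_nonneg fun q hq => (inv_pos.2 (hposc q hq)).le
  set c : ℕ → ℝ := fun q => C * s.ε q / D.α ^ 2 with hc
  have hc0 : ∀ q ∈ F, 0 ≤ c q := fun q hq => by
    have := hpos q hq; simp only [hc]; positivity
  have p1 : ∀ y, HasDerivAt (fun y : ℝ => K * y ^ 4 / 24) (K * y ^ 3 / 6) y := fun y => by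
    refine (((hasDerivAt_pow 4 y).const_mul K).div_const 24).congr_deriv ?_
    norm_num; ring
  have p2 : ∀ y, HasDerivAt (fun y : ℝ => K * y ^ 3 / 6) (K * y ^ 2 / 2) y := fun y => by
    refine (((hasDerivAt_pow 3 y).const_mul K).div_const 6).congr_deriv ?_
    norm_num; ring
  have p3 : ∀ y, HasDerivAt (fun y : ℝ => K * y ^ 2 / 2) (K * y) y := fun y => by
    refine (((hasDerivAt_pow 2 y).const_mul K).div_const 2).congr_deriv ?_
    norm_num; ring
  have p4 : ∀ y, HasDerivAt (fun y : ℝ => K * y) K y := fun y => by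
    simpa using (hasDerivAt_id y).const_mul K
  have l1 : ∀ a : ℕ → ℝ, ∀ y, HasDerivAt (fun y => ∑ q ∈ F, a q * layer D.α (s.ε q) y)
      (∑ q ∈ F, a q * layerDeriv D.α (s.ε q) y) y := fun a y =>
    HasDerivAt.fun_sum fun q _ => (hasDerivAt_layer D.α (s.ε q) y).const_mul (a q)
  have l2 : ∀ a : ℕ → ℝ, ∀ y, HasDerivAt (fun y => ∑ q ∈ F, a q * layerDeriv D.α (s.ε q) y)
      (∑ q ∈ F, (a q * (D.α / s.ε q)) * layer D.α (s.ε q) y) y := fun a y =>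
    (HasDerivAt.fun_sum fun q hq =>
      (hasDerivAt_layerDeriv (hr q hq).le y).const_mul (a q)).congr_deriv
      (Finset.sum_congr rfl fun q _ => by ring)
  have hcmp := abs_secDiff_remainder_le (x := x) hh (fun y => (w.d1 y).const_mul (s.ε i))
    (fun y => (w.d2 y).const_mul (s.ε i)) (fun y => (w.d3 y).const_mul (s.ε i))
    (fun y => (w.d4 y).const_mul (s.ε i)) (fun y => (p1 y).add (l1 c y))
    (fun y => (p2 y).add (l2 c y)) (fun y => (p3 y).add (l1 _ y))
    (fun y => (p4 y).add (l2 _ y)) fun y hy => by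
      have hy01 : y ∈ Set.Icc (0:ℝ) 1 := ⟨by linarith [hy.1], by linarith [hy.2]⟩
      refine (w.fourth y hy01).trans ?_
      rw [← Finset.sum_sdiff hF, ← add_assoc, mul_add, hK]
      refine add_le_add (mul_le_mul_of_nonneg_left (add_le_add le_rfl
        (Finset.sum_le_sum fun q hq => mul_le_mul_of_nonneg_left
          (ParabolicData.layer_le_two hy01) (inv_pos.2 (hposc q hq)).le)) hC) ?_
      rw [Finset.mul_sum]
      refine le_of_eq (Finset.sum_congr rfl fun q hq => ?_)
      have := (hpos q hq).ne'
      simp only [hc]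
      field_simp
  rw [secDiff_const_mul, ← mul_sub] at hcmp
  refine hcmp.trans ?_
  rw [secDiff_add]
  have hq : secDiff (fun y : ℝ => K * y ^ 4 / 24) (x - h) x (x + h)
      = K * x ^ 2 / 2 + K * h ^ 2 / 12 := by
    simp only [secDiff, add_sub_cancel_left, sub_sub_cancel]
    rw [show (x + h - (x - h)) / 2 = h by ring]
    field_simp; ring
  have hS := secDiff_le (m := ∑ q ∈ F, c q * (D.α / s.ε q)
      * (2 * Real.exp (-(√(D.α / s.ε q) * σ)))) (show x - h < x by linarith)
    (show x < x + h by linarith) (l1 c) (l2 c) fun y hy =>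
      Finset.sum_le_sum fun q hq => mul_le_mul_of_nonneg_left
        (layer_le_two_exp (by linarith [hy.1]) (by linarith [hy.2]))
        (mul_nonneg (hc0 q hq) (hr q hq).le)
  have hS0 : 0 ≤ ∑ q ∈ F, c q * (D.α / s.ε q) * layer D.α (s.ε q) x :=
    Finset.sum_nonneg fun q hq => mul_nonneg (mul_nonneg (hc0 q hq) (hr q hq).le)
      (layer_pos _ _ _).le
  have hSe : ∑ q ∈ F, c q * (D.α / s.ε q) * (2 * Real.exp (-(√(D.α / s.ε q) * σ)))
      = C * (2 / D.α) * ∑ q ∈ F, Real.exp (-(√(D.α / s.ε q) * σ)) := by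
    rw [Finset.mul_sum]
    refine Finset.sum_congr rfl fun q hq => ?_
    have := (hpos q hq).ne'
    simp only [hc]
    field_simp
  have hE0 : 0 ≤ ∑ q ∈ F, Real.exp (-(√(D.α / s.ε q) * σ)) :=
    Finset.sum_nonneg fun q _ => (Real.exp_pos _).le
  have hKle : K * h ^ 2 / 12 ≤ C * (h ^ 2 * (1 + ∑ q ∈ Finset.Icc 1 n \ F, (s.ε q)⁻¹)) := by
    rw [hK, ← Finset.sum_mul]
    have : 0 ≤ C * h ^ 2 := by positivity
    nlinarith [mul_nonneg this hnear0]
  rw [hq]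
  rw [hSe] at hS
  have h5 : 0 ≤ C * (2 / D.α) * (h ^ 2 * (1 + ∑ q ∈ Finset.Icc 1 n \ F, (s.ε q)⁻¹)) := by
    positivity
  have h6 : 0 ≤ C * ∑ q ∈ F, Real.exp (-(√(D.α / s.ε q) * σ)) := by positivity
  nlinarith

end LayerFn

namespace LayerFn

variable {D : ParabolicData n} {s : D.Sol} {i : ℕ} {C : ℝ}

/-- The left layer function of component `q`. -/
noncomputable def leftExp (s : D.Sol) (q : ℕ) (y : ℝ) : ℝ := Real.exp (-(√(D.α / s.ε q) * y))

theorem leftExp_pos (q : ℕ) (y : ℝ) : 0 < leftExp s q y := Real.exp_pos _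

theorem leftExp_anti (q : ℕ) {y z : ℝ} (h : y ≤ z) : leftExp s q z ≤ leftExp s q y :=
  Real.exp_le_exp.2 (neg_le_neg (mul_le_mul_of_nonneg_left h (Real.sqrt_nonneg _)))

theorem sum_layer_le {J : Finset ℕ} (hJ : J ⊆ Finset.Icc 1 n) {y : ℝ} (hy : y ≤ 3 / 4) :
    1 + ∑ q ∈ J, (s.ε q)⁻¹ * layer D.α (s.ε q) y ≤
      (1 + n * (32 / D.α)) * (1 + ∑ q ∈ J, (s.ε q)⁻¹ * leftExp s q y) := by
  have hα := D.α_pos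
  have h1 : ∑ q ∈ J, (s.ε q)⁻¹ * layer D.α (s.ε q) y ≤
      ∑ q ∈ J, ((s.ε q)⁻¹ * leftExp s q y + 32 / D.α) :=
    Finset.sum_le_sum fun q hq => inv_mul_layer_le hα (s.ε_pos q (hJ hq)) hy
  rw [Finset.sum_add_distrib, Finset.sum_const, nsmul_eq_mul] at h1
  have h2 : (J.card : ℝ) ≤ n := by
    have := Finset.card_le_card hJ
    rw [Nat.card_Icc, Nat.add_sub_cancel] at this
    exact_mod_cast this
  have h3 : 0 ≤ ∑ q ∈ J, (s.ε q)⁻¹ * leftExp s q y :=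
    Finset.sum_nonneg fun q hq => (mul_pos (inv_pos.2 (s.ε_pos q (hJ hq))) (leftExp_pos q y)).le
  have h4 : (J.card : ℝ) * (32 / D.α) ≤ n * (32 / D.α) :=
    mul_le_mul_of_nonneg_right h2 (by positivity)
  have h5 : (0:ℝ) ≤ n * (32 / D.α) := by positivity
  nlinarith

/-- The amplitude of layer `q` in the scaled third derivative of component `i`. -/
noncomputable def amp (s : D.Sol) (i q : ℕ) : ℝ := min (√(s.ε q))⁻¹ (√(s.ε i) * (s.ε q)⁻¹)

theorem Icc_subset (hi : i ∈ Finset.Icc 1 n) : Finset.Icc i n ⊆ Finset.Icc 1 n := fun q hq => by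
  simp only [Finset.mem_Icc] at *; omega

theorem amp_pos (hi : i ∈ Finset.Icc 1 n) {q : ℕ} (hq : q ∈ Finset.Icc 1 n) : 0 < amp s i q := by
  have h1 := s.ε_pos i hi
  have h2 := s.ε_pos q hq
  refine lt_min ?_ ?_ <;> positivity

theorem amp_of_le (hi : i ∈ Finset.Icc 1 n) {q : ℕ} (hq : q ∈ Finset.Icc i n) :
    √(s.ε i) * (s.ε q)⁻¹ = amp s i q := by
  have hq1 := Icc_subset hi hq
  have h1 := s.ε_pos i hi
  have h2 := s.ε_pos q hq1
  have h3 : √(s.ε i) ≤ √(s.ε q) := Real.sqrt_le_sqrt (s.ε_mono i hi q hq1 (Finset.mem_Icc.1 hq).1)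
  have h4 : 0 < √(s.ε q) := Real.sqrt_pos.2 h2
  refine (min_eq_right ?_).symm
  rw [← div_eq_mul_inv, div_le_iff₀ h2]
  refine h3.trans (le_of_eq ?_)
  have := Real.mul_self_sqrt h2.le
  field_simp
  linarith

theorem rate_inv {q : ℕ} :
    (√(D.α / s.ε q))⁻¹ = √(s.ε q) * (√D.α)⁻¹ := by
  rw [Real.sqrt_div D.α_pos.le, inv_div, div_eq_mul_inv]

theorem layer_increment_le (hi : i ∈ Finset.Icc 1 n) {q : ℕ} (hq : q ∈ Finset.Icc 1 n)
    {a b : ℝ} (hab : b - a ≤ √(s.ε i)) :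
    (s.ε q)⁻¹ / √(D.α / s.ε q) * (leftExp s q a - leftExp s q b) ≤
      (1 + (√D.α)⁻¹) * (amp s i q * leftExp s q a) := by
  have hα := D.α_pos
  have h1 := s.ε_pos i hi
  have h2 := s.ε_pos q hq
  have h4 : 0 < √(s.ε q) := Real.sqrt_pos.2 h2
  have hl : 0 < √(D.α / s.ε q) := Real.sqrt_pos.2 (div_pos hα h2)
  have hE := leftExp_pos (s := s) q a
  have hE' := leftExp_pos (s := s) q b
  have hd := exp_sub_exp_le (l := √(D.α / s.ε q)) (a := a) (b := b)
  change leftExp s q a - leftExp s q b ≤ √(D.α / s.ε q) * (b - a) * leftExp s q a at hd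
  have hc : 0 < (s.ε q)⁻¹ / √(D.α / s.ε q) := by positivity
  rw [amp]
  rcases min_choice (√(s.ε q))⁻¹ (√(s.ε i) * (s.ε q)⁻¹) with h | h <;> rw [h]
  · calc _ ≤ (s.ε q)⁻¹ / √(D.α / s.ε q) * leftExp s q a :=
          mul_le_mul_of_nonneg_left (by linarith) hc.le
      _ = (√D.α)⁻¹ * ((√(s.ε q))⁻¹ * leftExp s q a) := by
          rw [div_eq_mul_inv, rate_inv]
          have := Real.mul_self_sqrt h2.le
          have e : (s.ε q)⁻¹ = (√(s.ε q))⁻¹ * (√(s.ε q))⁻¹ := by rw [← mul_inv, this]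
          rw [e]; field_simp
      _ ≤ _ := mul_le_mul_of_nonneg_right (by linarith) (by positivity)
  · calc _ ≤ (s.ε q)⁻¹ / √(D.α / s.ε q) * (√(D.α / s.ε q) * (b - a) * leftExp s q a) :=
          mul_le_mul_of_nonneg_left hd hc.le
      _ = (b - a) * ((s.ε q)⁻¹ * leftExp s q a) := by field_simp
      _ ≤ √(s.ε i) * ((s.ε q)⁻¹ * leftExp s q a) :=
          mul_le_mul_of_nonneg_right hab (by positivity)
      _ = 1 * (√(s.ε i) * (s.ε q)⁻¹ * leftExp s q a) := by ring
      _ ≤ _ := mul_le_mul_of_nonneg_right (by linarith [inv_nonneg.2 (Real.sqrt_nonneg D.α)])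
          (by positivity)

theorem third_bound (w : LayerFn s i C) (hi : i ∈ Finset.Icc 1 n) (hC : 0 ≤ C) {z : ℝ}
    (hz : z ∈ Set.Icc (0:ℝ) (1 / 2)) :
    |s.ε i * w.v3 z| ≤ C * (1 + n * (32 / D.α)) * (10 + (√D.α)⁻¹) *
      (√(s.ε i) + ∑ q ∈ Finset.Icc 1 n, amp s i q * leftExp s q z) := by
  have hα := D.α_pos
  have he := s.ε_pos i hi
  set r := √(s.ε i) with hr
  have hr0 : 0 < r := Real.sqrt_pos.2 he
  have hr1 : r ≤ 1 := Real.sqrt_le_one.2 (s.ε_le_one i hi)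
  have hrr : r * r = s.ε i := Real.mul_self_sqrt he.le
  set C1 := C * (1 + n * (32 / D.α)) with hC1
  have hC10 : 0 ≤ C1 := by positivity
  set S1 := ∑ q ∈ Finset.Icc 1 n, amp s i q * leftExp s q z with hS1
  have hterm : ∀ q ∈ Finset.Icc 1 n, 0 ≤ amp s i q * leftExp s q z := fun q hq =>
    (mul_pos (amp_pos hi hq) (leftExp_pos q z)).le
  have hS0 : 0 ≤ S1 := Finset.sum_nonneg hterm
  -- the second derivative to the right of `z`
  have hsec : ∀ y ∈ Set.Icc z (z + r / 4), |s.ε i * w.v2 y| ≤ C1 * r * (r + S1) := fun y hy => by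
    have hy1 : y ≤ 3 / 4 := by linarith [hy.2, hz.2]
    have h1 := (w.second y ⟨hz.1.trans hy.1, by linarith⟩).trans
      (mul_le_mul_of_nonneg_left (sum_layer_le (s := s) (Icc_subset hi) hy1) hC)
    rw [abs_mul, abs_of_pos he]
    have h2 : r * (1 + ∑ q ∈ Finset.Icc i n, (s.ε q)⁻¹ * leftExp s q y) ≤ r + S1 := by
      rw [mul_add, mul_one, Finset.mul_sum]
      refine add_le_add le_rfl (le_trans (Finset.sum_le_sum fun q hq => ?_)
        (Finset.sum_le_sum_of_subset_of_nonneg (Icc_subset hi) fun q hq _ => hterm q hq))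
      rw [← mul_assoc, amp_of_le hi hq]
      exact mul_le_mul_of_nonneg_left (leftExp_anti q hy.1) (amp_pos hi (Icc_subset hi hq)).le
    calc s.ε i * |w.v2 y| ≤ s.ε i * (C1 * (1 + ∑ q ∈ Finset.Icc i n, (s.ε q)⁻¹ * leftExp s q y)) :=
          mul_le_mul_of_nonneg_left (by rw [hC1, mul_assoc]; exact h1) he.le
      _ = C1 * r * (r * (1 + ∑ q ∈ Finset.Icc i n, (s.ε q)⁻¹ * leftExp s q y)) := by
          rw [← hrr]; ring
      _ ≤ _ := mul_le_mul_of_nonneg_left h2 (by positivity)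
  have hd3 : ∀ y, HasDerivAt (fun y => s.ε i * w.v2 y) (s.ε i * w.v3 y) y :=
    fun y => (w.d3 y).const_mul _
  have hd4 : ∀ y, HasDerivAt (fun y => s.ε i * w.v3 y) (s.ε i * w.v4 y) y :=
    fun y => (w.d4 y).const_mul _
  obtain ⟨ξ, hξ, hξe⟩ := exists_hasDerivAt_eq_slope _ _ (show z < z + r / 4 by linarith)
    (fun y _ => (hd3 y).continuousAt.continuousWithinAt) (fun y _ => hd3 y)
  have hslope : |s.ε i * w.v3 ξ| ≤ 8 * (C1 * (r + S1)) := by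
    have h1 := hsec z ⟨le_rfl, by linarith⟩
    have h2 := hsec (z + r / 4) ⟨by linarith, le_rfl⟩
    rw [hξe, abs_div, add_sub_cancel_left, abs_of_pos (show 0 < r / 4 by positivity),
      div_le_iff₀ (by positivity)]
    have h3 := abs_sub (s.ε i * w.v2 (z + r / 4)) (s.ε i * w.v2 z)
    linarith
  have hdist := abs_sub_le_of_abs_deriv_le_exp_sum (Q := Finset.Icc 1 n) (a := z) (b := ξ)
    (c := fun q => C1 * (s.ε q)⁻¹) (l := fun q => √(D.α / s.ε q)) (c0 := C1)
    (fun q hq => Real.sqrt_pos.2 (div_pos hα (s.ε_pos q hq))) hξ.1.le hd4 fun y hy => by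
      have hy1 : y ≤ 3 / 4 := by linarith [hy.2, hz.2, hξ.2]
      have h1 := (w.fourth y ⟨hz.1.trans hy.1, by linarith⟩).trans
        (mul_le_mul_of_nonneg_left (sum_layer_le (s := s) subset_rfl hy1) hC)
      refine h1.trans (le_of_eq ?_)
      rw [← mul_assoc, ← hC1, mul_add, mul_one, Finset.mul_sum]
      congr 1
      exact Finset.sum_congr rfl fun q _ => by rw [leftExp]; ring
  have hdist_le : C1 * (ξ - z) + ∑ q ∈ Finset.Icc 1 n, C1 * (s.ε q)⁻¹ / √(D.α / s.ε q) *
      (Real.exp (-(√(D.α / s.ε q) * z)) - Real.exp (-(√(D.α / s.ε q) * ξ)))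
      ≤ C1 * (r + (1 + (√D.α)⁻¹) * S1) := by
    rw [mul_add, hS1, Finset.mul_sum, Finset.mul_sum]
    refine add_le_add (mul_le_mul_of_nonneg_left (by linarith [hξ.2]) hC10)
      (Finset.sum_le_sum fun q hq => ?_)
    rw [mul_div_assoc, mul_assoc]
    exact mul_le_mul_of_nonneg_left
      (layer_increment_le hi hq (by linarith [hξ.2])) hC10
  have hfin := hdist.trans hdist_le
  have h3 := abs_sub_abs_le_abs_sub (s.ε i * w.v3 z) (s.ε i * w.v3 ξ)
  rw [abs_sub_comm] at h3
  have h4 : 0 ≤ (√D.α)⁻¹ := inv_nonneg.2 (Real.sqrt_nonneg _)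
  have h5 : 0 ≤ C1 * ((√D.α)⁻¹ * r) := by positivity
  have h6 : 0 ≤ C1 * r := by positivity
  have h7 : 0 ≤ C1 * S1 := by positivity
  have h8 : C1 * (10 + (√D.α)⁻¹) * (r + S1) = 10 * (C1 * r) + 10 * (C1 * S1)
    + C1 * ((√D.α)⁻¹ * r) + C1 * ((√D.α)⁻¹ * S1) := by ring
  have h9 : C1 * (r + (1 + (√D.α)⁻¹) * S1) = C1 * r + C1 * S1 + C1 * ((√D.α)⁻¹ * S1) := by ring
  rw [h8]
  rw [h9] at hfin
  linarith

/-- The constant in the truncation error bound at transition points. -/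
noncomputable def transitionConst (D : ParabolicData n) : ℝ :=
  2 * ((1 + n * (32 / D.α)) * (10 + (√D.α)⁻¹) * (1 + (√D.α)⁻¹))

theorem transitionConst_pos (D : ParabolicData n) : 0 < transitionConst D := by
  have := D.α_pos
  unfold transitionConst; positivity

theorem truncation_left (w : LayerFn s i C) (hi : i ∈ Finset.Icc 1 n) (hC : 0 ≤ C)
    {F : Finset ℕ} (hF : F ⊆ Finset.Icc 1 n) {a x b h : ℝ} (ha : 0 ≤ a) (hax : a < x)
    (hxb : x < b) (hb : b ≤ 1 / 2) (hah : x - a ≤ h) (hbh : b - x ≤ h) :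
    |s.ε i * (secDiff w.v a x b - w.v2 x)| ≤ C * transitionConst D *
      (∑ q ∈ F, leftExp s q a +
        min (√(s.ε i) * h) (s.ε i) * (1 + ∑ q ∈ Finset.Icc 1 n \ F, (s.ε q)⁻¹)) := by
  have hα := D.α_pos
  have he := s.ε_pos i hi
  have hh : 0 < h := (sub_pos.2 hax).trans_le hah
  set r := √(s.ε i) with hr
  have hr0 : 0 < r := Real.sqrt_pos.2 he
  have hrr : r * r = s.ε i := Real.mul_self_sqrt he.le
  set k := (√D.α)⁻¹ with hk
  have hk0 : 0 < k := inv_pos.2 (Real.sqrt_pos.2 hα)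
  set N1 : ℝ := 1 + n * (32 / D.α) with hN1
  have hN10 : 1 ≤ N1 := by
    have : (0:ℝ) ≤ n * (32 / D.α) := by positivity
    linarith
  set near := ∑ q ∈ Finset.Icc 1 n \ F, (s.ε q)⁻¹ with hnear
  set far := ∑ q ∈ F, leftExp s q a with hfar
  have hnear0 : 0 ≤ near := Finset.sum_nonneg fun q hq =>
    (inv_pos.2 (s.ε_pos q (Finset.sdiff_subset hq))).le
  have hfar0 : 0 ≤ far := Finset.sum_nonneg fun q _ => (leftExp_pos q a).le
  have hconst : transitionConst D = 2 * (N1 * (10 + k) * (1 + k)) := rfl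
  have split : ∀ g : ℕ → ℝ, ∑ q ∈ Finset.Icc 1 n, g q
      = ∑ q ∈ Finset.Icc 1 n \ F, g q + ∑ q ∈ F, g q := fun g =>
    (Finset.sum_sdiff hF).symm
  suffices H : ∀ y ∈ Set.Icc a b, |s.ε i * w.v2 y - s.ε i * w.v2 x| ≤
      C * transitionConst D * (far + min (r * h) (s.ε i) * (1 + near)) by
    have := abs_secDiff_sub_le hax hxb (fun y => (w.d1 y).const_mul (s.ε i))
      (fun y => (w.d2 y).const_mul (s.ε i)) H
    rwa [secDiff_const_mul, ← mul_sub] at this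
  rcases le_total r h with hcase | hcase
  · have hmin : min (r * h) (s.ε i) = s.ε i := min_eq_right (by rw [← hrr]; nlinarith)
    have hv : ∀ y ∈ Set.Icc a b, |s.ε i * w.v2 y| ≤ C * N1 * (far + s.ε i * (1 + near)) := by
      intro y hy
      have hy1 : y ≤ 3 / 4 := by linarith [hy.2]
      have h1 := (w.second y ⟨ha.trans hy.1, by linarith⟩).trans
        (mul_le_mul_of_nonneg_left (sum_layer_le (s := s) (Icc_subset hi) hy1) hC)
      rw [abs_mul, abs_of_pos he]
      have h2 : s.ε i * ∑ q ∈ Finset.Icc i n, (s.ε q)⁻¹ * leftExp s q y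
          ≤ far + s.ε i * near := by
        have hstep : s.ε i * ∑ q ∈ Finset.Icc i n, (s.ε q)⁻¹ * leftExp s q y ≤
            ∑ q ∈ Finset.Icc i n, (if q ∈ F then leftExp s q a else s.ε i * (s.ε q)⁻¹) := by
          rw [Finset.mul_sum]
          refine Finset.sum_le_sum fun q hq => ?_
          have hq1 := Icc_subset hi hq
          have hεq := s.ε_pos q hq1
          rw [← mul_assoc]
          split_ifs with hqF
          · refine (mul_le_of_le_one_left (leftExp_pos q y).le ?_).trans (leftExp_anti q hy.1)
            rw [← div_eq_mul_inv, div_le_one hεq]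
            exact s.ε_mono i hi q hq1 (Finset.mem_Icc.1 hq).1
          · refine mul_le_of_le_one_right (by positivity) (Real.exp_le_one_iff.2 ?_)
            have := mul_nonneg (Real.sqrt_nonneg (D.α / s.ε q)) (ha.trans hy.1)
            linarith
        refine hstep.trans ((Finset.sum_le_sum_of_subset_of_nonneg (Icc_subset hi)
          fun q hq _ => ?_).trans ?_)
        · have := s.ε_pos q hq
          have := leftExp_pos (s := s) q a
          split_ifs <;> positivity
        · rw [split, add_comm, hnear, Finset.mul_sum, hfar]
          refine le_of_eq (congrArg₂ _ (Finset.sum_congr rfl fun q hq => if_pos hq)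
            (Finset.sum_congr rfl fun q hq => if_neg (Finset.mem_sdiff.1 hq).2))
      calc s.ε i * |w.v2 y|
          ≤ s.ε i * (C * (N1 * (1 + ∑ q ∈ Finset.Icc i n, (s.ε q)⁻¹ * leftExp s q y))) :=
            mul_le_mul_of_nonneg_left h1 he.le
        _ = C * N1 * (s.ε i + s.ε i * ∑ q ∈ Finset.Icc i n, (s.ε q)⁻¹ * leftExp s q y) := by ring
        _ ≤ _ := mul_le_mul_of_nonneg_left (by linarith) (by positivity)
    intro y hy
    rw [hmin]
    have h1 := hv y hy
    have h2 := hv x ⟨hax.le, hxb.le⟩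
    have h3 := abs_sub (s.ε i * w.v2 y) (s.ε i * w.v2 x)
    have h4 : 0 ≤ C * N1 * (far + s.ε i * (1 + near)) := by positivity
    have h5 : (1:ℝ) ≤ (10 + k) * (1 + k) := by nlinarith
    have h6 := mul_le_mul_of_nonneg_left h5 h4
    rw [hconst]
    calc _ ≤ 2 * (C * N1 * (far + s.ε i * (1 + near)) * 1) := by linarith
      _ ≤ 2 * (C * N1 * (far + s.ε i * (1 + near)) * ((10 + k) * (1 + k))) := by linarith
      _ = _ := by ring
  · have hmin : min (r * h) (s.ε i) = r * h := min_eq_left (by rw [← hrr]; nlinarith)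
    have key : ∀ y z : ℝ, a ≤ y → y ≤ z → z ≤ b → z - y ≤ h →
        |s.ε i * w.v2 z - s.ε i * w.v2 y| ≤
          C * transitionConst D * (far + r * h * (1 + near)) := by
      intro y z hay hyz hzb hzy
      set C2 := C * N1 * (10 + k) with hC2
      have hC20 : 0 ≤ C2 := by positivity
      have hdist := abs_sub_le_of_abs_deriv_le_exp_sum (Q := Finset.Icc 1 n) (a := y) (b := z)
        (G := fun y => s.ε i * w.v2 y)
        (c := fun q => C2 * amp s i q) (l := fun q => √(D.α / s.ε q)) (c0 := C2 * r)
        (fun q hq => Real.sqrt_pos.2 (div_pos hα (s.ε_pos q hq))) hyz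
        (fun y => (w.d3 y).const_mul (s.ε i)) fun y' hy' => by
          refine (w.third_bound hi hC ⟨ha.trans (hay.trans hy'.1),
            (hy'.2.trans hzb).trans hb⟩).trans (le_of_eq ?_)
          rw [← hC2, mul_add, Finset.mul_sum]
          congr 1
          exact Finset.sum_congr rfl fun q _ => by rw [leftExp]; ring
      refine hdist.trans ?_
      have hterm : ∀ q ∈ Finset.Icc 1 n, C2 * amp s i q / √(D.α / s.ε q) *
          (Real.exp (-(√(D.α / s.ε q) * y)) - Real.exp (-(√(D.α / s.ε q) * z))) ≤
          C2 * (1 + k) * (if q ∈ F then leftExp s q a else r * h * (s.ε q)⁻¹) := by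
        intro q hq
        have hεq := s.ε_pos q hq
        have hl : 0 < √(D.α / s.ε q) := Real.sqrt_pos.2 (div_pos hα hεq)
        have hsq : 0 < √(s.ε q) := Real.sqrt_pos.2 hεq
        have hA := amp_pos (s := s) hi hq
        change C2 * amp s i q / √(D.α / s.ε q) * (leftExp s q y - leftExp s q z) ≤ _
        have e1 : C2 * amp s i q / √(D.α / s.ε q) * (leftExp s q y - leftExp s q z)
            = C2 * (amp s i q / √(D.α / s.ε q) * (leftExp s q y - leftExp s q z)) := by ring
        rw [e1, mul_assoc C2 (1 + k)]
        refine mul_le_mul_of_nonneg_left ?_ hC20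
        split_ifs with hqF
        · have h1 : amp s i q / √(D.α / s.ε q) ≤ k := by
            rw [div_eq_mul_inv, rate_inv]
            calc amp s i q * (√(s.ε q) * k) ≤ (√(s.ε q))⁻¹ * (√(s.ε q) * k) :=
                  mul_le_mul_of_nonneg_right (min_le_left _ _) (by positivity)
              _ = k := by field_simp
          have h2 : leftExp s q y - leftExp s q z ≤ leftExp s q a := by
            linarith [leftExp_anti (s := s) q hay, leftExp_pos (s := s) q z]
          calc amp s i q / √(D.α / s.ε q) * (leftExp s q y - leftExp s q z)
              ≤ amp s i q / √(D.α / s.ε q) * leftExp s q a :=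
                mul_le_mul_of_nonneg_left h2 (by positivity)
            _ ≤ _ := mul_le_mul_of_nonneg_right (by linarith) (leftExp_pos q a).le
        · have hd := exp_sub_exp_le (l := √(D.α / s.ε q)) (a := y) (b := z)
          change leftExp s q y - leftExp s q z ≤ √(D.α / s.ε q) * (z - y) * leftExp s q y at hd
          have hE1 : leftExp s q y ≤ 1 := Real.exp_le_one_iff.2 (by
            have := mul_nonneg hl.le (ha.trans hay)
            linarith)
          have hzy0 : 0 ≤ z - y := sub_nonneg.2 hyz
          calc amp s i q / √(D.α / s.ε q) * (leftExp s q y - leftExp s q z)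
              ≤ amp s i q / √(D.α / s.ε q) * (√(D.α / s.ε q) * (z - y) * leftExp s q y) :=
                mul_le_mul_of_nonneg_left hd (by positivity)
            _ = amp s i q * ((z - y) * leftExp s q y) := by field_simp
            _ ≤ (r * (s.ε q)⁻¹) * (h * 1) :=
                mul_le_mul (min_le_right _ _) (mul_le_mul hzy hE1 (leftExp_pos q y).le hh.le)
                  (mul_nonneg hzy0 (leftExp_pos q y).le) (by positivity)
            _ = 1 * (r * h * (s.ε q)⁻¹) := by ring
            _ ≤ _ := mul_le_mul_of_nonneg_right (by linarith) (by positivity)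
      have hsum := Finset.sum_le_sum hterm
      rw [← Finset.mul_sum, split (fun q => if q ∈ F then leftExp s q a else r * h * (s.ε q)⁻¹),
        Finset.sum_congr rfl (fun q hq => if_neg (Finset.mem_sdiff.1 hq).2),
        Finset.sum_congr rfl (fun q hq => if_pos hq), ← Finset.mul_sum] at hsum
      change _ ≤ C2 * (1 + k) * (r * h * near + far) at hsum
      refine (add_le_add (mul_le_mul_of_nonneg_left hzy (by positivity)) hsum).trans ?_
      have h1 : 0 ≤ C2 * (1 + k) * (far + r * h * (1 + near)) := by positivity
      have h2 : 0 ≤ C2 * k * (r * h) := by positivity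
      have h3 : C * transitionConst D * (far + r * h * (1 + near))
          = 2 * (C2 * (1 + k) * (far + r * h * (1 + near))) := by
        rw [hconst, hC2]; ring
      rw [h3]
      nlinarith
    intro y hy
    rw [hmin]
    rcases le_total x y with hxy | hxy
    · exact key x y hax.le hxy hy.2 (by linarith [hy.2])
    · rw [abs_sub_comm]
      exact key y x hy.1 hxy hxb.le (by linarith [hy.1])

end LayerFn

section Mesh

/-- The transition parameters `σ_r`, extended by `σ_{n+1} = 1/2`. -/
noncomputable def extSigma (α N : ℝ) (ε : ℕ → ℝ) (n r : ℕ) : ℝ :=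
  if r = n + 1 then 1 / 2 else shishkinSigma α N ε n r

variable {α N : ℝ} {ε : ℕ → ℝ}

theorem extSigma_zero : extSigma α N ε n 0 = 0 := by
  rw [extSigma, if_neg (by omega), shishkinSigma, if_pos rfl]

theorem extSigma_top : extSigma α N ε n (n + 1) = 1 / 2 := if_pos rfl

theorem extSigma_of_le {r : ℕ} (h : r ≤ n) : extSigma α N ε n r = shishkinSigma α N ε n r :=
  if_neg (by omega)

theorem extSigma_eq_min {r : ℕ} (h1 : 1 ≤ r) (h2 : r ≤ n) :
    extSigma α N ε n r = min (extSigma α N ε n (r + 1) / 2) (2 * √(ε r / α) * Real.log N) := by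
  rw [extSigma_of_le h2, shishkinSigma, if_neg (by omega)]
  rcases h2.eq_or_lt with rfl | h
  · rw [Nat.sub_self, extSigma_top, shishkinSigmaAux]
    norm_num
  · obtain ⟨m, hm⟩ : ∃ m, n - r = m + 1 := ⟨n - r - 1, by omega⟩
    rw [hm, shishkinSigmaAux, extSigma_of_le h, shishkinSigma, if_neg (by omega),
      show n - (m + 1) = r by omega, show n - (r + 1) = m by omega]

theorem extSigma_pos (hα : 0 < α) (hN : 0 < Real.log N) (hε : ∀ i ∈ Finset.Icc 1 n, 0 < ε i)
    {r : ℕ} (h1 : 1 ≤ r) (h2 : r ≤ n + 1) : 0 < extSigma α N ε n r := by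
  induction h2 using Nat.decreasingInduction with
  | self => rw [extSigma_top]; norm_num
  | of_succ k hk ih =>
    rw [extSigma_eq_min h1 (by omega)]
    have := hε k (Finset.mem_Icc.2 ⟨h1, by omega⟩)
    have h3 := ih (by omega)
    exact lt_min (by positivity) (by positivity)

theorem extSigma_nonneg (hα : 0 < α) (hN : 0 < Real.log N) (hε : ∀ i ∈ Finset.Icc 1 n, 0 < ε i)
    {r : ℕ} (h2 : r ≤ n + 1) : 0 ≤ extSigma α N ε n r := by
  rcases Nat.eq_zero_or_pos r with rfl | h
  · rw [extSigma_zero]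
  · exact (extSigma_pos hα hN hε h h2).le

theorem extSigma_le_half (hα : 0 < α) (hN : 0 < Real.log N) (hε : ∀ i ∈ Finset.Icc 1 n, 0 < ε i)
    {r : ℕ} (h2 : r ≤ n) : extSigma α N ε n r ≤ extSigma α N ε n (r + 1) / 2 := by
  rcases Nat.eq_zero_or_pos r with rfl | h
  · rw [extSigma_zero]
    have := extSigma_pos hα hN hε (r := 0 + 1) (by omega) (by omega)
    linarith
  · rw [extSigma_eq_min h h2]
    exact min_le_left _ _

theorem extSigma_lt_succ (hα : 0 < α) (hN : 0 < Real.log N)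
    (hε : ∀ i ∈ Finset.Icc 1 n, 0 < ε i)
    {r : ℕ} (h2 : r ≤ n) : extSigma α N ε n r < extSigma α N ε n (r + 1) := by
  have h3 := extSigma_le_half hα hN hε h2
  have h4 := extSigma_pos hα hN hε (r := r + 1) (by omega) (by omega)
  linarith

theorem extSigma_mono (hα : 0 < α) (hN : 0 < Real.log N) (hε : ∀ i ∈ Finset.Icc 1 n, 0 < ε i)
    {r s : ℕ} (hrs : r ≤ s) (hs : s ≤ n + 1) : extSigma α N ε n r ≤ extSigma α N ε n s := by
  induction s, hrs using Nat.le_induction with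
  | base => exact le_rfl
  | succ k hk ih => exact (ih (by omega)).trans (extSigma_lt_succ hα hN hε (by omega)).le

/-- A layer which has not decayed at `σ_r` is resolved by the mesh up to `σ_{r+1}`. -/
theorem extSigma_dichotomy (hα : 0 < α) (hN : 0 < Real.log N)
    (hε : ∀ i ∈ Finset.Icc 1 n, 0 < ε i)
    (hmono : ∀ i ∈ Finset.Icc 1 n, ∀ j ∈ Finset.Icc 1 n, i ≤ j → ε i ≤ ε j)
    {q r : ℕ} (hq : q ∈ Finset.Icc 1 n) (hr : r ≤ n)
    (h : √(α / ε q) * extSigma α N ε n r < 2 * Real.log N) :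
    √(α / ε q) * extSigma α N ε n (r + 1) ≤ 4 * Real.log N := by
  have hq' := Finset.mem_Icc.1 hq
  have hεq := hε q hq
  have hl : 0 < √(α / ε q) := Real.sqrt_pos.2 (div_pos hα hεq)
  have hinv : √(α / ε q) * √(ε q / α) = 1 := by
    rw [← Real.sqrt_mul (by positivity)]
    have : α / ε q * (ε q / α) = 1 := by field_simp
    rw [this, Real.sqrt_one]
  rcases lt_or_ge r q with hrq | hrq
  · have h1 := extSigma_mono hα hN hε (r := r + 1) (s := q) (by omega) (by omega)
    have h2 : extSigma α N ε n q ≤ 2 * √(ε q / α) * Real.log N := by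
      rw [extSigma_eq_min hq'.1 hq'.2]; exact min_le_right _ _
    calc _ ≤ √(α / ε q) * (2 * √(ε q / α) * Real.log N) :=
          mul_le_mul_of_nonneg_left (h1.trans h2) hl.le
      _ = √(α / ε q) * √(ε q / α) * (2 * Real.log N) := by ring
      _ ≤ _ := by rw [hinv]; linarith
  · have hr1 : 1 ≤ r := hq'.1.trans hrq
    rw [extSigma_eq_min hr1 hr] at h
    rcases min_choice (extSigma α N ε n (r + 1) / 2) (2 * √(ε r / α) * Real.log N) with h3 | h3
    · rw [h3] at h; linarith
    · rw [h3] at h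
      have h4 : √(ε q / α) ≤ √(ε r / α) := Real.sqrt_le_sqrt
        (div_le_div_of_nonneg_right (hmono q hq r (Finset.mem_Icc.2 ⟨hr1, hr⟩) hrq) hα.le)
      have h5 : √(α / ε q) * √(ε q / α) ≤ √(α / ε q) * √(ε r / α) :=
        mul_le_mul_of_nonneg_left h4 hl.le
      rw [hinv] at h5
      nlinarith

end Mesh

section MeshPieces

variable {α : ℝ} {ε : ℕ → ℝ} {p N : ℕ} {x : ℕ → ℝ}

/-- The mesh indices of the transition points, extended by the right end of the middle piece. -/
def extIdx (n p r : ℕ) : ℕ :=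
  if r = n + 1 then 2 ^ (n + p + 1) - 2 ^ (n + p - 1) else meshIdx p r

/-- The left half of a Shishkin mesh, piece by piece. -/
theorem IsShishkinMesh.pieces (hn : 1 ≤ n) (hα : 0 < α) (hN : 0 < Real.log N)
    (hε : ∀ i ∈ Finset.Icc 1 n, 0 < ε i) (hNp : N = 2 ^ (n + p + 1))
    (hx : IsShishkinMesh α ε n p N x) {r : ℕ} (hr : r ≤ n) :
    ∃ h : ℝ, 0 < h ∧ h ≤ 2 ^ (n + 1) * extSigma α N ε n (r + 1) / N ∧
      extSigma α N ε n r + h ≤ 1 / 2 ∧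
      (∀ j, extIdx n p r ≤ j → j ≤ extIdx n p (r + 1) →
        x j = extSigma α N ε n r + (j - extIdx n p r : ℕ) * h) ∧
      x (extIdx n p (r + 1)) ≤ 1 - extSigma α N ε n r ∧
      x (extIdx n p r) = extSigma α N ε n r := by
  obtain ⟨hx0, hxN, hleft, hmid, hsymm⟩ := hx
  have hlt := extSigma_lt_succ (N := N) hα hN hε hr
  have hnn := extSigma_nonneg (N := N) hα hN hε (r := r) (by omega)
  have htop := extSigma_top (α := α) (N := N) (ε := ε) (n := n)
  have hNR : (N : ℝ) = 2 ^ (n + p + 1) := by rw [hNp]; push_cast; rfl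
  rcases hr.eq_or_lt with rfl | hr'
  · have hr4 := extSigma_le_half (N := N) hα hN hε le_rfl
    rw [htop] at hlt hr4 ⊢
    obtain ⟨m, rfl⟩ : ∃ m, r = m + 1 := ⟨r - 1, by omega⟩
    have hN4 : N = 4 * 2 ^ (m + p) := by rw [hNp]; ring
    have hI : extIdx (m + 1) p (m + 1) = 2 ^ (m + p) := by
      rw [extIdx, if_neg (by omega), meshIdx, if_neg (by omega)]
      congr 1; omega
    have hI' : extIdx (m + 1) p (m + 1 + 1) = 3 * 2 ^ (m + p) := by
      rw [extIdx, if_pos rfl, ← hNp, hN4, show m + 1 + p - 1 = m + p by omega]; omega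
    have hq : N / 4 = 2 ^ (m + p) := by omega
    have hh : N / 2 = 2 * 2 ^ (m + p) := by omega
    have hP : (1:ℝ) ≤ 2 ^ (m + p) := one_le_pow₀ (by norm_num)
    have hNR4 : (N : ℝ) = 4 * 2 ^ (m + p) := by rw [hN4]; push_cast; rfl
    rw [← extSigma_of_le le_rfl] at hmid
    rw [hq, hh] at hmid
    set σ := extSigma α N ε (m + 1) (m + 1)
    have hform : ∀ j, 2 ^ (m + p) ≤ j → j ≤ 3 * 2 ^ (m + p) →
        x j = σ + (j - 2 ^ (m + p) : ℕ) * ((1 - 2 * σ) / (2 * 2 ^ (m + p))) := fun j h1 h2 => by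
      rw [hmid j h1 (by omega)]
      push_cast
      ring
    refine ⟨(1 - 2 * σ) / (2 * 2 ^ (m + p)), ?_, ?_, ?_, ?_, ?_, ?_⟩
    · exact div_pos (by linarith) (by positivity)
    · rw [hNR4, div_le_div_iff₀ (by positivity) (by positivity)]
      have h2 : (2:ℝ) ≤ 2 ^ (m + 1) * 1 := by
        rw [pow_succ]; nlinarith [one_le_pow₀ (n := m) (show (1:ℝ) ≤ 2 by norm_num)]
      have h3 : (0:ℝ) < 2 ^ (m + p) := by positivity
      rw [show m + 1 + 1 = (m + 1) + 1 from rfl, pow_succ (2:ℝ) (m + 1)]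
      nlinarith
    · have : (1 - 2 * σ) / (2 * 2 ^ (m + p)) ≤ (1 - 2 * σ) / 2 :=
        div_le_div_of_nonneg_left (by linarith) (by norm_num) (by linarith)
      linarith
    · rw [hI, hI']; exact hform
    · rw [hI', hform _ (by omega) le_rfl, show 3 * 2 ^ (m + p) - 2 ^ (m + p) = 2 * 2 ^ (m + p) by
        omega]
      push_cast
      refine le_of_eq ?_
      field_simp
      ring
    · rw [hI, hform _ le_rfl (by omega), Nat.sub_self]; simp
  · have hI : extIdx n p r = meshIdx p r := if_neg (by omega)
    have hI' : extIdx n p (r + 1) = meshIdx p (r + 1) := if_neg (by omega)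
    have hpiece := hleft (r + 1) (by omega) hr'
    rw [Nat.add_sub_cancel, ← extSigma_of_le hr, ← extSigma_of_le (r := r + 1) hr'] at hpiece
    have hhalf := extSigma_mono (N := N) hα hN hε (r := r + 1) (s := n + 1) (by omega) le_rfl
    rw [htop] at hhalf
    rw [hI, hI']
    set σ := extSigma α N ε n r
    set τ := extSigma α N ε n (r + 1)
    set m := meshIdx p (r + 1) - meshIdx p r with hm
    have hmle : meshIdx p r ≤ meshIdx p (r + 1) ∧ 2 ^ p ≤ m := by
      rw [hm, meshIdx, meshIdx, if_neg (by omega : r + 1 ≠ 0)]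
      split_ifs with h0
      · subst h0; simp
      · obtain ⟨k, rfl⟩ : ∃ k, r = k + 1 := ⟨r - 1, by omega⟩
        rw [show k + 1 + 1 + p - 1 = (k + p) + 1 by omega, show k + 1 + p - 1 = k + p by omega,
          pow_succ]
        have : 2 ^ p ≤ 2 ^ (k + p) := Nat.pow_le_pow_right (by norm_num) (by omega)
        omega
    obtain ⟨hle, hpm⟩ := hmle
    have hpmR : (2:ℝ) ^ p ≤ m := by exact_mod_cast hpm
    have hp1 : (1:ℝ) ≤ 2 ^ p := one_le_pow₀ (by norm_num)
    have hm0 : (0:ℝ) < m := by linarith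
    have hform : ∀ j, meshIdx p r ≤ j → j ≤ meshIdx p (r + 1) →
        x j = σ + (j - meshIdx p r : ℕ) * ((τ - σ) / m) := fun j h1 h2 => by
      rw [hpiece j h1 h2]; ring
    refine ⟨(τ - σ) / m, div_pos (by linarith) hm0, ?_, ?_, hform, ?_, ?_⟩
    · rw [hNR, show n + p + 1 = (n + 1) + p by omega, pow_add (2:ℝ) (n + 1) p,
        mul_div_mul_left _ _ (by positivity)]
      exact div_le_div₀ (by linarith) (by linarith) (by positivity) hpmR
    · have : (τ - σ) / m ≤ (τ - σ) / 1 :=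
        div_le_div_of_nonneg_left (by linarith) (by norm_num) (by linarith)
      linarith
    · rw [hform _ hle le_rfl, ← hm, mul_div_cancel₀ _ hm0.ne']
      linarith
    · rw [hform _ le_rfl hle, Nat.sub_self]; simp

/-- Three consecutive mesh points inside a uniform piece of the mesh. -/
def UniformTriple (σ : ℕ → ℝ) (n : ℕ) (N a b c : ℝ) : Prop :=
  ∃ r ≤ n, ∃ h, 0 < h ∧ h ≤ 2 ^ (n + 1) * σ (r + 1) / N ∧ a = b - h ∧ c = b + h ∧
    σ r ≤ a ∧ c ≤ 1 - σ r

/-- Three consecutive mesh points around the transition point `σ_r`. -/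
def TransitionTriple (σ : ℕ → ℝ) (n : ℕ) (N a b c : ℝ) : Prop :=
  ∃ r, 1 ≤ r ∧ r ≤ n ∧ b = σ r ∧ 0 ≤ a ∧ a < b ∧ b < c ∧ c ≤ 1 / 2 ∧
    b - a ≤ 2 ^ (n + 1) * σ r / N ∧ c - b ≤ 2 ^ (n + 1) * σ (r + 1) / N

theorem UniformTriple.reflect {σ : ℕ → ℝ} {R a b c : ℝ} (h : UniformTriple σ n R a b c) :
    UniformTriple σ n R (1 - c) (1 - b) (1 - a) := by
  obtain ⟨r, hr, k, h1, h2, h3, h4, h5, h6⟩ := h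
  exact ⟨r, hr, k, h1, h2, by linarith, by linarith, by linarith, by linarith⟩

theorem exists_index_bracket {I : ℕ → ℕ} {j m : ℕ} (h0 : I 0 ≤ j) (hm : j < I (m + 1)) :
    ∃ r ≤ m, I r ≤ j ∧ j < I (r + 1) := by
  induction m with
  | zero => exact ⟨0, le_rfl, h0, hm⟩
  | succ m ih =>
    rcases lt_or_ge j (I (m + 1)) with h | h
    · obtain ⟨r, hr, h1⟩ := ih h
      exact ⟨r, by omega, h1⟩
    · exact ⟨m + 1, le_rfl, h, hm⟩

theorem meshIdx_lt_succ (r : ℕ) : meshIdx p r < meshIdx p (r + 1) := by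
  rw [meshIdx, meshIdx, if_neg (by omega : r + 1 ≠ 0)]
  split_ifs with h0
  · positivity
  · exact Nat.pow_lt_pow_right (by norm_num) (by omega)

theorem IsShishkinMesh.classify_left (hn : 1 ≤ n) (hα : 0 < α) (hN : 0 < Real.log N)
    (hε : ∀ i ∈ Finset.Icc 1 n, 0 < ε i) (hNp : N = 2 ^ (n + p + 1))
    (hx : IsShishkinMesh α ε n p N x) {j : ℕ} (hj : 0 < j) (hjN : 2 * j ≤ N) :
    UniformTriple (extSigma α N ε n) n N (x (j - 1)) (x j) (x (j + 1)) ∨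
      ((∃ r, 1 ≤ r ∧ r ≤ n ∧ j = meshIdx p r) ∧
        TransitionTriple (extSigma α N ε n) n N (x (j - 1)) (x j) (x (j + 1))) := by
  obtain ⟨r, hr, hrj, hjr⟩ : ∃ r ≤ n, extIdx n p r ≤ j ∧ j < extIdx n p (r + 1) := by
    refine exists_index_bracket ?_ ?_
    · rw [extIdx, if_neg (by omega), meshIdx, if_pos rfl]; omega
    · rw [extIdx, if_pos rfl, ← hNp]
      obtain ⟨m, rfl⟩ : ∃ m, n = m + 1 := ⟨n - 1, by omega⟩
      have hN4 : N = 4 * 2 ^ (m + p) := by rw [hNp]; ring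
      rw [show m + 1 + p - 1 = m + p by omega]
      have : 0 < 2 ^ (m + p) := by positivity
      omega
  obtain ⟨h, h0, hle, hhalf, hform, hend, hstart⟩ := hx.pieces hn hα hN hε hNp hr
  have hj1 := hform (j + 1) (by omega) (by omega)
  have hj0 := hform j hrj hjr.le
  have hsucc : x (j + 1) = x j + h := by
    rw [hj0, hj1, Nat.sub_add_comm hrj]
    push_cast
    ring
  rcases hrj.eq_or_lt with heq | hlt
  · right
    have hIr : extIdx n p r = meshIdx p r := if_neg (by omega)
    rw [hIr] at heq
    have hr1 : 1 ≤ r := by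
      rcases Nat.eq_zero_or_pos r with rfl | h
      · rw [meshIdx, if_pos rfl] at heq; omega
      · exact h
    obtain ⟨m, rfl⟩ : ∃ m, r = m + 1 := ⟨r - 1, by omega⟩
    refine ⟨⟨m + 1, hr1, hr, heq.symm⟩, m + 1, hr1, hr, ?_⟩
    obtain ⟨k, k0, kle, -, kform, -, -⟩ := hx.pieces hn hα hN hε hNp (r := m) (by omega)
    have hIm : extIdx n p m = meshIdx p m := if_neg (by omega)
    have hlt := meshIdx_lt_succ (p := p) m
    rw [hIm, hIr] at kform
    have hp1 := kform (j - 1) (by omega) (by omega)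
    have hp0 := kform j (by omega) (by omega)
    have hpred : x j = x (j - 1) + k := by
      rw [hp1, hp0, show j - meshIdx p m = (j - 1 - meshIdx p m) + 1 by omega]
      push_cast
      ring
    have hb : x j = extSigma α N ε n (m + 1) := by rw [← heq, ← hIr]; exact hstart
    refine ⟨hb, ?_, by linarith, by linarith, by linarith, by linarith, by linarith⟩
    rw [hp1]
    have := extSigma_nonneg (N := N) hα hN hε (r := m) (by omega)
    positivity
  · left
    have hm1 := hform (j - 1) (by omega) (by omega)
    have hpred : x j = x (j - 1) + h := by
      rw [hm1, hj0, show j - extIdx n p r = (j - 1 - extIdx n p r) + 1 by omega]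
      push_cast
      ring
    refine ⟨r, hr, h, h0, hle, by linarith, hsucc, ?_, ?_⟩
    · rw [hm1]
      have : 0 ≤ ((j - 1 - extIdx n p r : ℕ) : ℝ) * h := by positivity
      linarith
    · refine le_trans ?_ hend
      rw [hj1, hform _ (by omega) le_rfl]
      have : ((j + 1 - extIdx n p r : ℕ) : ℝ) ≤ (extIdx n p (r + 1) - extIdx n p r : ℕ) := by
        exact_mod_cast (by omega)
      linarith [mul_le_mul_of_nonneg_right this h0.le]

/-- The indices of all transition points. -/
def transitionIdx (n p N : ℕ) : Finset ℕ :=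
  (Finset.Icc 1 n).image (meshIdx p) ∪ (Finset.Icc 1 n).image (fun r => N - meshIdx p r)

theorem card_transitionIdx_le : (transitionIdx n p N).card ≤ 2 * n := by
  refine (Finset.card_union_le _ _).trans ?_
  have h1 := Finset.card_image_le (s := Finset.Icc 1 n) (f := meshIdx p)
  have h2 := Finset.card_image_le (s := Finset.Icc 1 n) (f := fun r => N - meshIdx p r)
  rw [Nat.card_Icc, Nat.add_sub_cancel] at h1 h2
  omega

theorem le_of_mem_transitionIdx (hNp : N = 2 ^ (n + p + 1)) {J : ℕ}
    (hJ : J ∈ transitionIdx n p N) : J ≤ N := by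
  simp only [transitionIdx, Finset.mem_union, Finset.mem_image, Finset.mem_Icc] at hJ
  rcases hJ with ⟨r, hr, rfl⟩ | ⟨r, hr, rfl⟩
  · rw [meshIdx, if_neg (by omega), hNp]
    exact Nat.pow_le_pow_right (by norm_num) (by omega)
  · exact Nat.sub_le _ _

theorem IsShishkinMesh.classify (hn : 1 ≤ n) (hα : 0 < α) (hN : 0 < Real.log N)
    (hε : ∀ i ∈ Finset.Icc 1 n, 0 < ε i) (hNp : N = 2 ^ (n + p + 1))
    (hx : IsShishkinMesh α ε n p N x) {j : ℕ} (hj : 0 < j) (hjN : j < N) :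
    UniformTriple (extSigma α N ε n) n N (x (j - 1)) (x j) (x (j + 1)) ∨
      (j ∈ transitionIdx n p N ∧
        (TransitionTriple (extSigma α N ε n) n N (x (j - 1)) (x j) (x (j + 1)) ∨
        TransitionTriple (extSigma α N ε n) n N (1 - x (j + 1)) (1 - x j) (1 - x (j - 1)))) := by
  rcases le_total (2 * j) N with h | h
  · rcases hx.classify_left hn hα hN hε hNp hj h with h1 | ⟨⟨r, hr1, hr2, rfl⟩, h2⟩
    · exact Or.inl h1
    · exact Or.inr ⟨Finset.mem_union_left _
        (Finset.mem_image.2 ⟨r, Finset.mem_Icc.2 ⟨hr1, hr2⟩, rfl⟩), Or.inl h2⟩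
  · have hsymm := hx.2.2.2.2
    have h3 := hx.classify_left hn hα hN hε hNp (j := N - j) (by omega) (by omega)
    rw [show N - j - 1 = N - (j + 1) by omega, show N - j + 1 = N - (j - 1) by omega,
      hsymm j hjN.le, hsymm (j + 1) hjN, hsymm (j - 1) (by omega)] at h3
    rcases h3 with h1 | ⟨⟨r, hr1, hr2, hrj⟩, h2⟩
    · refine Or.inl ?_
      have := h1.reflect
      simpa only [sub_sub_cancel] using this
    · exact Or.inr ⟨Finset.mem_union_right _
        (Finset.mem_image.2 ⟨r, Finset.mem_Icc.2 ⟨hr1, hr2⟩, by omega⟩), Or.inr h2⟩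

theorem IsShishkinMesh.lt_succ (hn : 1 ≤ n) (hα : 0 < α) (hN : 0 < Real.log N)
    (hε : ∀ i ∈ Finset.Icc 1 n, 0 < ε i) (hNp : N = 2 ^ (n + p + 1))
    (hx : IsShishkinMesh α ε n p N x) {j : ℕ} (hjN : j < N) : x j < x (j + 1) := by
  have hN4 : 4 ≤ N := by
    rw [hNp]
    exact (show 2 ^ 2 ≤ 2 ^ (n + p + 1) from Nat.pow_le_pow_right (by norm_num) (by omega))
  have key : ∀ m, 0 < m → m < N → x (m - 1) < x m ∧ x m < x (m + 1) := fun m h0 h1 => by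
    rcases hx.classify hn hα hN hε hNp h0 h1 with
      ⟨r, hr, h, h2, h3, h4, h5, h6⟩ | ⟨-, ⟨r, h⟩ | ⟨r, h⟩⟩
    · constructor <;> linarith
    · exact ⟨h.2.2.2.2.1, h.2.2.2.2.2.1⟩
    · exact ⟨by linarith [h.2.2.2.2.2.1], by linarith [h.2.2.2.2.1]⟩
  rcases Nat.eq_zero_or_pos j with rfl | h
  · exact (key 1 (by omega) (by omega)).1
  · exact (key j h hjN).2

end MeshPieces

namespace LayerFn

variable {D : ParabolicData n} {s : D.Sol} {i : ℕ} {C N : ℝ}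

/-- The layers which have decayed at the transition point `σ_r`. -/
noncomputable def decayed (s : D.Sol) (N : ℝ) (r : ℕ) : Finset ℕ :=
  (Finset.Icc 1 n).filter fun q =>
    2 * Real.log N ≤ √(D.α / s.ε q) * extSigma D.α N s.ε n r

theorem sq_mul_sum_inv_le (hN : 0 < N) (hL : 1 ≤ Real.log N) {r : ℕ} (hr : r ≤ n) {h : ℝ}
    (hh : 0 ≤ h) (hle : h ≤ 2 ^ (n + 1) * extSigma D.α N s.ε n (r + 1) / N) :
    h ^ 2 * (1 + ∑ q ∈ Finset.Icc 1 n \ decayed s N r, (s.ε q)⁻¹) ≤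
      4 ^ (n + 1) * (1 + n * (16 / D.α)) * ((N ^ 2)⁻¹ * Real.log N ^ 2) := by
  have hα := D.α_pos
  have hL0 : 0 < Real.log N := by linarith
  set L := Real.log N with hLdef
  set Λ := (N ^ 2)⁻¹ * L ^ 2 with hΛ
  have hΛ0 : 0 < Λ := by positivity
  have e4 : ((2:ℝ) ^ (n + 1)) ^ 2 = 4 ^ (n + 1) := by rw [← pow_mul, mul_comm, pow_mul]; norm_num
  have hsq : ∀ {c m : ℝ}, 0 ≤ c → c ≤ 2 ^ (n + 1) * (m * L) / N →
      c ^ 2 ≤ 4 ^ (n + 1) * m ^ 2 * Λ := fun {c m} h0 h1 => by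
    refine (pow_le_pow_left₀ h0 h1 2).trans (le_of_eq ?_)
    rw [div_pow, mul_pow, mul_pow, e4, hΛ]
    ring
  have hσ : extSigma D.α N s.ε n (r + 1) ≤ 1 / 2 := by
    rw [← extSigma_top (α := D.α) (N := N) (ε := s.ε) (n := n)]
    exact extSigma_mono D.α_pos hL0 s.ε_pos (by omega) le_rfl
  have h1 : h ^ 2 ≤ 4 ^ (n + 1) * Λ := by
    have := hsq (m := 1) hh (hle.trans (div_le_div_of_nonneg_right
      (mul_le_mul_of_nonneg_left (by linarith) (by positivity)) hN.le))
    linarith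
  have h2 : ∀ q ∈ Finset.Icc 1 n \ decayed s N r,
      h ^ 2 * (s.ε q)⁻¹ ≤ 4 ^ (n + 1) * (16 / D.α) * Λ := fun q hq => by
    obtain ⟨hq1, hq2⟩ := Finset.mem_sdiff.1 hq
    have hεq := s.ε_pos q hq1
    have h3 : √(D.α / s.ε q) * extSigma D.α N s.ε n r < 2 * L := by
      by_contra hcon
      exact hq2 (Finset.mem_filter.2 ⟨hq1, not_lt.1 hcon⟩)
    have h4 := extSigma_dichotomy hα hL0 s.ε_pos s.ε_mono hq1 hr h3
    have h5 := hsq (c := √(D.α / s.ε q) * h) (m := 4) (by positivity) (by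
      calc √(D.α / s.ε q) * h
          ≤ √(D.α / s.ε q) * (2 ^ (n + 1) * extSigma D.α N s.ε n (r + 1) / N) :=
            mul_le_mul_of_nonneg_left hle (Real.sqrt_nonneg _)
        _ = 2 ^ (n + 1) * (√(D.α / s.ε q) * extSigma D.α N s.ε n (r + 1)) / N := by ring
        _ ≤ _ := div_le_div_of_nonneg_right (mul_le_mul_of_nonneg_left h4 (by positivity)) hN.le)
    rw [mul_pow, Real.sq_sqrt (by positivity)] at h5
    calc h ^ 2 * (s.ε q)⁻¹ = D.α / s.ε q * h ^ 2 / D.α := by field_simp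
      _ ≤ 4 ^ (n + 1) * 4 ^ 2 * Λ / D.α := div_le_div_of_nonneg_right h5 hα.le
      _ = _ := by ring
  rw [mul_add, mul_one, Finset.mul_sum]
  have h3 := Finset.sum_le_card_nsmul _ _ _ h2
  rw [nsmul_eq_mul] at h3
  have h4 : ((Finset.Icc 1 n \ decayed s N r).card : ℝ) ≤ n := by
    have := Finset.card_le_card (Finset.sdiff_subset (s := Finset.Icc 1 n) (t := decayed s N r))
    rw [Nat.card_Icc, Nat.add_sub_cancel] at this
    exact_mod_cast this
  have h5 := mul_le_mul_of_nonneg_right h4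
    (show 0 ≤ 4 ^ (n + 1) * (16 / D.α) * Λ by positivity)
  linarith

theorem sum_exp_decayed_le (hN : 0 < N) (hL : 1 ≤ Real.log N) {r : ℕ} {y : ℝ}
    (hy : extSigma D.α N s.ε n r * (1 - 2 ^ (n + 1) / N) ≤ y) (hN2 : 2 ^ (n + 1) ≤ N) :
    ∑ q ∈ decayed s N r, Real.exp (-(√(D.α / s.ε q) * y)) ≤
      n * Real.exp (2 ^ (n + 2)) * ((N ^ 2)⁻¹ * Real.log N ^ 2) := by
  set L := Real.log N with hLdef
  have hterm : ∀ q ∈ decayed s N r, Real.exp (-(√(D.α / s.ε q) * y)) ≤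
      Real.exp (2 ^ (n + 2)) * ((N ^ 2)⁻¹ * L ^ 2) := fun q hq => by
    obtain ⟨-, hq2⟩ := Finset.mem_filter.1 hq
    have h1 : (2:ℝ) ^ (n + 1) / N ≤ 1 := (div_le_one hN).2 hN2
    have h2 : 2 * L * (1 - 2 ^ (n + 1) / N) ≤ √(D.α / s.ε q) * y :=
      calc _ ≤ √(D.α / s.ε q) * extSigma D.α N s.ε n r * (1 - 2 ^ (n + 1) / N) :=
            mul_le_mul_of_nonneg_right hq2 (by linarith)
        _ = √(D.α / s.ε q) * (extSigma D.α N s.ε n r * (1 - 2 ^ (n + 1) / N)) := by ring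
        _ ≤ _ := mul_le_mul_of_nonneg_left hy (Real.sqrt_nonneg _)
    have h3 : 2 * L * (2 ^ (n + 1) / N) ≤ 2 ^ (n + 2) := by
      have h4 : L / N ≤ 1 := (div_le_one hN).2 (Real.log_le_self hN.le)
      calc 2 * L * (2 ^ (n + 1) / N) = 2 ^ (n + 2) * (L / N) := by ring
        _ ≤ 2 ^ (n + 2) * 1 := mul_le_mul_of_nonneg_left h4 (by positivity)
        _ = _ := mul_one _
    have h5 : Real.exp (-(2 * L)) = (N ^ 2)⁻¹ := by
      rw [Real.exp_neg, two_mul, Real.exp_add, hLdef, Real.exp_log hN, sq]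
    calc Real.exp (-(√(D.α / s.ε q) * y)) ≤ Real.exp (2 ^ (n + 2) + -(2 * L)) :=
          Real.exp_le_exp.2 (by linarith)
      _ = Real.exp (2 ^ (n + 2)) * ((N ^ 2)⁻¹ * 1) := by rw [Real.exp_add, h5, mul_one]
      _ ≤ _ := by gcongr; nlinarith
  have h3 := Finset.sum_le_card_nsmul _ _ _ hterm
  rw [nsmul_eq_mul] at h3
  have h4 : ((decayed s N r).card : ℝ) ≤ n := by
    have := Finset.card_filter_le (Finset.Icc 1 n)
      (fun q => 2 * Real.log N ≤ √(D.α / s.ε q) * extSigma D.α N s.ε n r)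
    rw [Nat.card_Icc, Nat.add_sub_cancel] at this
    exact_mod_cast this
  refine h3.trans ?_
  rw [mul_assoc]
  exact mul_le_mul_of_nonneg_right h4 (by positivity)

/-- The constant in the truncation error bounds on the Shishkin mesh. -/
noncomputable def truncConst (D : ParabolicData n) : ℝ :=
  (1 + 2 / D.α + transitionConst D) *
    (4 ^ (n + 1) * (1 + n * (16 / D.α)) + n * Real.exp (2 ^ (n + 2)))

theorem truncConst_pos (D : ParabolicData n) : 0 < truncConst D := by
  have := D.α_pos
  have := transitionConst_pos D
  unfold truncConst; positivity

theorem truncation_of_uniformTriple (w : LayerFn s i C) (hC : 0 ≤ C) (hN : 0 < N)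
    (hL : 1 ≤ Real.log N) (hN2 : 2 ^ (n + 1) ≤ N) {a b c : ℝ}
    (h : UniformTriple (extSigma D.α N s.ε n) n N a b c) :
    |s.ε i * (secDiff w.v a b c - w.v2 b)| ≤
      C * truncConst D * ((N ^ 2)⁻¹ * Real.log N ^ 2) := by
  have hα := D.α_pos
  have hL0 : 0 < Real.log N := by linarith
  obtain ⟨r, hr, k, hk, hle, rfl, rfl, hσ, hσ'⟩ := h
  have hσ0 := extSigma_nonneg hα hL0 s.ε_pos (r := r) (by omega)
  have h1 := w.truncation_uniform hC (Finset.filter_subset _ _ : decayed s N r ⊆ _) hk hσ0 hσ hσ'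
  have h2 := sq_mul_sum_inv_le (s := s) hN hL hr hk.le hle
  have h3 := sum_exp_decayed_le (s := s) (r := r) (y := extSigma D.α N s.ε n r) hN hL
    (mul_le_of_le_one_right hσ0 (by
      have : 0 < (2:ℝ) ^ (n + 1) / N := by positivity
      linarith)) hN2
  have ht := transitionConst_pos D
  refine h1.trans ?_
  calc _ ≤ C * (1 + 2 / D.α) * (4 ^ (n + 1) * (1 + n * (16 / D.α)) *
            ((N ^ 2)⁻¹ * Real.log N ^ 2) +
          n * Real.exp (2 ^ (n + 2)) * ((N ^ 2)⁻¹ * Real.log N ^ 2)) :=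
        mul_le_mul_of_nonneg_left (add_le_add h2 h3) (by positivity)
    _ = C * (1 + 2 / D.α) * ((4 ^ (n + 1) * (1 + n * (16 / D.α)) +
          n * Real.exp (2 ^ (n + 2))) * ((N ^ 2)⁻¹ * Real.log N ^ 2)) := by ring
    _ ≤ C * (1 + 2 / D.α + transitionConst D) * ((4 ^ (n + 1) * (1 + n * (16 / D.α)) +
          n * Real.exp (2 ^ (n + 2))) * ((N ^ 2)⁻¹ * Real.log N ^ 2)) :=
        mul_le_mul_of_nonneg_right (mul_le_mul_of_nonneg_left (by linarith) hC) (by positivity)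
    _ = _ := by rw [truncConst]; ring

theorem truncation_of_transitionTriple (w : LayerFn s i C) (hi : i ∈ Finset.Icc 1 n)
    (hC : 0 ≤ C) (hN : 0 < N)
    (hL : 1 ≤ Real.log N) (hN2 : 2 ^ (n + 1) ≤ N) {a b c h : ℝ}
    (ht : TransitionTriple (extSigma D.α N s.ε n) n N a b c) (hh : h = max (b - a) (c - b)) :
    |s.ε i * (secDiff w.v a b c - w.v2 b)| ≤
      C * truncConst D * ((N ^ 2)⁻¹ * Real.log N ^ 2) *
        (1 + min (√(s.ε i) * h) (s.ε i) / h ^ 2) := by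
  have hα := D.α_pos
  have hL0 : 0 < Real.log N := by linarith
  have he := s.ε_pos i hi
  obtain ⟨r, hr1, hr, hb, ha, hab, hbc, hc, hl1, hl2⟩ := ht
  have hba : b - a ≤ h := hh ▸ le_max_left _ _
  have hcb : c - b ≤ h := hh ▸ le_max_right _ _
  have hh0 : 0 < h := (sub_pos.2 hab).trans_le hba
  have hhle : h ≤ 2 ^ (n + 1) * extSigma D.α N s.ε n (r + 1) / N := by
    rw [hh]
    refine max_le (hl1.trans (div_le_div_of_nonneg_right (mul_le_mul_of_nonneg_left
      (extSigma_lt_succ hα hL0 s.ε_pos hr).le (by positivity)) hN.le)) hl2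
  have h1 := w.truncation_left hi hC (Finset.filter_subset _ _ : decayed s N r ⊆ _) ha hab hbc hc
    hba hcb
  have h2 := sq_mul_sum_inv_le (s := s) hN hL hr hh0.le hhle
  have h3 : ∑ q ∈ decayed s N r, leftExp s q a ≤ _ :=
    sum_exp_decayed_le (s := s) (r := r) (y := a) hN hL (by
    rw [hb] at hl1
    calc _ = extSigma D.α N s.ε n r - 2 ^ (n + 1) * extSigma D.α N s.ε n r / N := by ring
      _ ≤ a := by linarith) hN2
  have hT := transitionConst_pos D
  set m := min (√(s.ε i) * h) (s.ε i)
  have hm : 0 < m := lt_min (mul_pos (Real.sqrt_pos.2 he) hh0) he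
  set Λ := (N ^ 2)⁻¹ * Real.log N ^ 2
  have hΛ : 0 < Λ := by positivity
  set near := 1 + ∑ q ∈ Finset.Icc 1 n \ decayed s N r, (s.ε q)⁻¹
  set c1 : ℝ := 4 ^ (n + 1) * (1 + n * (16 / D.α))
  set c2 : ℝ := n * Real.exp (2 ^ (n + 2))
  have hc1 : 0 ≤ c1 := by positivity
  have hc2 : 0 ≤ c2 := by positivity
  have h4 : m * near ≤ c1 * Λ * (m / h ^ 2) :=
    calc m * near = h ^ 2 * near * (m / h ^ 2) := by field_simp
      _ ≤ _ := mul_le_mul_of_nonneg_right h2 (by positivity)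
  have hq : 0 < m / h ^ 2 := by positivity
  refine h1.trans ?_
  calc _ ≤ C * transitionConst D * (c2 * Λ + c1 * Λ * (m / h ^ 2)) :=
        mul_le_mul_of_nonneg_left (add_le_add h3 h4) (by positivity)
    _ ≤ C * transitionConst D * ((c1 + c2) * Λ * (1 + m / h ^ 2)) := by
        refine mul_le_mul_of_nonneg_left ?_ (by positivity)
        have h5 : 0 ≤ c1 * Λ := by positivity
        have h6 : 0 ≤ c2 * Λ * (m / h ^ 2) := by positivity
        linarith
    _ ≤ C * (1 + 2 / D.α + transitionConst D) * ((c1 + c2) * Λ * (1 + m / h ^ 2)) := by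
        have : 0 < 2 / D.α := by positivity
        exact mul_le_mul_of_nonneg_right (mul_le_mul_of_nonneg_left (by linarith) hC)
          (by positivity)
    _ = _ := by rw [truncConst]; ring

theorem truncation_of_reflected_transitionTriple (w : LayerFn s i C) (hi : i ∈ Finset.Icc 1 n)
    (hC : 0 ≤ C) (hN : 0 < N)
    (hL : 1 ≤ Real.log N) (hN2 : 2 ^ (n + 1) ≤ N) {a b c h : ℝ}
    (ht : TransitionTriple (extSigma D.α N s.ε n) n N (1 - c) (1 - b) (1 - a))
    (hh : h = max (b - a) (c - b)) :
    |s.ε i * (secDiff w.v a b c - w.v2 b)| ≤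
      C * truncConst D * ((N ^ 2)⁻¹ * Real.log N ^ 2) *
        (1 + min (√(s.ε i) * h) (s.ε i) / h ^ 2) := by
  have := w.reflect.truncation_of_transitionTriple hi hC hN hL hN2 ht (h := h)
    (by rw [hh, max_comm]; congr 1 <;> ring)
  have e : secDiff w.reflect.v (1 - c) (1 - b) (1 - a) = secDiff w.v a b c :=
    secDiff_reflect w.v a b c
  have e2 : w.reflect.v2 (1 - b) = w.v2 b := congrArg w.v2 (sub_sub_cancel 1 b)
  rwa [e, e2] at this

end LayerFn

theorem discreteL_add {ε : ℕ → ℝ} {A : ℕ → ℕ → ℝ → ℝ → ℝ} {x t : ℕ → ℝ} (Φ Ψ : ℕ → ℕ → ℕ → ℝ)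
    (i j k : ℕ) : discreteL n ε A x t (fun i j k => Φ i j k + Ψ i j k) i j k =
      discreteL n ε A x t Φ i j k + discreteL n ε A x t Ψ i j k := by
  simp only [discreteL, mul_add, Finset.sum_add_distrib]
  ring

theorem discreteL_neg {ε : ℕ → ℝ} {A : ℕ → ℕ → ℝ → ℝ → ℝ} {x t : ℕ → ℝ} (Ψ : ℕ → ℕ → ℕ → ℝ)
    (i j k : ℕ) : discreteL n ε A x t (fun i j k => -Ψ i j k) i j k =
      -discreteL n ε A x t Ψ i j k := by
  simp only [discreteL, mul_neg, Finset.sum_neg_distrib]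
  ring

/-- The discrete maximum principle. -/
theorem ParabolicData.discrete_max_principle (D : ParabolicData n) {ε : ℕ → ℝ}
    (hε : ∀ i ∈ Finset.Icc 1 n, 0 < ε i) {N M : ℕ} {x t : ℕ → ℝ}
    (hx : ∀ j < N, x j < x (j + 1)) (hx01 : ∀ j ≤ N, x j ∈ Set.Icc (0:ℝ) 1)
    (ht : ∀ k < M, t k < t (k + 1)) (ht01 : ∀ k ≤ M, t k ∈ Set.Icc 0 D.T)
    {W : ℕ → ℕ → ℕ → ℝ}
    (hL : ∀ i ∈ Finset.Icc 1 n, ∀ j k : ℕ, 0 < j → j < N → 0 < k → k ≤ M →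
      0 ≤ discreteL n ε D.A x t W i j k)
    (hb : ∀ i ∈ Finset.Icc 1 n, ∀ j ≤ N, ∀ k ≤ M, (j = 0 ∨ j = N ∨ k = 0) → 0 ≤ W i j k) :
    ∀ i ∈ Finset.Icc 1 n, ∀ j ≤ N, ∀ k ≤ M, 0 ≤ W i j k := by
  intro i₀ hi₀ j₀ hj₀ k₀ hk₀
  set S := Finset.Icc 1 n ×ˢ Finset.range (N + 1) ×ˢ Finset.range (M + 1) with hS
  obtain ⟨⟨i, j, k⟩, hmem, hmin⟩ := Finset.exists_min_image S (fun q => W q.1 q.2.1 q.2.2)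
    ⟨(i₀, j₀, k₀), by simp only [hS, Finset.mem_product, Finset.mem_range]; exact
      ⟨hi₀, by omega, by omega⟩⟩
  have hmin' : ∀ i' ∈ Finset.Icc 1 n, ∀ j' ≤ N, ∀ k' ≤ M, W i j k ≤ W i' j' k' :=
    fun i' h1 j' h2 k' h3 => hmin (i', j', k') (by
      simp only [hS, Finset.mem_product, Finset.mem_range]; exact ⟨h1, by omega, by omega⟩)
  simp only [hS, Finset.mem_product, Finset.mem_range] at hmem
  obtain ⟨hi, hj, hk⟩ := hmem
  refine le_trans ?_ (hmin' i₀ hi₀ j₀ hj₀ k₀ hk₀)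
  by_contra hneg
  rw [not_le] at hneg
  have hinterior : ¬(j = 0 ∨ j = N ∨ k = 0) := fun h =>
    absurd (hb i hi j (by omega) k (by omega) h) (not_le.2 hneg)
  have h0 := hL i hi j k (by omega) (by omega) (by omega) (by omega)
  have htime : (W i j k - W i j (k - 1)) / (t k - t (k - 1)) ≤ 0 := by
    have h1 := ht (k - 1) (by omega)
    rw [show k - 1 + 1 = k by omega] at h1
    exact div_nonpos_of_nonpos_of_nonneg
      (by linarith [hmin' i hi j (by omega) (k - 1) (by omega)]) (by linarith)
  have hx1 := hx (j - 1) (by omega)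
  rw [show j - 1 + 1 = j by omega] at hx1
  have hx2 := hx j (by omega)
  have hspace : 0 ≤ ((W i (j + 1) k - W i j k) / (x (j + 1) - x j)
      - (W i j k - W i (j - 1) k) / (x j - x (j - 1))) / ((x (j + 1) - x (j - 1)) / 2) := by
    have h1 : 0 ≤ (W i (j + 1) k - W i j k) / (x (j + 1) - x j) :=
      div_nonneg (by linarith [hmin' i hi (j + 1) (by omega) k (by omega)]) (by linarith)
    have h2 : (W i j k - W i (j - 1) k) / (x j - x (j - 1)) ≤ 0 :=
      div_nonpos_of_nonpos_of_nonneg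
        (by linarith [hmin' i hi (j - 1) (by omega) k (by omega)]) (by linarith)
    exact div_nonneg (by linarith) (by linarith)
  have hrow := D.row_sum_ge hi (hx01 j (by omega)) (ht01 k (by omega)) (b := fun l => -W l j k)
    (m := -W i j k) fun l hl => neg_le_neg (hmin' l hl j (by omega) k (by omega))
  simp only [mul_neg, Finset.sum_neg_distrib, sub_self, mul_zero] at hrow
  have hα := D.α_lt _ (hx01 j (by omega)) _ (ht01 k (by omega)) i hi
  have hα0 := D.α_pos
  rw [discreteL] at h0
  have h3 := mul_nonneg (hε i hi).le hspace
  have h4 := mul_pos (hα0.trans hα) (neg_pos.2 hneg)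
  linarith

theorem ParabolicData.discrete_comparison (D : ParabolicData n) {ε : ℕ → ℝ}
    (hε : ∀ i ∈ Finset.Icc 1 n, 0 < ε i) {N M : ℕ} {x t : ℕ → ℝ}
    (hx : ∀ j < N, x j < x (j + 1)) (hx01 : ∀ j ≤ N, x j ∈ Set.Icc (0:ℝ) 1)
    (ht : ∀ k < M, t k < t (k + 1)) (ht01 : ∀ k ≤ M, t k ∈ Set.Icc 0 D.T)
    {W β : ℕ → ℕ → ℕ → ℝ}
    (hL : ∀ i ∈ Finset.Icc 1 n, ∀ j k : ℕ, 0 < j → j < N → 0 < k → k ≤ M →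
      |discreteL n ε D.A x t W i j k| ≤ discreteL n ε D.A x t β i j k)
    (hb : ∀ i ∈ Finset.Icc 1 n, ∀ j ≤ N, ∀ k ≤ M, (j = 0 ∨ j = N ∨ k = 0) →
      |W i j k| ≤ β i j k) :
    ∀ i ∈ Finset.Icc 1 n, ∀ j ≤ N, ∀ k ≤ M, |W i j k| ≤ β i j k := by
  have h1 := D.discrete_max_principle hε hx hx01 ht ht01 (W := fun i j k => β i j k + W i j k)
    (fun i hi j k a b c d => by
      rw [discreteL_add]; linarith [neg_abs_le (discreteL n ε D.A x t W i j k), hL i hi j k a b c d])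
    (fun i hi j hj k hk h => by linarith [neg_abs_le (W i j k), hb i hi j hj k hk h])
  have h2 := D.discrete_max_principle hε hx hx01 ht ht01 (W := fun i j k => β i j k + -W i j k)
    (fun i hi j k a b c d => by
      rw [discreteL_add, discreteL_neg]
      linarith [le_abs_self (discreteL n ε D.A x t W i j k), hL i hi j k a b c d])
    (fun i hi j hj k hk h => by linarith [le_abs_self (W i j k), hb i hi j hj k hk h])
  intro i hi j hj k hk
  have h3 := h1 i hi j hj k hk
  have h4 := h2 i hi j hj k hk
  exact abs_le.2 ⟨by linarith, by linarith⟩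

/-- A barrier with a kink at `y`. -/
noncomputable def bump (κ y z : ℝ) : ℝ := (1 + κ * |z - y|)⁻¹

section Bump

variable {κ y z a b c : ℝ}

theorem bump_pos (hκ : 0 < κ) : 0 < bump κ y z := by
  unfold bump; positivity

theorem bump_le_one (hκ : 0 < κ) : bump κ y z ≤ 1 :=
  inv_le_one_of_one_le₀ (by have := mul_nonneg hκ.le (abs_nonneg (z - y)); linarith)

theorem secDiff_bump_le_of_le (hκ : 0 < κ) (hab : a < b) (hbc : b < c) (hy : y ≤ a) :
    secDiff (bump κ y) a b c ≤ 2 * κ ^ 2 := by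
  have h1 : 0 < b - a := sub_pos.2 hab
  have h2 : 0 < c - b := sub_pos.2 hbc
  have h3 : 0 < c - a := by linarith
  simp only [secDiff, bump, abs_of_nonneg (sub_nonneg.2 hy),
    abs_of_nonneg (sub_nonneg.2 (hy.trans hab.le)),
    abs_of_nonneg (sub_nonneg.2 (hy.trans (hab.trans hbc).le))]
  have hA : 1 ≤ 1 + κ * (a - y) := by nlinarith
  have hB : 1 ≤ 1 + κ * (b - y) := by nlinarith
  have hC : 1 ≤ 1 + κ * (c - y) := by nlinarith
  have key : (((1 + κ * (c - y))⁻¹ - (1 + κ * (b - y))⁻¹) / (c - b)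
      - ((1 + κ * (b - y))⁻¹ - (1 + κ * (a - y))⁻¹) / (b - a)) / ((c - a) / 2)
      = 2 * κ ^ 2 / ((1 + κ * (a - y)) * (1 + κ * (b - y)) * (1 + κ * (c - y))) := by
    have := (zero_lt_one.trans_le hA).ne'
    have := (zero_lt_one.trans_le hB).ne'
    have := (zero_lt_one.trans_le hC).ne'
    field_simp
    ring
  rw [key]
  exact div_le_self (by positivity) (one_le_mul_of_one_le_of_one_le
    (one_le_mul_of_one_le_of_one_le hA hB) hC)

theorem secDiff_bump_le_of_ge (hκ : 0 < κ) (hab : a < b) (hbc : b < c) (hy : c ≤ y) :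
    secDiff (bump κ y) a b c ≤ 2 * κ ^ 2 := by
  have h := secDiff_bump_le_of_le (y := 1 - y) hκ (sub_lt_sub_left hbc 1) (sub_lt_sub_left hab 1)
    (by linarith)
  rw [← secDiff_reflect]
  refine le_of_eq_of_le ?_ h
  congr 1
  funext z
  simp only [bump]
  rw [← abs_neg]
  congr 4
  ring

theorem secDiff_bump_self_le {e h : ℝ} (he : 0 < e) (hab : a < b) (hbc : b < c)
    (hh : h = max (b - a) (c - b)) :
    min (√e * h) e / h ^ 2 ≤ -(e * secDiff (bump (√e)⁻¹ b) a b c) := by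
  have h1 : 0 < b - a := sub_pos.2 hab
  have h2 : 0 < c - b := sub_pos.2 hbc
  have hba : b - a ≤ h := hh ▸ le_max_left _ _
  have hcb : c - b ≤ h := hh ▸ le_max_right _ _
  have hh0 : 0 < h := h1.trans_le hba
  set r := √e with hr
  have hr0 : 0 < r := Real.sqrt_pos.2 he
  have hrr : r * r = e := Real.mul_self_sqrt he.le
  simp only [secDiff, bump, sub_self, abs_zero, mul_zero, abs_of_pos h2,
    abs_sub_comm a b, abs_of_pos h1]
  have key : -(e * ((((1 + r⁻¹ * (c - b))⁻¹ - (1 + 0)⁻¹) / (c - b)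
      - ((1 + 0)⁻¹ - (1 + r⁻¹ * (b - a))⁻¹) / (b - a)) / ((c - a) / 2)))
      = e * ((r + (c - b))⁻¹ + (r + (b - a))⁻¹) / ((c - a) / 2) := by
    have h3 : 0 < c - a := by linarith
    have h4 : 0 < r + (c - b) := by linarith
    have h5 : 0 < r + (b - a) := by linarith
    have e1 : (1 + r⁻¹ * (c - b))⁻¹ = r / (r + (c - b)) := by field_simp
    have e2 : (1 + r⁻¹ * (b - a))⁻¹ = r / (r + (b - a)) := by field_simp
    rw [e1, e2]
    field_simp
    ring
  have key' : e * (2 * (r + h)⁻¹) / h ≤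
      e * ((r + (c - b))⁻¹ + (r + (b - a))⁻¹) / ((c - a) / 2) := by
    have h3 : (r + h)⁻¹ ≤ (r + (c - b))⁻¹ := inv_anti₀ (by linarith) (by linarith)
    have h4 : (r + h)⁻¹ ≤ (r + (b - a))⁻¹ := inv_anti₀ (by linarith) (by linarith)
    have h5 : 0 < (r + h)⁻¹ := by positivity
    exact div_le_div₀ (mul_nonneg he.le (by linarith))
      (mul_le_mul_of_nonneg_left (by linarith) he.le) (by linarith) (by linarith)
  have hfin : min (r * h) e / h ^ 2 ≤ e * (2 * (r + h)⁻¹) / h := by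
    have e3 : e * (2 * (r + h)⁻¹) / h = 2 * e / ((r + h) * h) := by field_simp
    rw [e3, div_le_div_iff₀ (by positivity) (by positivity)]
    rcases le_total r h with hc | hc
    · have : min (r * h) e ≤ e := min_le_right _ _
      calc _ ≤ e * ((r + h) * h) := mul_le_mul_of_nonneg_right this (by positivity)
        _ ≤ e * ((h + h) * h) := by gcongr
        _ = _ := by ring
    · have : min (r * h) e ≤ r * h := min_le_left _ _
      calc _ ≤ r * h * ((r + h) * h) := mul_le_mul_of_nonneg_right this (by positivity)
        _ ≤ r * h * ((r + r) * h) := by gcongr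
        _ = _ := by rw [← hrr]; ring
  refine hfin.trans (key'.trans (le_of_eq ?_))
  rw [← key]

end Bump

theorem secDiff_affine_sum {ι : Type*} (P : Finset ι) (g : ι → ℝ → ℝ) (d e m a b c : ℝ) :
    secDiff (fun z => d + m * (e + ∑ J ∈ P, g J z)) a b c = m * ∑ J ∈ P, secDiff (g J) a b c := by
  simp only [secDiff, ← Finset.sum_div, Finset.sum_sub_distrib]
  ring

theorem monotone_of_lt_succ {N : ℕ} {x : ℕ → ℝ} (hx : ∀ j < N, x j < x (j + 1)) {a b : ℕ}
    (hab : a ≤ b) (hb : b ≤ N) : x a ≤ x b := by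
  induction b, hab using Nat.le_induction with
  | base => exact le_rfl
  | succ k hk ih => exact (ih (by omega)).trans (hx k (by omega)).le

theorem ParabolicData.barrier_bound (D : ParabolicData n) {ε : ℕ → ℝ}
    (hε : ∀ i ∈ Finset.Icc 1 n, 0 < ε i) {N : ℕ} {x t : ℕ → ℝ}
    (hx : ∀ j < N, x j < x (j + 1)) (hx01 : ∀ j ≤ N, x j ∈ Set.Icc (0:ℝ) 1) {K : ℝ}
    (hK : ∀ i ∈ Finset.Icc 1 n, ∀ x ∈ Set.Icc (0:ℝ) 1, ∀ t ∈ Set.Icc 0 D.T, D.A i i x t ≤ K)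
    {P : Finset ℕ} (hP : ∀ J ∈ P, J ≤ N) {m d lam e : ℝ} (hm : (P.card : ℝ) ≤ m)
    (hd : 0 ≤ d) (hlam : 0 ≤ lam) (he : 0 ≤ e) {i : ℕ} (hi : i ∈ Finset.Icc 1 n) {j k : ℕ}
    (hj : 0 < j) (hjN : j < N) (htk : t k ∈ Set.Icc 0 D.T) {h θ : ℝ}
    (hh : h = max (x j - x (j - 1)) (x (j + 1) - x j))
    (hθ : θ = if j ∈ P then min (√(ε i) * h) (ε i) / h ^ 2 else 0) :
    D.α * d + lam * (D.α * e - m * K - 2 * m + θ) ≤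
      discreteL n ε D.A x t
        (fun i j _ => d + lam * (e + ∑ J ∈ P, bump (√(ε i))⁻¹ (x J) (x j))) i j k := by
  have hεi := hε i hi
  have hκ : ∀ l ∈ Finset.Icc 1 n, 0 < (√(ε l))⁻¹ := fun l hl => inv_pos.2 (Real.sqrt_pos.2 (hε l hl))
  have hx1 := hx (j - 1) (by omega)
  rw [show j - 1 + 1 = j by omega] at hx1
  have hx2 := hx j hjN
  have hxj := hx01 j hjN.le
  have hm0 : 0 ≤ m := (Nat.cast_nonneg _).trans hm
  have hspace : θ - 2 * m ≤ ∑ J ∈ P,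
      -(ε i * secDiff (bump (√(ε i))⁻¹ (x J)) (x (j - 1)) (x j) (x (j + 1))) := by
    have hterm : ∀ J ∈ P, -2 + (if J = j then min (√(ε i) * h) (ε i) / h ^ 2 else 0) ≤
        -(ε i * secDiff (bump (√(ε i))⁻¹ (x J)) (x (j - 1)) (x j) (x (j + 1))) := fun J hJ => by
      split_ifs with hJj
      · rw [hJj]
        linarith [secDiff_bump_self_le hεi hx1 hx2 hh]
      · have hle : secDiff (bump (√(ε i))⁻¹ (x J)) (x (j - 1)) (x j) (x (j + 1))
            ≤ 2 * (√(ε i))⁻¹ ^ 2 := by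
          rcases Nat.lt_or_gt_of_ne hJj with hlt | hlt
          · exact secDiff_bump_le_of_le (hκ i hi) hx1 hx2
              (monotone_of_lt_succ hx (by omega) (by omega))
          · exact secDiff_bump_le_of_ge (hκ i hi) hx1 hx2
              (monotone_of_lt_succ hx (by omega) (hP J hJ))
        have h2 := mul_le_mul_of_nonneg_left hle hεi.le
        rw [inv_pow, Real.sq_sqrt hεi.le] at h2
        have h3 : ε i * (2 * (ε i)⁻¹) = 2 := by field_simp
        linarith
    have hsum := Finset.sum_le_sum hterm
    rw [Finset.sum_add_distrib, Finset.sum_const, nsmul_eq_mul, Finset.sum_ite_eq', ← hθ] at hsum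
    linarith
  have hrow1 := D.α_lt _ hxj _ htk i hi
  set S : ℕ → ℝ := fun l => ∑ J ∈ P, bump (√(ε l))⁻¹ (x J) (x j) with hS
  have hS0 : ∀ l ∈ Finset.Icc 1 n, 0 ≤ S l := fun l hl =>
    Finset.sum_nonneg fun J _ => (bump_pos (hκ l hl)).le
  have hSm : ∀ l ∈ Finset.Icc 1 n, S l ≤ m := fun l hl => by
    have := Finset.sum_le_card_nsmul P (fun J => bump (√(ε l))⁻¹ (x J) (x j)) 1
      fun J _ => bump_le_one (hκ l hl)
    rw [nsmul_eq_mul, mul_one] at this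
    exact this.trans hm
  have hrow2 : -(m * K) ≤ ∑ l ∈ Finset.Icc 1 n, D.A i l (x j) (t k) * S l := by
    have h1 := D.row_sum_ge hi hxj htk hSm
    have h2 : 0 ≤ (∑ l ∈ Finset.Icc 1 n, D.A i l (x j) (t k)) * m :=
      mul_nonneg (D.α_pos.trans hrow1).le hm0
    have hA0 : 0 ≤ D.A i i (x j) (t k) :=
      (Finset.sum_nonneg fun l _ => abs_nonneg _).trans (D.A_diag i hi _ hxj _ htk).le
    have h3 : D.A i i (x j) (t k) * (m - S i) ≤ K * m :=
      mul_le_mul (hK i hi _ hxj _ htk) (by linarith [hS0 i hi]) (by linarith [hSm i hi])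
        (hA0.trans (hK i hi _ hxj _ htk))
    linarith
  have hLeq : discreteL n ε D.A x t
        (fun i j _ => d + lam * (e + ∑ J ∈ P, bump (√(ε i))⁻¹ (x J) (x j))) i j k =
      lam * ∑ J ∈ P, -(ε i * secDiff (bump (√(ε i))⁻¹ (x J)) (x (j - 1)) (x j) (x (j + 1))) +
        ((∑ l ∈ Finset.Icc 1 n, D.A i l (x j) (t k)) * (d + lam * e) +
          lam * ∑ l ∈ Finset.Icc 1 n, D.A i l (x j) (t k) * S l) := by
    have h1 := secDiff_affine_sum P (fun J => bump (√(ε i))⁻¹ (x J)) d e lam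
      (x (j - 1)) (x j) (x (j + 1))
    simp only [secDiff] at h1
    simp only [discreteL, sub_self, zero_div]
    rw [h1]
    simp only [secDiff, Finset.sum_neg_distrib, ← Finset.mul_sum]
    rw [Finset.sum_mul, Finset.mul_sum (f := fun l => D.A i l (x j) (t k) * S l),
      ← Finset.sum_add_distrib]
    have h2 : ∀ l ∈ Finset.Icc 1 n, D.A i l (x j) (t k) * (d + lam * (e + S l)) =
        D.A i l (x j) (t k) * (d + lam * e) + lam * (D.A i l (x j) (t k) * S l) :=
      fun l _ => by ring
    rw [← Finset.sum_congr rfl h2]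
    ring
  rw [hLeq]
  have h4 := mul_le_mul_of_nonneg_left hspace hlam
  have h5 := mul_le_mul_of_nonneg_left hrow2 hlam
  have h6 : D.α * (d + lam * e) ≤
      (∑ l ∈ Finset.Icc 1 n, D.A i l (x j) (t k)) * (d + lam * e) :=
    mul_le_mul_of_nonneg_right hrow1.le (by positivity)
  linarith

theorem Smooth2.abs_dT_sub_slope_le {F : ℝ → ℝ → ℝ} (hF : Smooth2 F) {x a b C : ℝ} (hab : a < b)
    (hC : ∀ s ∈ Set.Icc a b, |_root_.dT (_root_.dT F) x s| ≤ C) :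
    |_root_.dT F x b - (F x b - F x a) / (b - a)| ≤ C * (b - a) := by
  obtain ⟨ξ, hξ, hξe⟩ := exists_hasDerivAt_eq_slope _ _ hab
    (fun y _ => (hF.hasDerivAt_snd x y).continuousAt.continuousWithinAt)
    (fun y _ => hF.hasDerivAt_snd x y)
  rw [← hξe]
  have h1 := (convex_Icc a b).norm_image_sub_le_of_norm_hasDerivWithin_le (f := _root_.dT F x)
    (C := C) (fun y _ => (hF.dT.hasDerivAt_snd x y).hasDerivWithinAt) hC
    (Set.Ioo_subset_Icc_self hξ) (Set.right_mem_Icc.2 hab.le)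
  have h0 : 0 ≤ C := (abs_nonneg _).trans (hC a (Set.left_mem_Icc.2 hab.le))
  rw [Real.norm_eq_abs, Real.norm_eq_abs, abs_of_pos (sub_pos.2 hξ.2)] at h1
  exact h1.trans (mul_le_mul_of_nonneg_left (by linarith [hξ.1]) h0)

/-- The restriction of a solution component to a time level. -/
noncomputable def LayerFn.ofSol {D : ParabolicData n} (s : D.Sol) {C : ℝ} {i : ℕ}
    (hi : i ∈ Finset.Icc 1 n) (t : ℝ)
    (h2 : ∀ x ∈ Set.Icc (0:ℝ) 1, |dX (dX (s.u i)) x t| ≤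
      C * (1 + ∑ q ∈ Finset.Icc i n, (s.ε q)⁻¹ * layer D.α (s.ε q) x))
    (h4 : ∀ x ∈ Set.Icc (0:ℝ) 1, |s.ε i * dX (dX (dX (dX (s.u i)))) x t| ≤
      C * (1 + ∑ q ∈ Finset.Icc 1 n, (s.ε q)⁻¹ * layer D.α (s.ε q) x)) : LayerFn s i C where
  v y := s.u i y t
  v1 y := dX (s.u i) y t
  v2 y := dX (dX (s.u i)) y t
  v3 y := dX (dX (dX (s.u i))) y t
  v4 y := dX (dX (dX (dX (s.u i)))) y t
  d1 y := (s.u_smooth i hi).hasDerivAt_fst y t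
  d2 y := (s.u_smooth i hi).dX.hasDerivAt_fst y t
  d3 y := (s.u_smooth i hi).dX.dX.hasDerivAt_fst y t
  d4 y := (s.u_smooth i hi).dX.dX.dX.hasDerivAt_fst y t
  second := h2
  fourth := h4

/-- The parameter-uniform error estimate on Shishkin meshes. -/
theorem ParabolicData.exists_error_bound (D : ParabolicData n) (hn : 1 ≤ n) :
    ∃ C : ℝ, 0 < C ∧ ∀ s : D.Sol, ∀ p M N : ℕ, 1 ≤ M → N = 2 ^ (n + p + 1) →
      ∀ x : ℕ → ℝ, IsShishkinMesh D.α s.ε n p N x → ∀ U : ℕ → ℕ → ℕ → ℝ,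
        (∀ i ∈ Finset.Icc 1 n, ∀ j k : ℕ, 0 < j → j < N → 0 < k → k ≤ M →
          discreteL n s.ε D.A x (fun k' => (k' : ℝ) * D.T / M) U i j k
            = D.f i (x j) ((k : ℝ) * D.T / M)) →
        (∀ i ∈ Finset.Icc 1 n, ∀ j ≤ N, ∀ k ≤ M, (j = 0 ∨ j = N ∨ k = 0) →
          U i j k = s.u i (x j) ((k : ℝ) * D.T / M)) →
      ∀ i ∈ Finset.Icc 1 n, ∀ j ≤ N, ∀ k ≤ M,
        |U i j k - s.u i (x j) ((k : ℝ) * D.T / M)|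
          ≤ C * ((M : ℝ)⁻¹ + ((N : ℝ) ^ 2)⁻¹ * (Real.log N) ^ 3) := by
  obtain ⟨C, hC0, hC⟩ := D.exists_derivative_bounds
  obtain ⟨K, hK1, hK⟩ := D.exists_diag_bound
  have hα := D.α_pos
  have hT := D.T_pos
  have hQ := LayerFn.truncConst_pos D
  set Q := LayerFn.truncConst D
  set e : ℝ := (1 + 2 * n * K + 2 * (2 * n)) / D.α with he
  have he0 : 0 < e := by positivity
  have hαe : D.α * e = 1 + 2 * n * K + 2 * (2 * n) := by rw [he]; field_simp
  refine ⟨C * D.T / D.α + C * Q * (e + 2 * n), by positivity, ?_⟩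
  intro s p M N hM hNp x hmesh U hU hUb
  have hM0 : (0:ℝ) < M := by exact_mod_cast hM
  have hNR : (N : ℝ) = 2 ^ (n + p + 1) := by rw [hNp]; push_cast; rfl
  have hN0 : (0:ℝ) < N := by rw [hNR]; positivity
  have hN2 : (2:ℝ) ^ (n + 1) ≤ N := by
    rw [hNR]; exact pow_le_pow_right₀ (by norm_num) (by omega)
  have hN4 : (4:ℝ) ≤ N := by
    refine le_trans ?_ hN2
    have := pow_le_pow_right₀ (show (1:ℝ) ≤ 2 by norm_num) (show 2 ≤ n + 1 by omega)
    linarith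
  have hL : 1 ≤ Real.log N := by
    rw [Real.le_log_iff_exp_le hN0]
    linarith [Real.exp_one_lt_d9]
  have hL0 : 0 < Real.log N := by linarith
  have hlt : ∀ j < N, x j < x (j + 1) := fun j hj => hmesh.lt_succ hn hα hL0 s.ε_pos hNp hj
  have hx01 : ∀ j ≤ N, x j ∈ Set.Icc (0:ℝ) 1 := fun j hj => by
    rw [← hmesh.1, ← hmesh.2.1]
    exact ⟨monotone_of_lt_succ hlt (Nat.zero_le _) hj, monotone_of_lt_succ hlt hj le_rfl⟩
  set t : ℕ → ℝ := fun k => (k : ℝ) * D.T / M with htdef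
  have ht01 : ∀ k ≤ M, t k ∈ Set.Icc 0 D.T := fun k hk => by
    have : (k : ℝ) ≤ M := by exact_mod_cast hk
    refine ⟨by positivity, ?_⟩
    rw [htdef, div_le_iff₀ hM0, mul_comm]
    exact mul_le_mul_of_nonneg_left this hT.le
  have htstep : ∀ k, t (k + 1) - t k = D.T / M := fun k => by
    simp only [htdef]; push_cast; ring
  have hstep0 : 0 < D.T / M := by positivity
  have htlt : ∀ k < M, t k < t (k + 1) := fun k _ => by linarith [htstep k]
  set Λ : ℝ := ((N : ℝ) ^ 2)⁻¹ * Real.log N ^ 2 with hΛ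
  have hΛ0 : 0 < Λ := by positivity
  set P := transitionIdx n p N
  have hcard : (P.card : ℝ) ≤ 2 * n := by exact_mod_cast card_transitionIdx_le
  set d : ℝ := C * (D.T / M) / D.α with hd
  have hd0 : 0 ≤ d := by positivity
  have hαd : D.α * d = C * (D.T / M) := by rw [hd]; field_simp
  have hmain := D.discrete_comparison s.ε_pos hlt hx01 htlt ht01
    (W := fun i j k => U i j k + -s.u i (x j) (t k))
    (β := fun i j _ => d + C * Q * Λ * (e + ∑ J ∈ P, bump (√(s.ε i))⁻¹ (x J) (x j))) ?_ ?_
  · intro i hi j hj k hk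
    refine (hmain i hi j hj k hk).trans ?_
    have hsum : ∑ J ∈ P, bump (√(s.ε i))⁻¹ (x J) (x j) ≤ 2 * n := by
      have := Finset.sum_le_card_nsmul P (fun J => bump (√(s.ε i))⁻¹ (x J) (x j)) 1
        fun J _ => bump_le_one (inv_pos.2 (Real.sqrt_pos.2 (s.ε_pos i hi)))
      rw [nsmul_eq_mul, mul_one] at this
      exact this.trans hcard
    have hΛ3 : Λ ≤ ((N : ℝ) ^ 2)⁻¹ * Real.log N ^ 3 :=
      mul_le_mul_of_nonneg_left (pow_le_pow_right₀ hL (by norm_num)) (by positivity)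
    have h1 : d = C * D.T / D.α * (M : ℝ)⁻¹ := by rw [hd]; field_simp
    have hsum0 : 0 ≤ ∑ J ∈ P, bump (√(s.ε i))⁻¹ (x J) (x j) := Finset.sum_nonneg fun J _ =>
      (bump_pos (inv_pos.2 (Real.sqrt_pos.2 (s.ε_pos i hi)))).le
    have h2 : C * Q * Λ * (e + ∑ J ∈ P, bump (√(s.ε i))⁻¹ (x J) (x j)) ≤
        C * Q * (((N : ℝ) ^ 2)⁻¹ * Real.log N ^ 3) * (e + 2 * n) := by
      gcongr
    have h3 : 0 ≤ C * D.T / D.α * (((N : ℝ) ^ 2)⁻¹ * Real.log N ^ 3) := by positivity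
    have h4 : 0 ≤ C * Q * (e + 2 * n) * (M : ℝ)⁻¹ := by positivity
    rw [h1]
    linarith
  · intro i hi j k hj hjN hk hkM
    have htk := ht01 k hkM
    have hxj := hx01 j hjN.le
    set θ : ℝ := if j ∈ P then min (√(s.ε i) * max (x j - x (j - 1)) (x (j + 1) - x j)) (s.ε i) /
      max (x j - x (j - 1)) (x (j + 1) - x j) ^ 2 else 0 with hθ
    have hbar := D.barrier_bound s.ε_pos (t := t) hlt hx01 hK (P := P)
      (fun J hJ => le_of_mem_transitionIdx hNp hJ) hcard hd0
      (show 0 ≤ C * Q * Λ by positivity) he0.le hi hj hjN htk rfl hθ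
    refine le_trans ?_ hbar
    rw [hαd, hαe, discreteL_add, discreteL_neg, hU i hi j k hj hjN hk hkM]
    have hpde := (s.eqn i hi).closed hT
      (((s.u_smooth i hi).dT.sub ((s.u_smooth i hi).dX.dX.const_mul _)).add
        (Smooth2.sum fun l hl => (D.A_smooth i hi l hl).mul (s.u_smooth l hl)))
      (D.f_smooth i hi) _ hxj _ htk
    let w : LayerFn s i C := LayerFn.ofSol s hi (t k) (fun y hy => (hC s i hi y hy _ htk).2.1)
      (fun y hy => (hC s i hi y hy _ htk).2.2)
    have hk1 := htstep (k - 1)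
    rw [show k - 1 + 1 = k by omega] at hk1
    have hdisc : D.f i (x j) (t k) + -discreteL n s.ε D.A x t (fun i j k => s.u i (x j) (t k)) i j k
        = (dT (s.u i) (x j) (t k) - (s.u i (x j) (t k) - s.u i (x j) (t (k - 1))) /
            (t k - t (k - 1))) +
          s.ε i * (secDiff w.v (x (j - 1)) (x j) (x (j + 1)) - w.v2 (x j)) := by
      rw [← hpde]
      simp only [ParabolicData.L, discreteL, secDiff, w, LayerFn.ofSol]
      ring
    change |D.f i (x j) (t k) + -discreteL n s.ε D.A x t (fun i j k => s.u i (x j) (t k)) i j k| ≤ _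
    rw [hdisc]
    have htime := (s.u_smooth i hi).abs_dT_sub_slope_le (x := x j) (a := t (k - 1)) (b := t k)
      (C := C) (by linarith) fun y hy => (hC s i hi (x j) hxj y
        ⟨(ht01 (k - 1) (by omega)).1.trans hy.1, hy.2.trans htk.2⟩).1
    rw [hk1] at htime
    have hθ0 : 0 ≤ θ := by
      rw [hθ]
      have := s.ε_pos i hi
      have h1 := hlt j hjN
      have h2 : 0 < max (x j - x (j - 1)) (x (j + 1) - x j) := lt_max_of_lt_right (by linarith)
      split_ifs <;> positivity
    have hspace : |s.ε i * (secDiff w.v (x (j - 1)) (x j) (x (j + 1)) - w.v2 (x j))| ≤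
        C * Q * Λ * (1 + θ) := by
      rcases hmesh.classify hn hα hL0 s.ε_pos hNp hj hjN with h | ⟨hjP, h | h⟩
      · refine (w.truncation_of_uniformTriple hC0.le hN0 hL hN2 h).trans ?_
        exact le_mul_of_one_le_right (by positivity) (by linarith)
      · rw [hθ, if_pos hjP]
        exact w.truncation_of_transitionTriple hi hC0.le hN0 hL hN2 h rfl
      · rw [hθ, if_pos hjP]
        exact w.truncation_of_reflected_transitionTriple hi hC0.le hN0 hL hN2 h rfl
    rw [hk1]
    refine ((abs_add_le _ _).trans (add_le_add htime hspace)).trans (le_of_eq ?_)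
    ring
  · intro i hi j hj k hk hjk
    have h1 : U i j k = s.u i (x j) (t k) := hUb i hi j hj k hk hjk
    have h2 : 0 ≤ ∑ J ∈ P, bump (√(s.ε i))⁻¹ (x J) (x j) := Finset.sum_nonneg fun J _ =>
      (bump_pos (inv_pos.2 (Real.sqrt_pos.2 (s.ε_pos i hi)))).le
    change |U i j k + -s.u i (x j) (t k)| ≤ _
    rw [h1, add_neg_cancel, abs_zero]
    positivity

end UniformConvergence

/-- **Main parameter-uniform error estimate** (Theorem 3 of the paper):
there is a constant `C`, independent of `ε₁,…,εₙ`, `M` and `N`, such that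
`‖U − u‖ ≤ C(M⁻¹ + N⁻²(ln N)³)`, where `u` is the exact solution of
`Lu = f` on `Ω` with `u = φ` on `Γ`, and `U` solves the discrete problem
`L^{M,N}U = f` at the interior points of the Shishkin mesh with `U = u` at
the boundary mesh points. -/
theorem stmt_19
    (n : ℕ) (hn : 1 ≤ n) (T : ℝ) (hT : 0 < T)
    (A : ℕ → ℕ → ℝ → ℝ → ℝ)
    (hAsmooth : ∀ i ∈ Finset.Icc 1 n, ∀ j ∈ Finset.Icc 1 n,
      ContDiff ℝ (⊤ : ℕ∞) (fun p : ℝ × ℝ => A i j p.1 p.2))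
    (hAdiag : ∀ i ∈ Finset.Icc 1 n, ∀ x ∈ Set.Icc (0:ℝ) 1, ∀ t ∈ Set.Icc (0:ℝ) T,
      ∑ j ∈ (Finset.Icc 1 n).erase i, |A i j x t| < A i i x t)
    (hAoff : ∀ i ∈ Finset.Icc 1 n, ∀ j ∈ Finset.Icc 1 n, i ≠ j →
      ∀ x ∈ Set.Icc (0:ℝ) 1, ∀ t ∈ Set.Icc (0:ℝ) T, A i j x t ≤ 0)
    (α : ℝ) (hα : 0 < α)
    (hαA : ∀ x ∈ Set.Icc (0:ℝ) 1, ∀ t ∈ Set.Icc (0:ℝ) T, ∀ i ∈ Finset.Icc 1 n,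
      α < ∑ j ∈ Finset.Icc 1 n, A i j x t)
    (f φ : ℕ → ℝ → ℝ → ℝ)
    (hfsmooth : ∀ i ∈ Finset.Icc 1 n, ContDiff ℝ (⊤ : ℕ∞) (fun p : ℝ × ℝ => f i p.1 p.2))
    (hφsmooth : ∀ i ∈ Finset.Icc 1 n, ContDiff ℝ (⊤ : ℕ∞) (fun p : ℝ × ℝ => φ i p.1 p.2)) :
    ∃ C : ℝ, 0 < C ∧
      ∀ ε : ℕ → ℝ,
        (∀ i ∈ Finset.Icc 1 n, 0 < ε i) →
        (∀ i ∈ Finset.Icc 1 n, ε i ≤ 1) →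
        (∀ i j : ℕ, 1 ≤ i → i < j → j ≤ n → ε i < ε j) →
        (∀ i ∈ Finset.Icc 1 n, Real.sqrt (ε i) ≤ Real.sqrt α / 6) →
      ∀ p M N : ℕ, 1 ≤ M → N = 2 ^ (n + p + 1) →
      ∀ xm : ℕ → ℝ, IsShishkinMesh α ε n p N xm →
      ∀ u : ℕ → ℝ → ℝ → ℝ,
        (∀ i ∈ Finset.Icc 1 n, ContDiff ℝ (⊤ : ℕ∞) (fun q : ℝ × ℝ => u i q.1 q.2)) →
        -- `u` solves `Lu = f` on `Ω` with `u = φ` on `Γ`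
        (∀ i ∈ Finset.Icc 1 n, ∀ x t : ℝ, 0 < x → x < 1 → 0 < t → t ≤ T →
          deriv (fun s => u i x s) t - ε i * iteratedDeriv 2 (fun y => u i y t) x
            + ∑ j ∈ Finset.Icc 1 n, A i j x t * u j x t = f i x t) →
        (∀ i ∈ Finset.Icc 1 n, ∀ x ∈ Set.Icc (0:ℝ) 1, ∀ t ∈ Set.Icc (0:ℝ) T,
          (x = 0 ∨ x = 1 ∨ t = 0) → u i x t = φ i x t) →
      ∀ U : ℕ → ℕ → ℕ → ℝ,
        -- `U` solves the discrete problem with boundary values `u`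
        (∀ i ∈ Finset.Icc 1 n, ∀ j k : ℕ, 0 < j → j < N → 0 < k → k ≤ M →
          discreteL n ε A xm (fun k' => (k' : ℝ) * T / M) U i j k
            = f i (xm j) ((k : ℝ) * T / M)) →
        (∀ i ∈ Finset.Icc 1 n, ∀ j ≤ N, ∀ k ≤ M, (j = 0 ∨ j = N ∨ k = 0) →
          U i j k = u i (xm j) ((k : ℝ) * T / M)) →
      ∀ i ∈ Finset.Icc 1 n, ∀ j ≤ N, ∀ k ≤ M,
        |U i j k - u i (xm j) ((k : ℝ) * T / M)|
          ≤ C * ((M : ℝ)⁻¹ + ((N : ℝ) ^ 2)⁻¹ * (Real.log N) ^ 3) := by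
  let D : ParabolicData n :=
    ⟨T, hT, A, hAsmooth, hAdiag, hAoff, α, hα, hαA, f, φ, hfsmooth, hφsmooth⟩
  obtain ⟨C, hC, h⟩ := D.exists_error_bound hn
  refine ⟨C, hC, fun ε hpos hle hmono _ p M N hM hN xm hmesh u hu hpde hbdry U hU hUb => ?_⟩
  let s : D.Sol :=
    { ε := ε
      ε_pos := hpos
      ε_le_one := hle
      ε_mono := fun i hi j hj hij => hij.eq_or_lt.elim (fun h => h ▸ le_rfl) fun h =>
        (hmono i j (Finset.mem_Icc.1 hi).1 h (Finset.mem_Icc.1 hj).2).le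
      u := u
      u_smooth := hu
      eqn := fun i hi x hx t ht => by
        have := hpde i hi x t hx.1 hx.2 ht.1 ht.2.le
        rwa [iteratedDeriv_succ, iteratedDeriv_one] at this
      boundary := hbdry }
  exact h s p M N hM hN xm hmesh U hU hUb
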